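/- For β = 2 and integers m ≤ n ≤ A, the joint law of the eigenvalues {λ^l_i}_{1 ≤ i ≤ l ≤ m} of the first m levels of the multilevel β-Jacobi ensemble with parameters (A, n) is supported on interlacing sequences λ^1 ≺ ⋯ ≺ λ^m with all entries in [0, 1], and has joint density with respect to Lebesgue measure equal to C · Δ(λ^m) ∏_{i=1}^m (λ^m_i)^{A + m − n − 1} (1 − λ^m_i)^{n − m} ∏_{l=1}^{m−1} ∏_{i=1}^l (λ^l_i)^{−2} for some positive normalization constant C. -/

import Mathlib

open MeasureTheory ProbabilityTheory Filter Finset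
open scoped ENNReal NNReal BigOperators Classical

noncomputable section

namespace RMT

/-- `Δ(x) = ∏_{i<j<k} (x i - x j)`. -/
def vand (k : ℕ) (x : ℕ → ℝ) : ℝ :=
  ∏ i ∈ range k, ∏ j ∈ range k, if i < j then x i - x j else 1

/-- `Δ^trig(x) = ∏_{i<j<k} (e^{(x i - x j)/2} - e^{(x j - x i)/2})`. -/
def vandTrig (k : ℕ) (x : ℕ → ℝ) : ℝ :=
  ∏ i ∈ range k, ∏ j ∈ range k,
    if i < j then Real.exp ((x i - x j) / 2) - Real.exp ((x j - x i) / 2) else 1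

/-- `Δ(x, y) = ∏_{i<a, j<b} |x i - y j|`. -/
def cross (a b : ℕ) (x y : ℕ → ℝ) : ℝ :=
  ∏ i ∈ range a, ∏ j ∈ range b, |x i - y j|

/-- `|x| = ∑_{i<k} x i`. -/
def asum (k : ℕ) (x : ℕ → ℝ) : ℝ := ∑ i ∈ range k, x i

/-- `x` (of length `a`) interlaces `y` (of length `b`), `a ∈ {b-1, b}`:
`y 0 ≥ x 0 ≥ y 1 ≥ x 1 ≥ ⋯` (0-based). -/
def interlaces (a b : ℕ) (x y : ℕ → ℝ) : Prop :=
  (∀ i, i < a → x i ≤ y i) ∧ ∀ i, i < a → i + 1 < b → y (i + 1) ≤ x i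

/-- `x` is decreasing on its first `k` entries. -/
def decrOn (k : ℕ) (x : ℕ → ℝ) : Prop := ∀ i j, i ≤ j → j < k → x j ≤ x i

/-- strictly decreasing and positive on the first `k` entries -/
def sdecrPos (k : ℕ) (x : ℕ → ℝ) : Prop :=
  (∀ i j, i < j → j < k → x j < x i) ∧ ∀ i, i < k → 0 < x i

/-- Coordinates of a `k`-level triangular array capped at width `n`:
level `l` (0-based) has `min (l+1) n` entries. -/
def coords (k n : ℕ) : Finset (ℕ × ℕ) :=
  (range k ×ˢ range n).filter fun p => p.2 < min (p.1 + 1) n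

/-- The space of `k`-level arrays capped at width `n`. -/
abbrev Arr (k n : ℕ) : Type := { p // p ∈ coords k n } → ℝ

/-- Entry accessor, `0` outside the allowed coordinates. -/
def ent {k n : ℕ} (μ : Arr k n) (l i : ℕ) : ℝ :=
  if h : (l, i) ∈ coords k n then μ ⟨(l, i), h⟩ else 0

/-- Level `l` (1-based) of an `m`-level array; level `0` is the zero sequence. -/
def lev {m n : ℕ} (μ : Arr m n) (l : ℕ) : ℕ → ℝ :=
  fun i => if l = 0 then 0 else ent μ (l - 1) i

/-- Level `l` (1-based) of a Gelfand–Tsetlin pattern with interior `μ`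
(levels `1, …, m-1`) and prescribed top level `lam` (level `m`). -/
def levT {m n : ℕ} (μ : Arr (m - 1) n) (lam : ℕ → ℝ) (l : ℕ) : ℕ → ℝ :=
  fun i => if l = 0 then 0 else if l = m then lam i else ent μ (l - 1) i

/-- The Gelfand–Tsetlin polytope `GT_lam^{(m)}` (interior coordinates). -/
def GTset (m n : ℕ) (lam : ℕ → ℝ) : Set (Arr (m - 1) n) :=
  {μ | ∀ l, 1 ≤ l → l < m →
    interlaces (min l n) (min (l + 1) n) (levT μ lam l) (levT μ lam (l + 1))}

/-- extension of a finite vector by zero -/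
def extF {k : ℕ} (x : Fin k → ℝ) : ℕ → ℝ := fun i => if h : i < k then x ⟨i, h⟩ else 0

/-! ### Multivariate Bessel functions -/

/-- The integral `φ^{n,m}_θ(λ, s)`. -/
def phiB (θ : ℝ) (n m : ℕ) (lam s : ℕ → ℝ) : ℝ :=
  (Real.Gamma θ)⁻¹ ^ (n * (n - 1) / 2 + n * (m - n)) *
    ∫ μ in GTset m n lam,
      (Real.exp (∑ l ∈ Icc 1 m,
          s (l - 1) * (asum (min l n) (levT μ lam l) - asum (min (l - 1) n) (levT μ lam (l - 1)))) *
        ∏ i ∈ range n, levT μ lam n i ^ (θ - 1) / lam i ^ (θ - 1)) *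
      ∏ l ∈ Ico 1 m,
        cross (min l n) (min (l + 1) n) (levT μ lam l) (levT μ lam (l + 1)) ^ (θ - 1) /
          (vand (min l n) (levT μ lam l) ^ (θ - 1) *
            vand (min (l + 1) n) (levT μ lam (l + 1)) ^ (θ - 1))

/-- `Γ(mθ)Γ((m-1)θ)⋯Γ((m-n+1)θ)` -/
def gammaProd (θ : ℝ) (n m : ℕ) : ℝ := ∏ k ∈ Icc (m - n + 1) m, Real.Gamma (k * θ)

/-- The multivariate Bessel function `B^{n,m}_β(λ, s)`, `θ = β/2`. -/
def mvBessel (θ : ℝ) (n m : ℕ) (lam s : ℕ → ℝ) : ℝ :=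
  gammaProd θ n m / Real.Gamma θ ^ n *
    (phiB θ n m lam s / (vand n lam ^ θ * ∏ i ∈ range n, lam i ^ (θ * ((m - n : ℕ) : ℝ))))

/-- The conjugate multivariate Bessel function `B̃^{n,m}_β(λ, s)`. -/
def mvBesselC (θ : ℝ) (n m : ℕ) (lam s : ℕ → ℝ) : ℝ :=
  (Real.Gamma θ)⁻¹ ^ n * (∏ i ∈ range n, lam i ^ (θ - 1)) * mvBessel θ n m lam s

/-! ### Heckman–Opdam hypergeometric functions -/

/-- The integral `Φ^{n,m}_θ(λ, s)`. -/
def phiHO (θ : ℝ) (n m : ℕ) (lam s : ℕ → ℝ) : ℝ :=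
  (Real.Gamma θ)⁻¹ ^ (n * (m - n) + n * (n - 1) / 2) *
    ∫ μ in GTset m n lam,
      (Real.exp (∑ l ∈ Icc 1 m,
          s (l - 1) * (asum (min l n) (levT μ lam l) - asum (min (l - 1) n) (levT μ lam (l - 1)))) *
        ∏ i ∈ range n,
          (1 - Real.exp (-levT μ lam n i)) ^ (θ - 1) / (1 - Real.exp (-lam i)) ^ (θ - 1)) *
      ∏ l ∈ Ico 1 m,
        cross (min l n) (min (l + 1) n) (fun i => Real.exp (-levT μ lam l i))
            (fun i => Real.exp (-levT μ lam (l + 1) i)) ^ (θ - 1) /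
          (vand (min l n) (fun i => Real.exp (-levT μ lam l i)) ^ (θ - 1) *
            vand (min (l + 1) n) (fun i => Real.exp (-levT μ lam (l + 1) i)) ^ (θ - 1)) *
        Real.exp ((θ - 1) * asum (min l n) (levT μ lam l))

/-- The Heckman–Opdam hypergeometric function `F^{n,m}_β(λ, s)`, `θ = β/2`. -/
def hoF (θ : ℝ) (n m : ℕ) (lam s : ℕ → ℝ) : ℝ :=
  gammaProd θ n m / Real.Gamma θ ^ n *
    (phiHO θ n m lam s /
      (vandTrig n lam ^ θ * ∏ i ∈ range n, (1 - Real.exp (-lam i)) ^ (θ * ((m - n : ℕ) : ℝ))))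

/-- The conjugate Heckman–Opdam hypergeometric function `F̃^{n,m}_β(λ, s)`. -/
def hoFC (θ : ℝ) (n m : ℕ) (lam s : ℕ → ℝ) : ℝ :=
  (Real.Gamma θ)⁻¹ ^ n * (∏ i ∈ range n, (1 - Real.exp (-lam i)) ^ (θ - 1)) * hoF θ n m lam s

/-! ### Ensembles -/

/-- Support of an `m`-level ensemble: interlacing chain with non-negative entries. -/
def chainSupp {m n : ℕ} (μ : Arr m n) : Prop :=
  (∀ l, 1 ≤ l → l < m → interlaces (min l n) (min (l + 1) n) (lev μ l) (lev μ (l + 1))) ∧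
  ∀ l i, 1 ≤ l → l ≤ m → i < min l n → 0 ≤ lev μ l i

/-- Unnormalized density of the multivariate Bessel ensemble. -/
def mvbDensity (θ : ℝ) (n m : ℕ) (piv pih : ℕ → ℝ) : Arr m n → ℝ :=
  Set.indicator {μ | chainSupp μ} fun μ =>
    vand (min m n) (lev μ m) ^ θ *
    Real.exp (-θ * ∑ l ∈ Icc 1 m,
      pih (l - 1) * (asum (min l n) (lev μ l) - asum (min (l - 1) n) (lev μ (l - 1)))) *
    (∏ i ∈ range (min m n), lev μ m i ^ (θ * ((n - min n m : ℕ) : ℝ))) *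
    (∏ i ∈ range (min n m), lev μ (min n m) i ^ (θ - 1) / lev μ m i ^ (θ - 1)) *
    (∏ l ∈ Ico 1 m,
      cross (min l n) (min (l + 1) n) (lev μ l) (lev μ (l + 1)) ^ (θ - 1) /
        (vand (min l n) (lev μ l) ^ (θ - 1) * vand (min (l + 1) n) (lev μ (l + 1)) ^ (θ - 1))) *
    mvBesselC θ (min n m) n (lev μ m) fun i => -θ * piv i

/-- Unnormalized density of the Heckman–Opdam ensemble. -/
def hoDensity (θ : ℝ) (n m : ℕ) (piv pih : ℕ → ℝ) : Arr m n → ℝ :=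
  Set.indicator {μ | chainSupp μ} fun μ =>
    vandTrig (min m n) (lev μ m) ^ θ *
    (∏ i ∈ range (min m n), (1 - Real.exp (-lev μ m i)) ^ (θ * ((n - min m n : ℕ) : ℝ))) *
    (∏ i ∈ range (min m n),
      (1 - Real.exp (-lev μ (min m n) i)) ^ (θ - 1) / (1 - Real.exp (-lev μ m i)) ^ (θ - 1)) *
    Real.exp (-θ * ∑ l ∈ Icc 1 m,
      pih (l - 1) * (asum (min l n) (lev μ l) - asum (min (l - 1) n) (lev μ (l - 1)))) *
    (∏ l ∈ Ico 1 m,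
      cross (min l n) (min (l + 1) n) (fun i => Real.exp (-lev μ l i))
          (fun i => Real.exp (-lev μ (l + 1) i)) ^ (θ - 1) /
        (vand (min l n) (fun i => Real.exp (-lev μ l i)) ^ (θ - 1) *
          vand (min (l + 1) n) (fun i => Real.exp (-lev μ (l + 1) i)) ^ (θ - 1)) *
      Real.exp ((θ - 1) * asum (min l n) (lev μ l))) *
    hoFC θ (min m n) n (lev μ m) fun i => -θ * piv i

/-! ### Random matrices -/

instance matMeasurableSpace (m n : ℕ) (α : Type*) [MeasurableSpace α] :
    MeasurableSpace (Matrix (Fin m) (Fin n) α) :=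
  inferInstanceAs (MeasurableSpace (Fin m → Fin n → α))

/-- Eigenvalues (real parts of the roots of the characteristic polynomial, with
multiplicity) of a complex matrix, sorted in decreasing order; `0` beyond index `n`. -/
def eigsDesc {n : ℕ} (M : Matrix (Fin n) (Fin n) ℂ) : ℕ → ℝ := fun i =>
  (((M.charpoly.roots.map Complex.re).toList.insertionSort (· ≥ ·)).getD i 0)

/-- `(B^T B)` for the first `k` rows of `B`. -/
def gramR {n : ℕ} (k : ℕ) (B : ℕ → Fin n → ℝ) : Matrix (Fin n) (Fin n) ℝ :=
  Matrix.of fun a b => ∑ i ∈ range k, B i a * B i b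

/-- `(B^* B)` for the first `k` rows of `B`. -/
def gramC {n : ℕ} (k : ℕ) (B : ℕ → Fin n → ℂ) : Matrix (Fin n) (Fin n) ℂ :=
  Matrix.of fun a b => ∑ i ∈ range k, (starRingEnd ℂ) (B i a) * B i b

/-- decreasing eigenvalues of the level-`k` real Wishart matrix built from rows of `B` -/
def wishEigR {n : ℕ} (k : ℕ) (B : ℕ → Fin n → ℝ) : ℕ → ℝ :=
  eigsDesc ((gramR k B).map Complex.ofReal)

/-- decreasing eigenvalues of the level-`k` complex Wishart matrix built from rows of `B` -/
def wishEigC {n : ℕ} (k : ℕ) (B : ℕ → Fin n → ℂ) : ℕ → ℝ :=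
  eigsDesc (gramC k B)

/-- the multilevel array of nonzero Wishart eigenvalues (real entries) -/
def wishArrR (n m : ℕ) {Ω : Type*} (A : ℕ → Fin n → Ω → ℝ) (ω : Ω) : Arr m n :=
  fun p => wishEigR (p.1.1 + 1) (fun i j => A i j ω) p.1.2

/-- the multilevel array of nonzero Wishart eigenvalues (complex entries) -/
def wishArrC (n m : ℕ) {Ω : Type*} (A : ℕ → Fin n → Ω → ℂ) (ω : Ω) : Arr m n :=
  fun p => wishEigC (p.1.1 + 1) (fun i j => A i j ω) p.1.2

/-- The complex Gaussian distribution with mean `0` and variance `v = E|z|²`. -/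
def complexGaussian (v : ℝ) : Measure ℂ :=
  Measure.map (fun p : ℝ × ℝ => (⟨p.1, p.2⟩ : ℂ))
    ((gaussianReal 0 (v / 2).toNNReal).prod (gaussianReal 0 (v / 2).toNNReal))

/-- Law of the first `m` levels of eigenvalue arrays of the real generalized Wishart
ensemble with parameters `(p, 0)`. -/
def wishartLawR (n m : ℕ) (p : Fin n → ℝ) : Measure (Arr m n) :=
  Measure.map
    (fun Z : Fin m × Fin n → ℝ => fun c : { q // q ∈ coords m n } =>
      wishEigR (c.1.1 + 1) (fun i j => if h : i < m then Z (⟨i, h⟩, j) else 0) c.1.2)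
    (Measure.pi fun q : Fin m × Fin n => gaussianReal 0 ((p q.2)⁻¹).toNNReal)

/-- Law of the first `m` levels of eigenvalue arrays of the complex generalized Wishart
ensemble with parameters `(p, 0)`. -/
def wishartLawC (n m : ℕ) (p : Fin n → ℝ) : Measure (Arr m n) :=
  Measure.map
    (fun Z : Fin m × Fin n → ℂ => fun c : { q // q ∈ coords m n } =>
      wishEigC (c.1.1 + 1) (fun i j => if h : i < m then Z (⟨i, h⟩, j) else 0) c.1.2)
    (Measure.pi fun q : Fin m × Fin n => complexGaussian (p q.2)⁻¹)

/-! ### Haar-type measures and HCIZ integrals -/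

/-- `ν` is the Haar probability measure on the orthogonal group `O(n)` (identified with the
unique left-invariant probability measure carried by `O(n) ⊆ Matrix (Fin n) (Fin n) ℝ`). -/
def IsHaarOrth (n : ℕ) (ν : Measure (Matrix (Fin n) (Fin n) ℝ)) : Prop :=
  IsProbabilityMeasure ν ∧
    ν ((↑(Matrix.orthogonalGroup (Fin n) ℝ) : Set (Matrix (Fin n) (Fin n) ℝ))ᶜ) = 0 ∧
    ∀ U ∈ Matrix.orthogonalGroup (Fin n) ℝ, Measure.map (fun V => U * V) ν = ν

/-- `ν` is the Haar probability measure on the unitary group `U(n)`. -/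
def IsHaarUnitary (n : ℕ) (ν : Measure (Matrix (Fin n) (Fin n) ℂ)) : Prop :=
  IsProbabilityMeasure ν ∧
    ν ((↑(Matrix.unitaryGroup (Fin n) ℂ) : Set (Matrix (Fin n) (Fin n) ℂ))ᶜ) = 0 ∧
    ∀ U ∈ Matrix.unitaryGroup (Fin n) ℂ, Measure.map (fun V => U * V) ν = ν

/-- first `k` entries of `x`, padded with zeros, as a `Fin n`-vector -/
def pad (n : ℕ) (x : ℕ → ℝ) (k : ℕ) : Fin n → ℝ := fun j => if (j : ℕ) < k then x j else 0

/-- The real HCIZ integral `h¹_a(b) = ∫_{O(n)} e^{-Tr(V a Vᵀ b)/2} dν` with `a` of length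
`ka` and `b` of length `kb`, both padded by zeros. -/
def hcizR (n : ℕ) (ν : Measure (Matrix (Fin n) (Fin n) ℝ)) (a : ℕ → ℝ) (ka : ℕ)
    (b : ℕ → ℝ) (kb : ℕ) : ℝ :=
  ∫ V, Real.exp (-(Matrix.trace (V * Matrix.diagonal (pad n a ka) * V.transpose *
    Matrix.diagonal (pad n b kb))) / 2) ∂ν

/-! ### Jacobi matrices -/

/-- `J_l = (X^{An})^* X^{An} ((X^{An})^* X^{An} + (Y^{ln})^* Y^{ln})⁻¹`, real entries. -/
def jacMatR (A n l : ℕ) (X Y : ℕ → ℕ → ℝ) : Matrix (Fin n) (Fin n) ℝ :=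
  (Matrix.of fun a b : Fin n => ∑ i ∈ range A, X i a * X i b) *
    ((Matrix.of fun a b : Fin n => ∑ i ∈ range A, X i a * X i b) +
      Matrix.of fun a b : Fin n => ∑ i ∈ range l, Y i a * Y i b)⁻¹

/-- `J_l`, complex entries. -/
def jacMatC (A n l : ℕ) (X Y : ℕ → ℕ → ℂ) : Matrix (Fin n) (Fin n) ℂ :=
  (Matrix.of fun a b : Fin n => ∑ i ∈ range A, (starRingEnd ℂ) (X i a) * X i b) *
    ((Matrix.of fun a b : Fin n => ∑ i ∈ range A, (starRingEnd ℂ) (X i a) * X i b) +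
      Matrix.of fun a b : Fin n => ∑ i ∈ range l, (starRingEnd ℂ) (Y i a) * Y i b)⁻¹

/-- `λ^l_i` (0-based `i < l`): the `i`-th largest among the `l` smallest eigenvalues of
`J_l` (real case). -/
def jacEigR (A n l : ℕ) (X Y : ℕ → ℕ → ℝ) (i : ℕ) : ℝ :=
  eigsDesc ((jacMatR A n l X Y).map Complex.ofReal) (n - l + i)

/-- `λ^l_i` (complex case). -/
def jacEigC (A n l : ℕ) (X Y : ℕ → ℕ → ℂ) (i : ℕ) : ℝ :=
  eigsDesc (jacMatC A n l X Y) (n - l + i)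

/-! ### q-analysis -/

/-- finite q-Pochhammer `(x; q)_N` -/
def qpoch (x q : ℝ) (N : ℕ) : ℝ := ∏ k ∈ range N, (1 - x * q ^ k)

/-- infinite q-Pochhammer `(x; q)_∞` -/
def qpochInf (x q : ℝ) : ℝ := ∏' k : ℕ, (1 - x * q ^ k)

/-- `f(u) = (tu; q)_∞/(qu; q)_∞` -/
def macf (q t u : ℝ) : ℝ := qpochInf (t * u) q / qpochInf (q * u) q

/-- Macdonald norm constant `b_ν(q, t)` (1-based parts `ν 1 ≥ ν 2 ≥ ⋯ ≥ ν n`, `ν (n+1) = 0`). -/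
def bMac (n : ℕ) (ν : ℕ → ℕ) (q t : ℝ) : ℝ :=
  ∏ l ∈ Icc 1 n, ∏ i ∈ range l,
    qpoch (t ^ (i + 1) * q ^ (ν (l - i) - ν l)) q (ν l - ν (l + 1)) /
      qpoch (t ^ i * q ^ (ν (l - i) - ν l + 1)) q (ν l - ν (l + 1))

/-- Macdonald branching coefficient `ψ^m_{λ/μ}(q, t)` (0-based index sequences). -/
def psiMac (m : ℕ) (lam mu : ℕ → ℝ) (q t : ℝ) : ℝ :=
  ∏ i ∈ range (m - 1), ∏ j ∈ range (m - 1),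
    if i ≤ j then
      macf q t (q ^ (mu i - mu j) * t ^ (j - i)) *
          macf q t (q ^ (lam i - lam (j + 1)) * t ^ (j - i)) /
        (macf q t (q ^ (mu i - lam (j + 1)) * t ^ (j - i)) *
          macf q t (q ^ (lam i - mu j) * t ^ (j - i)))
    else 1

/-- Truncated Macdonald branching coefficient (0-based index sequences of length `n`). -/
def psiMacT (n : ℕ) (lam mu : ℕ → ℝ) (q t : ℝ) : ℝ :=
  (∏ i ∈ range n, ∏ j ∈ range n,
    if i < j then
      macf q t (q ^ (mu i - mu j) * t ^ (j - i)) *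
          macf q t (q ^ (lam i - lam j) * t ^ (j - i - 1)) /
        (macf q t (q ^ (lam i - mu j) * t ^ (j - i)) *
          macf q t (q ^ (mu i - lam j) * t ^ (j - i - 1)))
    else 1) *
  (∏ i ∈ range n, macf q t 1 / macf q t (q ^ (lam i - mu i))) *
  ∏ i ∈ range n, macf q t (q ^ lam i * t ^ (n - 1 - i)) / macf q t (q ^ mu i * t ^ (n - 1 - i))

/-- Transition kernel density of the β = 1 generalized Wishart eigenvalue chain
(`prev` = level `m-1`, argument = level `m`). -/
def wishKer1 (n : ℕ) (piv pih : ℕ → ℝ) (ν : Measure (Matrix (Fin n) (Fin n) ℝ)) (m : ℕ)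
    (prev : ℕ → ℝ) : (ℕ → ℝ) → ℝ :=
  Set.indicator {y | interlaces (min (m - 1) n) (min m n) prev y} fun y =>
    (∏ i ∈ range n, (piv i + pih (m - 1)) ^ ((1 : ℝ) / 2)) /
        (Real.Gamma (m / 2) * Real.Gamma (1 / 2) ^ m) *
      Real.exp (-(1 / 2) * pih (m - 1) * (asum (min m n) y - asum (min (m - 1) n) prev)) *
      ((∏ i ∈ range (min m n),
          y i ^ (((n : ℝ) - min m n - if m ≤ n then 1 else 0) / 2)) /
        ∏ i ∈ range (min (m - 1) n),
          prev i ^ (((n : ℝ) - min (m - 1) n - if m ≤ n then 1 else 0) / 2)) *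
      (hcizR n ν piv n y (min m n) / hcizR n ν piv n prev (min (m - 1) n)) *
      (vand (min m n) y * cross (min m n) (min (m - 1) n) y prev ^ (-(1 : ℝ) / 2))

/-- Support of the multilevel Jacobi ensemble: interlacing with entries in `[0,1]`. -/
def jacSupp {m n : ℕ} (μ : Arr m n) : Prop :=
  (∀ l, 1 ≤ l → l < m → interlaces (min l n) (min (l + 1) n) (lev μ l) (lev μ (l + 1))) ∧
  ∀ l i, 1 ≤ l → l ≤ m → i < min l n → lev μ l i ∈ Set.Icc (0 : ℝ) 1

/-- Unnormalized density of the first `m` levels of the β = 2 Jacobi ensemble. -/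
def jacDens2 (A n m : ℕ) : Arr m n → ℝ :=
  Set.indicator {μ | jacSupp μ} fun μ =>
    vand (min m n) (lev μ m) *
    (∏ i ∈ range (min m n),
      lev μ m i ^ ((A : ℝ) + m - n - 1) * (1 - lev μ m i) ^ ((n : ℝ) - m)) *
    ∏ l ∈ Ico 1 m, ∏ i ∈ range (min l n), lev μ l i ^ (-2 : ℝ)

/-- Unnormalized density of the first `m` levels of the β = 1 Jacobi ensemble. -/
def jacDens1 (A n m : ℕ) : Arr m n → ℝ :=
  Set.indicator {μ | jacSupp μ} fun μ =>
    vand (min m n) (lev μ m) *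
    (∏ i ∈ range (min m n),
      lev μ m i ^ (((A : ℝ) + m - n - 4) / 2) * (1 - lev μ m i) ^ (((n : ℝ) - m + 1) / 2)) *
    ∏ l ∈ Ico 1 m,
      (∏ i ∈ range (min l n), lev μ l i ^ (-1 : ℝ)) * vand (min l n) (lev μ l) *
        cross (min l n) (min (l + 1) n) (lev μ l) (lev μ (l + 1)) ^ (-(1 : ℝ) / 2)

/-- `(X^{An})^T X^{An}` (real). -/
def SxR (A n : ℕ) (X : ℕ → ℕ → ℝ) : Matrix (Fin n) (Fin n) ℝ :=
  Matrix.of fun a b : Fin n => ∑ i ∈ range A, X i a * X i b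

/-- `(X^{An})^* X^{An}` (complex). -/
def SxC (A n : ℕ) (X : ℕ → ℕ → ℂ) : Matrix (Fin n) (Fin n) ℂ :=
  Matrix.of fun a b : Fin n => ∑ i ∈ range A, (starRingEnd ℂ) (X i a) * X i b

/-- The array `{λ^l_i}_{1 ≤ i ≤ l ≤ m}` of Jacobi eigenvalues (real case). -/
def jacArrR (A n m : ℕ) (X Y : ℕ → ℕ → ℝ) : Arr m n :=
  fun c => jacEigR A n (c.1.1 + 1) X Y c.1.2

/-- The array `{λ^l_i}_{1 ≤ i ≤ l ≤ m}` of Jacobi eigenvalues (complex case). -/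
def jacArrC (A n m : ℕ) (X Y : ℕ → ℕ → ℂ) : Arr m n :=
  fun c => jacEigC A n (c.1.1 + 1) X Y c.1.2

/-- The array `{τ^l_i = (λ^l_{l+1-i})⁻¹ - 1}` (real case). -/
def tauArrR (A n m : ℕ) (X Y : ℕ → ℕ → ℝ) : Arr m n :=
  fun c => (eigsDesc ((jacMatR A n (c.1.1 + 1) X Y).map Complex.ofReal) (n - 1 - c.1.2))⁻¹ - 1

/-- The array `{τ^l_i = (λ^l_{l+1-i})⁻¹ - 1}` (complex case). -/
def tauArrC (A n m : ℕ) (X Y : ℕ → ℕ → ℂ) : Arr m n :=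
  fun c => (eigsDesc (jacMatC A n (c.1.1 + 1) X Y) (n - 1 - c.1.2))⁻¹ - 1

set_option linter.unusedVariables false
set_option linter.unusedSimpArgs false

/-! ### The secular map -/

/-- squared weights of a rank one perturbation, from old spectrum `t` and new spectrum `y` -/
def pmap {N : ℕ} (t y : Fin N → ℝ) : Fin N → ℝ := fun i =>
  -(∏ j, (t i - y j)) / ∏ j ∈ univ.erase i, (t i - t j)

/-- strict interlacing `t 0 < y 0 < t 1 < y 1 < ⋯`. -/
def intSet {N : ℕ} (t : Fin N → ℝ) : Set (Fin N → ℝ) :=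
  {y | (∀ i, t i < y i) ∧ ∀ i j, i < j → y i < t j}

lemma intSet_strictMono {N : ℕ} {t y : Fin N → ℝ} (hy : y ∈ intSet t) : StrictMono y :=
  fun i j hij => (hy.2 i j hij).trans (hy.1 j)

lemma isOpen_intSet {N : ℕ} (t : Fin N → ℝ) : IsOpen (intSet t) := by
  have : intSet t = (⋂ i, {y | t i < y i}) ∩ ⋂ i, ⋂ j, {y | i < j → y i < t j} := by
    ext y; simp [intSet]
  rw [this]
  refine IsOpen.inter (isOpen_iInter_of_finite fun i => isOpen_lt continuous_const (continuous_apply i)) ?_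
  refine isOpen_iInter_of_finite fun i => isOpen_iInter_of_finite fun j => ?_
  by_cases h : i < j
  · simpa [h] using isOpen_lt (continuous_apply i) continuous_const
  · simp [h]

open Polynomial in
/-- secular polynomial -/
def secPoly {N : ℕ} (t p : Fin N → ℝ) : ℝ[X] :=
  ∏ j, (X - C (t j)) - ∑ i, C (p i) * ∏ j ∈ univ.erase i, (X - C (t j))

open Polynomial in
lemma secPoly_eval {N : ℕ} (t p : Fin N → ℝ) (i : Fin N) :
    (secPoly t p).eval (t i) = - (p i * ∏ j ∈ univ.erase i, (t i - t j)) := by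
  have h0 : ∏ j, (t i - t j) = 0 := prod_eq_zero (mem_univ i) (sub_self _)
  have h1 : ∀ k ∈ univ, k ≠ i → p k * ∏ j ∈ univ.erase k, (t i - t j) = 0 := by
    intro k _ hk
    rw [prod_eq_zero (i := i) (by simp [Ne.symm hk]) (sub_self _), mul_zero]
  simp only [secPoly, eval_sub, eval_prod, eval_finsetSum, eval_mul, eval_X, eval_C]
  rw [h0, sum_eq_single i h1 (by simp)]
  ring

open Polynomial in
lemma secPoly_eq_of {N : ℕ} (t p y s : Fin N → ℝ) (hs : Function.Injective s)
    (h : ∀ i, (secPoly t p).eval (s i) = ∏ j, (s i - y j)) :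
    secPoly t p = ∏ j, (X - C (y j)) := by
  rcases Nat.eq_zero_or_pos N with rfl | hN
  · simp [secPoly]
  have hd : ∀ x : Fin N → ℝ, (∏ j, (X - C (x j))).degree = ((N : ℕ) : WithBot ℕ) := by
    intro x; rw [degree_prod]; simp
  refine Polynomial.eq_of_degree_sub_lt_of_eval_finset_eq (univ.image s) ?_ ?_
  · rw [card_image_of_injective _ hs, card_fin]
    have e : secPoly t p - ∏ j, (X - C (y j)) =
      (∏ j, (X - C (t j)) - ∏ j, (X - C (y j))) -
        ∑ i, C (p i) * ∏ j ∈ univ.erase i, (X - C (t j)) := by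
      unfold secPoly; ring
    rw [e]
    refine (degree_sub_le _ _).trans_lt (max_lt ?_ ?_)
    · have hm : ∀ x : Fin N → ℝ, (∏ j, (X - C (x j))).Monic := fun x =>
        monic_prod_of_monic _ _ fun j _ => monic_X_sub_C _
      refine (degree_sub_lt_left (by rw [hd, hd]) (hm t).ne_zero ?_).trans_le (by rw [hd])
      rw [hm, hm]
    · refine (degree_sum_le _ _).trans_lt ?_
      rw [Finset.sup_lt_iff (by simpa using WithBot.bot_lt_coe N)]
      intro i _
      refine (degree_mul_le _ _).trans_lt ?_
      refine (add_le_add_left degree_C_le _).trans_lt ?_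
      rw [zero_add]
      rw [degree_prod]
      simp only [degree_X_sub_C, sum_const, card_erase_of_mem (mem_univ i), card_fin]
      simp only [nsmul_eq_mul, mul_one]
      exact_mod_cast Nat.sub_lt hN one_pos
  · intro x hx
    obtain ⟨i, _, rfl⟩ := mem_image.1 hx
    rw [h i]; simp [eval_prod]

lemma wprod_ne {N : ℕ} {t : Fin N → ℝ} (ht : Function.Injective t) (i : Fin N) :
    ∏ j ∈ univ.erase i, (t i - t j) ≠ 0 :=
  prod_ne_zero_iff.2 fun j hj => sub_ne_zero.2 fun h => (mem_erase.1 hj).1 (ht h).symm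

open Polynomial in
lemma secPoly_pmap {N : ℕ} {t : Fin N → ℝ} (ht : Function.Injective t) (y : Fin N → ℝ) :
    secPoly t (pmap t y) = ∏ j, (X - C (y j)) := by
  refine secPoly_eq_of _ _ _ t ht fun i => ?_
  rw [secPoly_eval, pmap, div_mul_cancel₀ _ (wprod_ne ht i)]; ring

open Polynomial in
lemma pmap_eq_of_secPoly {N : ℕ} {t : Fin N → ℝ} (ht : Function.Injective t) {y p : Fin N → ℝ}
    (h : secPoly t p = ∏ j, (X - C (y j))) : pmap t y = p := by
  funext i
  have := congrArg (Polynomial.eval (t i)) h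
  rw [secPoly_eval] at this
  simp only [eval_prod, eval_sub, eval_X, eval_C] at this
  rw [pmap, div_eq_iff (wprod_ne ht i), ← this]; ring

open Polynomial in
lemma pmap_injOn {N : ℕ} {t : Fin N → ℝ} (ht : Function.Injective t) :
    Set.InjOn (pmap t) (intSet t) := by
  intro y hy z hz h
  have h1 : ∏ j, (X - C (y j)) = ∏ j, (X - C (z j)) := by
    rw [← secPoly_pmap ht y, h, secPoly_pmap ht z]
  refine (StrictMono.range_inj (intSet_strictMono hy) (intSet_strictMono hz)).1 ?_
  have key : ∀ x : Fin N → ℝ, Set.range x = {a | (∏ j, (X - C (x j))).eval a = 0} := by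
    intro x; ext a
    simp only [eval_prod, eval_sub, eval_X, eval_C, prod_eq_zero_iff, sub_eq_zero, Set.mem_range,
      Set.mem_ofPred_eq, mem_univ, true_and]
    exact ⟨fun ⟨k, hk⟩ => ⟨k, hk.symm⟩, fun ⟨k, hk⟩ => ⟨k, hk.symm⟩⟩
  rw [key, key, h1]

lemma wprod_adj {N : ℕ} {t : Fin N → ℝ} (ht : StrictMono t) (i j : Fin N)
    (hij : (i : ℕ) + 1 = j) :
    (∏ k ∈ univ.erase i, (t i - t k)) * (∏ k ∈ univ.erase j, (t j - t k)) < 0 := by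
  have hlt : i < j := by rw [Fin.lt_def]; omega
  rw [← mul_prod_erase (univ.erase i) _ (mem_erase.2 ⟨hlt.ne', mem_univ j⟩),
    ← mul_prod_erase (univ.erase j) _ (mem_erase.2 ⟨hlt.ne, mem_univ i⟩),
    erase_right_comm (a := j) (b := i)]
  have hpos : 0 < (∏ k ∈ (univ.erase i).erase j, (t i - t k)) *
      ∏ k ∈ (univ.erase i).erase j, (t j - t k) := by
    rw [← prod_mul_distrib]
    refine prod_pos fun k hk => ?_
    simp only [mem_erase, mem_univ, and_true] at hk
    rcases lt_or_gt_of_ne hk.2 with h | h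
    · exact mul_pos (sub_pos.2 (ht h)) (sub_pos.2 (ht (h.trans hlt)))
    · have : j < k := by
        have h1 := hk.1
        rw [Fin.lt_def] at h ⊢
        have : (k : ℕ) ≠ j := fun e => h1 (Fin.ext e)
        omega
      exact mul_pos_of_neg_of_neg (sub_neg.2 (ht h)) (sub_neg.2 (ht this))
  have h2 := sub_pos.2 (ht hlt)
  nlinarith [mul_pos (mul_pos h2 h2) hpos]

open Polynomial in
lemma pmap_surj {N : ℕ} {t : Fin N → ℝ} (ht : StrictMono t) (p : Fin N → ℝ) (hp : ∀ i, 0 < p i) :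
    ∃ y ∈ intSet t, pmap t y = p := by
  have key : ∀ i : Fin N, ∃ x, t i < x ∧ (∀ j, i < j → x < t j) ∧ (secPoly t p).eval x = 0 := by
    intro i
    have hc : Continuous fun x => (secPoly t p).eval x := (secPoly t p).continuous
    by_cases hi : (i : ℕ) + 1 < N
    · set j : Fin N := ⟨i + 1, hi⟩ with hj
      have hlt : i < j := by rw [Fin.lt_def, hj]; simp
      have hadj := wprod_adj ht i j rfl
      have hneg : (secPoly t p).eval (t i) * (secPoly t p).eval (t j) < 0 := by
        rw [secPoly_eval, secPoly_eval]
        nlinarith [mul_pos (hp i) (hp j), mul_neg_of_pos_of_neg (mul_pos (hp i) (hp j)) hadj]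
      have : ∃ x ∈ Set.Ioo (t i) (t j), (secPoly t p).eval x = 0 := by
        rcases mul_neg_iff.1 hneg with ⟨h1, h2⟩ | ⟨h1, h2⟩
        · exact intermediate_value_Ioo' (ht hlt).le hc.continuousOn ⟨h2, h1⟩
        · exact intermediate_value_Ioo (ht hlt).le hc.continuousOn ⟨h1, h2⟩
      obtain ⟨x, hx, hx0⟩ := this
      refine ⟨x, hx.1, fun k hk => hx.2.trans_le (ht.monotone ?_), hx0⟩
      rw [Fin.le_def, hj]; rw [Fin.lt_def] at hk; simp; omega
    · have hlast : ∀ j : Fin N, j ≤ i := fun j => by rw [Fin.le_def]; omega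
      have h1 : (secPoly t p).eval (t i) < 0 := by
        rw [secPoly_eval, neg_lt_zero]
        refine mul_pos (hp i) (prod_pos fun j hj => sub_pos.2 (ht ?_))
        exact lt_of_le_of_ne (hlast j) (mem_erase.1 hj).1
      set z := t i + ∑ k, p k + 1 with hz
      have hs : 0 ≤ ∑ k, p k := sum_nonneg fun k _ => (hp k).le
      have hzt : ∀ j, 0 < z - t j := fun j => by
        have := ht.monotone (hlast j); linarith
      have h2 : 0 < (secPoly t p).eval z := by
        simp only [secPoly, eval_sub, eval_prod, eval_finsetSum, eval_mul, eval_X, eval_C]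
        rw [sub_pos]
        have hP : 0 < ∏ j, (z - t j) := prod_pos fun j _ => hzt j
        calc ∑ k, p k * ∏ j ∈ univ.erase k, (z - t j)
            ≤ ∑ k, p k * (∏ j, (z - t j)) / (∑ k, p k + 1) := by
              refine sum_le_sum fun k _ => ?_
              rw [le_div_iff₀ (by linarith), ← mul_prod_erase univ (fun j => z - t j) (mem_univ k),
                mul_assoc]
              refine mul_le_mul_of_nonneg_left ?_ (hp k).le
              rw [mul_comm]
              refine mul_le_mul_of_nonneg_right ?_ (prod_nonneg fun j _ => (hzt j).le)
              have := ht.monotone (hlast k); linarith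
          _ = (∏ j, (z - t j)) * ((∑ k, p k) / (∑ k, p k + 1)) := by
              rw [← sum_div, ← sum_mul]; ring
          _ < ∏ j, (z - t j) := by
              refine mul_lt_of_lt_one_right hP ?_
              rw [div_lt_one (by linarith)]; linarith
      obtain ⟨x, hx, hx0⟩ := intermediate_value_Ioo (by linarith : t i ≤ z) hc.continuousOn ⟨h1, h2⟩
      exact ⟨x, hx.1, fun k hk => absurd (hlast k) (not_le.2 hk), hx0⟩
  choose y h1 h2 h3 using key
  have hy : y ∈ intSet t := ⟨h1, h2⟩
  refine ⟨y, hy, pmap_eq_of_secPoly ht.injective ?_⟩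
  refine secPoly_eq_of _ _ _ y (intSet_strictMono hy).injective fun i => ?_
  rw [h3 i, prod_eq_zero (mem_univ i) (sub_self _)]

lemma pmap_pos {N : ℕ} {t y : Fin N → ℝ} (ht : StrictMono t) (hy : y ∈ intSet t) (i : Fin N) :
    0 < pmap t y i := by
  have e : pmap t y i = (y i - t i) * ∏ j ∈ univ.erase i, ((t i - y j) / (t i - t j)) := by
    rw [pmap, prod_div_distrib, ← mul_prod_erase univ (fun j => t i - y j) (mem_univ i)]; ring
  rw [e]
  refine mul_pos (sub_pos.2 (hy.1 i)) (prod_pos fun j hj => ?_)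
  rcases lt_or_gt_of_ne (mem_erase.1 hj).1 with h | h
  · exact div_pos (sub_pos.2 (hy.2 j i h)) (sub_pos.2 (ht h))
  · exact div_pos_of_neg_of_neg (sub_neg.2 ((ht h).trans (hy.1 j))) (sub_neg.2 (ht h))

lemma pmap_image {N : ℕ} {t : Fin N → ℝ} (ht : StrictMono t) :
    pmap t '' intSet t = {p | ∀ i, 0 < p i} := by
  ext p; constructor
  · rintro ⟨y, hy, rfl⟩ i; exact pmap_pos ht hy i
  · intro hp; obtain ⟨y, hy, h⟩ := pmap_surj ht p hp; exact ⟨y, hy, h⟩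


/-! ### Jacobian of the secular map -/

/-- Vandermonde product -/
def VM {N : ℕ} (x : Fin N → ℝ) : ℝ := ∏ i, ∏ j ∈ Ioi i, (x j - x i)

lemma VM_pos {N : ℕ} {x : Fin N → ℝ} (hx : StrictMono x) : 0 < VM x :=
  prod_pos fun i _ => prod_pos fun j hj => sub_pos.2 (hx (mem_Ioi.1 hj))

lemma prod_erase_eq_VM {N : ℕ} (x : Fin N → ℝ) :
    |∏ i, ∏ j ∈ univ.erase i, (x i - x j)| = VM x ^ 2 := by
  have h1 : ∀ i : Fin N, univ.erase i = (Ioi i).disjUnion (Iio i) (by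
      rw [Finset.disjoint_left]; intro a ha hb
      exact lt_asymm (mem_Ioi.1 ha) (mem_Iio.1 hb)) := by
    intro i; ext j; simp [lt_or_lt_iff_ne, ne_comm]
  have h2 : ∏ i, ∏ j ∈ Iio i, (x i - x j) = VM x := by
    unfold VM
    rw [prod_sigma', prod_sigma']
    refine prod_bij' (fun a _ => ⟨a.2, a.1⟩) (fun a _ => ⟨a.2, a.1⟩) ?_ ?_ ?_ ?_ ?_ <;> simp
  have h3 : |∏ i, ∏ j ∈ Ioi i, (x i - x j)| = |VM x| := by
    unfold VM
    simp only [abs_prod]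
    exact prod_congr rfl fun i _ => prod_congr rfl fun j _ => abs_sub_comm _ _
  simp_rw [h1, prod_disjUnion]
  rw [prod_mul_distrib, h2, abs_mul, h3, ← abs_mul, ← sq, abs_sq]

open Polynomial in
lemma det_cauchy_aux {N : ℕ} (t y : Fin N → ℝ) :
    (Matrix.of fun i j : Fin N => ∏ k ∈ univ.erase j, (t i - y k)).det * VM y =
      VM t * ∏ i, ∏ j ∈ univ.erase i, (y i - y j) := by
  let q : Fin N → ℝ[X] := fun j => ∏ k ∈ univ.erase j, (X - C (y k))
  let Cm : Matrix (Fin N) (Fin N) ℝ := Matrix.of fun k j => (q j).coeff k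
  have hdeg : ∀ j : Fin N, (q j).natDegree < N := by
    intro j
    refine (natDegree_prod_le _ _).trans_lt ?_
    simp only [natDegree_X_sub_C, sum_const, card_erase_of_mem (mem_univ j), card_fin]
    have := j.pos
    simp; omega
  have hmul : ∀ s : Fin N → ℝ, Matrix.vandermonde s * Cm =
      Matrix.of fun i j : Fin N => ∏ k ∈ univ.erase j, (s i - y k) := by
    intro s; ext i j
    rw [Matrix.mul_apply]
    have : (q j).eval (s i) = ∏ k ∈ univ.erase j, (s i - y k) := by simp [q, eval_prod]
    rw [Matrix.of_apply, ← this, eval_eq_sum_range' (hdeg j), ← Fin.sum_univ_eq_sum_range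
      (fun k => (q j).coeff k * s i ^ k)]
    refine sum_congr rfl fun k _ => ?_
    simp [Matrix.vandermonde, Cm, mul_comm]
  have hdiag : Matrix.of (fun i j : Fin N => ∏ k ∈ univ.erase j, (y i - y k)) =
      Matrix.diagonal fun i => ∏ k ∈ univ.erase i, (y i - y k) := by
    ext i j
    by_cases h : i = j
    · subst h; simp
    · rw [Matrix.diagonal_apply_ne _ h, Matrix.of_apply]
      exact prod_eq_zero (i := i) (by simp [h]) (sub_self _)
  have e1 := congrArg Matrix.det (hmul t)
  have e2 := congrArg Matrix.det (hmul y)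
  rw [hdiag, Matrix.det_diagonal, Matrix.det_mul, Matrix.det_vandermonde] at e2
  rw [Matrix.det_mul, Matrix.det_vandermonde] at e1
  rw [← e1, ← e2]; unfold VM; ring

/-- Jacobian matrix of `pmap t` -/
def pjac {N : ℕ} (t y : Fin N → ℝ) : Matrix (Fin N) (Fin N) ℝ :=
  Matrix.of fun i j => (∏ k ∈ univ.erase i, (t i - t k))⁻¹ * ∏ k ∈ univ.erase j, (t i - y k)

lemma pjac_det {N : ℕ} {t y : Fin N → ℝ} (ht : StrictMono t) (hy : StrictMono y) :
    |(pjac t y).det| = VM y / VM t := by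
  have e : pjac t y = Matrix.of fun i j => (∏ k ∈ univ.erase i, (t i - t k))⁻¹ *
    (Matrix.of fun i j : Fin N => ∏ k ∈ univ.erase j, (t i - y k)) i j := rfl
  have h1 := VM_pos ht
  have h2 := VM_pos hy
  rw [e, Matrix.det_mul_column, prod_inv_distrib, abs_mul, abs_inv, prod_erase_eq_VM]
  have := congrArg abs (det_cauchy_aux t y)
  rw [abs_mul, abs_mul, prod_erase_eq_VM, abs_of_pos h1, abs_of_pos h2] at this
  have h3 : |(Matrix.of fun i j : Fin N => ∏ k ∈ univ.erase j, (t i - y k)).det| = VM t * VM y := by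
    apply mul_right_cancel₀ h2.ne'
    rw [this]; ring
  rw [h3]; field_simp

lemma hasFDerivAt_pmap {N : ℕ} (t y : Fin N → ℝ) :
    HasFDerivAt (pmap t) (LinearMap.toContinuousLinearMap (Matrix.toLin' (pjac t y))) y := by
  rw [hasFDerivAt_pi']
  intro i
  have h1 : ∀ j ∈ (univ : Finset (Fin N)), HasFDerivAt (fun z : Fin N → ℝ => t i - z j)
      (-(ContinuousLinearMap.proj j : (Fin N → ℝ) →L[ℝ] ℝ)) y := fun j _ =>
    ((ContinuousLinearMap.proj j : (Fin N → ℝ) →L[ℝ] ℝ).hasFDerivAt).const_sub (t i)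
  have h2 := (HasFDerivAt.finsetProd h1).neg.mul_const ((∏ k ∈ univ.erase i, (t i - t k))⁻¹)
  have h3 : (fun z => pmap t z i) = fun z => (-∏ j, (t i - z j)) * (∏ k ∈ univ.erase i, (t i - t k))⁻¹ := by
    funext z; rw [pmap, div_eq_mul_inv]
  rw [h3]
  refine HasFDerivAt.congr_fderiv h2 ?_
  refine ContinuousLinearMap.ext fun v => ?_
  simp [pjac, Matrix.toLin'_apply, Matrix.mulVec, dotProduct, mul_sum, mul_assoc]

lemma lintegral_pmap_image {N : ℕ} {t : Fin N → ℝ} (ht : StrictMono t)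
    {s : Set (Fin N → ℝ)} (hs : MeasurableSet s) (hst : s ⊆ intSet t)
    (f : (Fin N → ℝ) → ℝ≥0∞) :
    ∫⁻ p in pmap t '' s, f p = ∫⁻ y in s, ENNReal.ofReal (VM y / VM t) * f (pmap t y) := by
  rw [lintegral_image_eq_lintegral_abs_det_fderiv_mul volume hs
    (fun y _ => (hasFDerivAt_pmap t y).hasFDerivWithinAt) ((pmap_injOn ht.injective).mono hst)]
  refine setLIntegral_congr_fun hs fun y hy => ?_
  simp only [ContinuousLinearMap.det, LinearMap.coe_toContinuousLinearMap, LinearMap.det_toLin',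
    pjac_det ht (intSet_strictMono (hst hy))]

lemma measurableSet_pmap_image {N : ℕ} {t : Fin N → ℝ} (ht : StrictMono t)
    {s : Set (Fin N → ℝ)} (hs : MeasurableSet s) (hst : s ⊆ intSet t) :
    MeasurableSet (pmap t '' s) :=
  hs.image_of_continuousOn_injOn
    (fun y _ => (hasFDerivAt_pmap t y).continuousAt.continuousWithinAt)
    ((pmap_injOn ht.injective).mono hst)


/-! ### Sorted eigenvalues -/

open Polynomial in
lemma eigsDesc_eq {n : ℕ} {M : Matrix (Fin n) (Fin n) ℂ} {d : Fin n → ℝ} (hd : Antitone d)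
    (h : M.charpoly = ∏ i, (X - C (d i : ℂ))) (i : Fin n) : eigsDesc M i = d i := by
  have hr : (M.charpoly.roots.map Complex.re) = (List.ofFn d : Multiset ℝ) := by
    rw [h, Polynomial.roots_prod _ _ (prod_ne_zero_iff.2 fun i _ => X_sub_C_ne_zero _)]
    simp [Multiset.bind_singleton, Fin.univ_val_map]
    rfl
  have hl : (M.charpoly.roots.map Complex.re).toList.insertionSort (· ≥ ·) = List.ofFn d := by
    refine List.Perm.eq_of_sortedGE List.sortedGE_insertionSort hd.sortedGE_ofFn ?_
    refine (List.perm_insertionSort _ _).trans ?_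
    rw [← Multiset.coe_eq_coe, Multiset.coe_toList, hr]
  unfold eigsDesc
  rw [hl, List.getD_eq_getElem _ _ (by simp)]
  simp

open Polynomial in
lemma exists_sorted {n : ℕ} {M : Matrix (Fin n) (Fin n) ℂ} {e : Fin n → ℝ}
    (h : M.charpoly = ∏ i, (X - C (e i : ℂ))) :
    ∃ σ : Equiv.Perm (Fin n), Antitone (e ∘ σ) ∧ M.charpoly = ∏ i, (X - C ((e ∘ σ) i : ℂ)) := by
  refine ⟨Tuple.sort (fun i => -(e i)), ?_, ?_⟩
  · intro i j hij
    have := Tuple.monotone_sort (fun i => -(e i)) hij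
    simpa using this
  · rw [h]; exact (Equiv.prod_comp _ (fun i => X - C (e i : ℂ))).symm

open Polynomial in
lemma charpoly_eigsDesc {n : ℕ} {M : Matrix (Fin n) (Fin n) ℂ} {e : Fin n → ℝ}
    (h : M.charpoly = ∏ i, (X - C (e i : ℂ))) :
    Antitone (fun i : Fin n => eigsDesc M i) ∧
      M.charpoly = ∏ i : Fin n, (X - C (eigsDesc M i : ℂ)) := by
  obtain ⟨σ, h1, h2⟩ := exists_sorted h
  have : (fun i : Fin n => eigsDesc M i) = e ∘ σ := funext fun i => eigsDesc_eq h1 h2 i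
  refine ⟨this ▸ h1, ?_⟩
  rw [h2]; refine prod_congr rfl fun i _ => ?_
  rw [← congrFun this i]

open Polynomial in
open scoped Matrix in
lemma exists_diag {n : ℕ} {H : Matrix (Fin n) (Fin n) ℂ} (hH : H.IsHermitian) {d : Fin n → ℝ}
    (hd : Antitone d) (h : H.charpoly = ∏ i, (X - C (d i : ℂ))) :
    ∃ U : Matrix (Fin n) (Fin n) ℂ, U * Uᴴ = 1 ∧ Uᴴ * U = 1 ∧
      H = U * Matrix.diagonal (fun i => (d i : ℂ)) * Uᴴ := by
  obtain ⟨σ, h1, h2⟩ := exists_sorted (e := hH.eigenvalues) hH.charpoly_eq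
  have hds : d = hH.eigenvalues ∘ σ := by
    funext i; rw [← eigsDesc_eq hd h i, eigsDesc_eq h1 h2 i]
  set V : Matrix (Fin n) (Fin n) ℂ := (hH.eigenvectorUnitary : Matrix (Fin n) (Fin n) ℂ) with hV
  have hV1 : V * Vᴴ = 1 := by
    have := Unitary.coe_mul_star_self hH.eigenvectorUnitary
    simpa [hV, Matrix.star_eq_conjTranspose] using this
  have hV2 : Vᴴ * V = 1 := by
    have := Unitary.coe_star_mul_self hH.eigenvectorUnitary
    simpa [hV, Matrix.star_eq_conjTranspose] using this
  have hsp : H = V * Matrix.diagonal (fun i => (hH.eigenvalues i : ℂ)) * Vᴴ := by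
    have := hH.spectral_theorem
    rw [Unitary.conjStarAlgAut_apply] at this
    conv_lhs => rw [this]
    rfl
  refine ⟨V.submatrix id σ, ?_, ?_, ?_⟩
  · rw [Matrix.conjTranspose_submatrix, Matrix.submatrix_mul_equiv, hV1]; simp
  · rw [Matrix.conjTranspose_submatrix, ← Matrix.submatrix_mul _ _ _ id _ Function.bijective_id, hV2]
    simp
  · have : Matrix.diagonal (fun i => (d i : ℂ)) =
        (Matrix.diagonal (fun i => (hH.eigenvalues i : ℂ))).submatrix σ σ := by
      rw [Matrix.submatrix_diagonal_equiv, hds]; rfl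
    rw [this, Matrix.conjTranspose_submatrix, Matrix.submatrix_mul_equiv,
      Matrix.submatrix_mul_equiv, ← hsp]; simp

/-- measurability of sorted eigenvalues for real rooted families -/
lemma measurable_eigsDesc {α : Type*} [MeasurableSpace α] {n : ℕ}
    (M : α → Matrix (Fin n) (Fin n) ℂ) (hM : ∀ a b, Measurable fun ω => M ω a b)
    (hr : ∀ ω, ∃ e : Fin n → ℝ, (M ω).charpoly = ∏ i, (Polynomial.X - Polynomial.C (e i : ℂ)))
    (i : Fin n) : Measurable fun ω => eigsDesc (M ω) i := by
  let E : Set (Fin n → ℝ) := {x | Antitone x}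
  have hE : MeasurableSet E := by
    have : E = ⋂ i, ⋂ j, {x : Fin n → ℝ | i ≤ j → x j ≤ x i} := by
      ext x; simp [E, Antitone]
    rw [this]
    refine (isClosed_iInter fun i => isClosed_iInter fun j => ?_).measurableSet
    by_cases h : i ≤ j
    · simpa [h] using isClosed_le (continuous_apply j) (continuous_apply i)
    · simp [h]
  let Φ : (Fin n → ℝ) → (ℕ → ℝ) := fun x k => ∏ i, ((k : ℝ) - x i)
  have hΦ : Continuous Φ := by fun_prop
  have hinj : Set.InjOn Φ E := by
    intro x hx y hy hxy
    have hp : ∏ i, (Polynomial.X - Polynomial.C (x i)) = ∏ i, (Polynomial.X - Polynomial.C (y i)) := by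
      refine Polynomial.eq_of_infinite_eval_eq _ _ ?_
      refine Set.Infinite.mono (s := Set.range (fun k : ℕ => (k : ℝ))) ?_
        (Set.infinite_range_of_injective Nat.cast_injective)
      rintro _ ⟨k, rfl⟩
      have := congrFun hxy k
      simpa [Φ, Polynomial.eval_prod] using this
    let D : Matrix (Fin n) (Fin n) ℂ := Matrix.diagonal fun i => (x i : ℂ)
    have h1 : D.charpoly = ∏ i, (Polynomial.X - Polynomial.C (x i : ℂ)) := Matrix.charpoly_diagonal _
    have h2 : D.charpoly = ∏ i, (Polynomial.X - Polynomial.C (y i : ℂ)) := by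
      have := congrArg (Polynomial.map Complex.ofRealHom) hp
      simp only [Polynomial.map_prod, Polynomial.map_sub, Polynomial.map_X, Polynomial.map_C] at this
      rw [h1]; exact this
    funext i
    rw [← eigsDesc_eq hx h1 i, eigsDesc_eq hy h2 i]
  have hemb := (hΦ.continuousOn (s := E)).measurableEmbedding hE hinj
  have hD : ∀ ω, (fun i : Fin n => eigsDesc (M ω) i) ∈ E := fun ω =>
    (charpoly_eigsDesc (hr ω).choose_spec).1
  let D : α → E := fun ω => ⟨fun i : Fin n => eigsDesc (M ω) i, hD ω⟩
  have hcomp : Measurable (E.domRestrict Φ ∘ D) := by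
    refine measurable_pi_lambda _ fun k => ?_
    have : (fun ω => (E.domRestrict Φ ∘ D) ω k) =
        fun ω => ((Matrix.scalar (Fin n) ((k : ℂ)) - M ω).det).re := by
      funext ω
      rw [← Matrix.eval_charpoly, (charpoly_eigsDesc (hr ω).choose_spec).2]
      simp only [Polynomial.eval_prod, Polynomial.eval_sub, Polynomial.eval_X, Polynomial.eval_C]
      show (∏ i : Fin n, ((k : ℝ) - eigsDesc (M ω) i)) = _
      rw [← Complex.ofReal_re (∏ i : Fin n, ((k : ℝ) - eigsDesc (M ω) i))]
      push_cast; rfl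
    rw [this]
    refine Complex.measurable_re.comp ?_
    simp only [Matrix.det_apply]
    refine Finset.measurable_sum _ fun σ _ => Measurable.const_smul ?_ _
    refine Finset.measurable_prod _ fun j _ => ?_
    simp only [Matrix.sub_apply]
    exact measurable_const.sub (hM _ _)
  have hDm : Measurable D := hemb.measurable_comp_iff.1 hcomp
  exact (measurable_pi_apply i).comp (measurable_subtype_coe.comp hDm)


/-! ### Gram matrices and their level eigenvalues -/

open scoped Matrix in
lemma gramC_eq {n : ℕ} (l : ℕ) (Z : ℕ → Fin n → ℂ) :
    gramC l Z = (Matrix.of fun (i : Fin l) (a : Fin n) => Z i a)ᴴ *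
      (Matrix.of fun (i : Fin l) (a : Fin n) => Z i a) := by
  ext a b
  simp only [gramC, Matrix.of_apply, Matrix.mul_apply, Matrix.conjTranspose_apply]
  rw [Finset.sum_range]; rfl

open scoped ComplexOrder in
lemma gramC_posSemidef {n : ℕ} (l : ℕ) (Z : ℕ → Fin n → ℂ) : (gramC l Z).PosSemidef := by
  rw [gramC_eq]; exact Matrix.posSemidef_conjTranspose_mul_self _

lemma gramC_succ {n : ℕ} (l : ℕ) (Z : ℕ → Fin n → ℂ) :
    gramC (l + 1) Z = gramC l Z + Matrix.vecMulVec (star (Z l)) (Z l) := by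
  ext a b
  simp [gramC, Finset.sum_range_succ, Matrix.vecMulVec_apply]

lemma gramC_congr {n : ℕ} (l : ℕ) {Z W : ℕ → Fin n → ℂ} (h : ∀ i < l, Z i = W i) :
    gramC l Z = gramC l W := by
  ext a b
  simp only [gramC, Matrix.of_apply]
  exact Finset.sum_congr rfl fun i hi => by rw [h i (by simpa using hi)]

/-- increasing nonzero eigenvalues at level `l` -/
def tl {n : ℕ} (l : ℕ) (Z : ℕ → Fin n → ℂ) : Fin l → ℝ := fun i =>
  eigsDesc (gramC l Z) (l - 1 - i)

/-- decreasing eigenvalue vector of length `n` built from an increasing vector of length `l` -/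
def dvec (n : ℕ) {l : ℕ} (y : Fin l → ℝ) : Fin n → ℝ := fun i =>
  if h : (i : ℕ) < l then y (Fin.rev ⟨i, h⟩) else 0

lemma dvec_antitone {n l : ℕ} {y : Fin l → ℝ} (hy : Monotone y) (h0 : ∀ i, 0 ≤ y i) :
    Antitone (dvec n y) := by
  intro i j hij
  unfold dvec
  by_cases h : (j : ℕ) < l
  · have h' : (i : ℕ) < l := lt_of_le_of_lt hij h
    rw [dif_pos h, dif_pos h']
    exact hy (Fin.rev_le_rev.2 hij)
  · rw [dif_neg h]
    split_ifs
    · exact h0 _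
    · exact le_rfl

open Polynomial in
lemma dvec_prod {R : Type*} [CommMonoid R] {n l : ℕ} (hl : l ≤ n) (y : Fin l → ℝ) (f : ℝ → R) :
    ∏ i, f (dvec n y i) = f 0 ^ (n - l) * ∏ i, f (y i) := by
  obtain ⟨k, rfl⟩ := Nat.exists_eq_add_of_le hl
  rw [Fin.prod_univ_add, mul_comm]
  congr 1
  · simp [dvec]
  · simp only [dvec, Fin.val_castAdd, Fin.is_lt, dif_pos]
    exact Equiv.prod_comp Fin.revPerm (fun i => f (y i))

open Polynomial in
open scoped ComplexOrder in
lemma tl_spec {n l : ℕ} (hl : l ≤ n) (Z : ℕ → Fin n → ℂ) :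
    Monotone (tl l Z) ∧ (∀ i, 0 ≤ tl l Z i) ∧
      (gramC l Z).charpoly = ∏ i, (X - C (dvec n (tl l Z) i : ℂ)) := by
  set B : Matrix (Fin l) (Fin n) ℂ := Matrix.of fun (i : Fin l) (a : Fin n) => Z i a with hB
  have hps : (B * B.conjTranspose).PosSemidef := Matrix.posSemidef_self_mul_conjTranspose B
  obtain ⟨σ, h1, h2⟩ := exists_sorted (e := hps.1.eigenvalues) hps.1.charpoly_eq
  set e := hps.1.eigenvalues ∘ σ with he
  have he0 : ∀ i, 0 ≤ e i := fun i => hps.eigenvalues_nonneg _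
  let y : Fin l → ℝ := fun i => e (Fin.rev i)
  have hym : Monotone y := fun i j hij => h1 (Fin.rev_le_rev.2 hij)
  have hch : (gramC l Z).charpoly = ∏ i, (X - C (dvec n y i : ℂ)) := by
    rw [dvec_prod hl y (fun r => (X - C (r : ℂ))), gramC_eq, Matrix.charpoly_mul_comm_of_le _ _ (by simpa using hl)]
    rw [← hB, h2]
    simp only [Complex.ofReal_zero, C_0, sub_zero, Fintype.card_fin]
    congr 1
    exact (Equiv.prod_comp Fin.revPerm (fun i => X - C (e i : ℂ))).symm
  have hty : tl l Z = y := by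
    funext i
    have := eigsDesc_eq (dvec_antitone hym fun i => he0 _) hch ⟨l - 1 - i, by omega⟩
    simp only [tl]
    rw [this, dvec, dif_pos (by simp only; omega)]
    congr 1
    ext; simp [Fin.val_rev]; omega
  rw [hty]
  exact ⟨hym, fun i => he0 _, hch⟩

open Polynomial in
lemma tl_eq_of {n l : ℕ} (hl : l ≤ n) (Z : ℕ → Fin n → ℂ) {y : Fin l → ℝ} (hy : Monotone y)
    (h0 : ∀ i, 0 ≤ y i) (h : (gramC l Z).charpoly = ∏ i, (X - C (dvec n y i : ℂ))) :
    tl l Z = y := by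
  funext i
  have := eigsDesc_eq (dvec_antitone hy h0) h ⟨l - 1 - i, by omega⟩
  simp only [tl]
  rw [this, dvec, dif_pos (by simp only; omega)]
  congr 1
  ext; simp [Fin.val_rev]; omega

lemma measurable_gramC_entry {α : Type*} [MeasurableSpace α] {n : ℕ} (l : ℕ)
    (Z : α → ℕ → Fin n → ℂ) (hZ : ∀ i a, Measurable fun ω => Z ω i a) (a b : Fin n) :
    Measurable fun ω => gramC l (Z ω) a b := by
  simp only [gramC, Matrix.of_apply]
  refine Finset.measurable_sum _ fun i _ => ?_
  exact (Complex.continuous_conj.measurable.comp (hZ i a)).mul (hZ i b)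

lemma measurable_tl {α : Type*} [MeasurableSpace α] {n l : ℕ} (hl : l ≤ n)
    (Z : α → ℕ → Fin n → ℂ) (hZ : ∀ i a, Measurable fun ω => Z ω i a) :
    Measurable fun ω => tl l (Z ω) := by
  refine measurable_pi_lambda _ fun i => ?_
  exact measurable_eigsDesc (fun ω => gramC l (Z ω)) (measurable_gramC_entry l Z hZ)
    (fun ω => ⟨_, (tl_spec hl (Z ω)).2.2⟩) ⟨l - 1 - i, by omega⟩

open scoped Matrix in
/-- determinant of `1 + gram` -/
lemma det_one_add_gramC {n l : ℕ} (hl : l ≤ n) (Z : ℕ → Fin n → ℂ) :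
    (1 + gramC l Z).det = ∏ i, (1 + (tl l Z i : ℂ)) := by
  have h := (tl_spec hl Z).2.2
  have h1 : (gramC l Z).charpoly.eval (-1) = (Matrix.scalar (Fin n) (-1 : ℂ) - gramC l Z).det :=
    Matrix.eval_charpoly _ _
  have h2 : (Matrix.scalar (Fin n) (-1 : ℂ) - gramC l Z) = - (1 + gramC l Z) := by
    rw [map_neg, map_one]; abel
  rw [h2, Matrix.det_neg, h, Polynomial.eval_prod] at h1
  simp only [Polynomial.eval_sub, Polynomial.eval_X, Polynomial.eval_C] at h1
  have h3 : ∏ i : Fin n, (-1 - (dvec n (tl l Z) i : ℂ)) =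
      (-1) ^ n * ∏ i : Fin n, (1 + (dvec n (tl l Z) i : ℂ)) := by
    have : ((-1 : ℂ)) ^ n = ∏ i : Fin n, (-1 : ℂ) := by simp
    rw [this, ← Finset.prod_mul_distrib]
    exact Finset.prod_congr rfl fun i _ => by ring
  rw [h3, Fintype.card_fin] at h1
  have h4 := mul_left_cancel₀ (pow_ne_zero n (by norm_num : (-1 : ℂ) ≠ 0)) h1
  rw [← h4, dvec_prod hl _ (fun r : ℝ => (1 + (r : ℂ)))]
  simp

open scoped Matrix in
open Polynomial in
open scoped ComplexOrder in
lemma eigsDesc_inv_one_add {n l : ℕ} (hl : l ≤ n) (Z : ℕ → Fin n → ℂ) (i : Fin l) :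
    eigsDesc ((1 + gramC l Z)⁻¹) (n - l + i) = (1 + tl l Z i)⁻¹ := by
  obtain ⟨h1, h2, h3⟩ := tl_spec hl Z
  obtain ⟨U, hU1, hU2, hU⟩ := exists_diag (gramC_posSemidef l Z).1 (dvec_antitone h1 h2) h3
  set d := dvec n (tl l Z) with hd
  have hd0 : ∀ i, 0 ≤ d i := by
    intro i; simp only [hd, dvec]; split_ifs; exacts [h2 _, le_rfl]
  have hd1 : ∀ i, (1 + d i : ℂ) ≠ 0 := by
    intro i
    have := hd0 i
    have h : (1 + d i : ℝ) ≠ 0 := by positivity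
    exact_mod_cast h
  have e1 : 1 + gramC l Z = U * Matrix.diagonal (fun i => (1 + d i : ℂ)) * Uᴴ := by
    have : Matrix.diagonal (fun i => (1 + d i : ℂ)) = 1 + Matrix.diagonal (fun i => (d i : ℂ)) := by
      rw [← Matrix.diagonal_one, Matrix.diagonal_add]
    rw [this, Matrix.mul_add, Matrix.add_mul, ← hU, Matrix.mul_one, hU1]
  have e2 : (1 + gramC l Z)⁻¹ = U * Matrix.diagonal (fun i => (1 + d i : ℂ)⁻¹) * Uᴴ := by
    rw [e1]
    refine Matrix.inv_eq_right_inv ?_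
    calc _ = U * Matrix.diagonal (fun i => (1 + d i : ℂ)) * (Uᴴ * U) * Matrix.diagonal (fun i => (1 + d i : ℂ)⁻¹) * Uᴴ := by
          simp only [Matrix.mul_assoc]
      _ = _ := by
          rw [hU2, Matrix.mul_one, Matrix.mul_assoc U, Matrix.diagonal_mul_diagonal]
          simp [hd1, hU1]
  have e3 : ((1 + gramC l Z)⁻¹).charpoly = ∏ i, (X - C (((fun i => (1 + d (Fin.rev i))⁻¹) i : ℝ) : ℂ)) := by
    rw [e2, Matrix.charpoly_mul_comm, ← Matrix.mul_assoc, hU2, Matrix.one_mul, Matrix.charpoly_diagonal]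
    push_cast
    exact (Equiv.prod_comp Fin.revPerm (fun i => X - C ((1 + d i : ℂ)⁻¹))).symm
  have hanti : Antitone (fun i => (1 + d (Fin.rev i))⁻¹) := by
    intro a b hab
    have := dvec_antitone (n := n) h1 h2 (Fin.rev_le_rev.2 hab)
    have h0 := hd0 (Fin.rev a)
    exact inv_anti₀ (by positivity) (by simpa [hd] using this)
  have := eigsDesc_eq hanti e3 ⟨n - l + i, by omega⟩
  simp only at this
  rw [this]
  congr 2
  simp only [hd, dvec]
  rw [dif_pos (by simp [Fin.val_rev]; omega)]
  congr 1
  ext; simp [Fin.val_rev]; omega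

/-! ### rank one perturbation -/

open Polynomial in
lemma charpoly_diag_add_rankone {n : ℕ} (d u v : Fin n → ℂ) :
    (Matrix.diagonal d + Matrix.vecMulVec u v).charpoly =
      ∏ j, (X - C (d j)) - ∑ i, C (u i * v i) * ∏ j ∈ univ.erase i, (X - C (d j)) := by
  refine Polynomial.eq_of_infinite_eval_eq _ _ ?_
  refine Set.Infinite.mono (s := (Set.range d)ᶜ) ?_ (Set.finite_range d).infinite_compl
  intro z hz
  have hz' : ∀ j, z - d j ≠ 0 := fun j h => hz ⟨j, (sub_eq_zero.1 h).symm⟩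
  show eval z _ = eval z _
  rw [Matrix.eval_charpoly]
  have e : Matrix.scalar (Fin n) z - (Matrix.diagonal d + Matrix.vecMulVec u v) =
      Matrix.diagonal (fun j => z - d j) +
        Matrix.replicateCol Unit (-u) * Matrix.replicateRow Unit v := by
    rw [← Matrix.vecMulVec_eq, Matrix.neg_vecMulVec, ← sub_eq_add_neg, ← sub_sub]
    congr 1
    rw [Matrix.scalar_apply, Matrix.diagonal_sub]
  rw [e, Matrix.det_add_replicateCol_mul_replicateRow (by
    rw [Matrix.det_diagonal]; exact (prod_ne_zero_iff.2 fun j _ => hz' j).isUnit)]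
  rw [Matrix.det_diagonal, Matrix.inv_diagonal]
  have hinv : Ring.inverse (fun j => z - d j) = fun j => (z - d j)⁻¹ := by
    have hu : (fun j => z - d j) * (fun j => (z - d j)⁻¹) = 1 := by
      funext j; simp [hz' j]
    have hu2 : IsUnit (fun j => z - d j) := IsUnit.of_mul_eq_one _ hu
    have := Ring.inverse_mul_cancel _ hu2
    calc _ = Ring.inverse (fun j => z - d j) * ((fun j => z - d j) * (fun j => (z - d j)⁻¹)) := by
          rw [hu, mul_one]
      _ = _ := by rw [← mul_assoc, this, one_mul]
  rw [hinv, Matrix.det_unique]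
  simp only [eval_sub, eval_prod, eval_finsetSum, eval_mul, eval_X, eval_C, Matrix.add_apply,
    Matrix.one_apply_eq, Matrix.mul_apply, Matrix.replicateRow_apply, Matrix.replicateCol_apply,
    Matrix.diagonal_apply, mul_ite, mul_zero, Finset.sum_ite_eq', Finset.mem_univ, if_true, Pi.neg_apply,
    mul_add, mul_one, Finset.mul_sum]
  rw [sub_eq_add_neg, ← Finset.sum_neg_distrib]
  congr 1
  refine Finset.sum_congr rfl fun i _ => ?_
  rw [← Finset.mul_prod_erase univ _ (mem_univ i)]
  field_simp [hz' i]

/-! ### Product integrals, densities -/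

lemma lintegral_fin_prod {α : Type*} [MeasurableSpace α] : ∀ (N : ℕ) (μ : Fin N → Measure α)
    (_ : ∀ i, SigmaFinite (μ i)) (f : Fin N → α → ℝ≥0∞) (_ : ∀ i, Measurable (f i)),
    ∫⁻ x, ∏ i, f i (x i) ∂Measure.pi μ = ∏ i, ∫⁻ x, f i x ∂μ i := by
  intro N
  induction N with
  | zero => intro μ hμ f hf; simp [Measure.pi_of_empty]
  | succ N ih =>
    intro μ hμ f hf
    have h := (measurePreserving_piFinSuccAbove (α := fun _ => α) μ 0).symm
    rw [← h.map_eq, (MeasurableEquiv.measurableEmbedding _).lintegral_map]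
    have e : ∀ z : α × (Fin N → α), ∏ i, f i
        ((MeasurableEquiv.piFinSuccAbove (fun _ => α) 0).symm z i) =
        f 0 z.1 * ∏ i : Fin N, f i.succ (z.2 i) := by
      intro z
      rw [Fin.prod_univ_succ]
      rfl
    simp only [e]
    rw [lintegral_prod_mul (g := fun y : Fin N → α => ∏ i, f i.succ (y i))
      (hf 0).aemeasurable (by
        refine Measurable.aemeasurable ?_
        exact Finset.measurable_prod _ fun i _ => (hf _).comp (measurable_pi_apply i))]
    rw [Fin.prod_univ_succ]
    congr 1
    exact ih (fun j => μ j.succ) (fun j => hμ _) (fun j => f j.succ) (fun j => hf _)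

lemma lintegral_pi_prod {ι α : Type*} [Fintype ι] [MeasurableSpace α] (μ : ι → Measure α)
    [∀ i, SigmaFinite (μ i)] (f : ι → α → ℝ≥0∞) (hf : ∀ i, Measurable (f i)) :
    ∫⁻ x, ∏ i, f i (x i) ∂Measure.pi μ = ∏ i, ∫⁻ x, f i x ∂μ i := by
  let e := (Fintype.equivFin ι).symm
  have h := measurePreserving_piCongrLeft (α := fun _ => α) μ e
  rw [← h.map_eq, (MeasurableEquiv.measurableEmbedding _).lintegral_map]
  have e1 : ∀ z : Fin (Fintype.card ι) → α, ∏ i, f i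
      ((MeasurableEquiv.piCongrLeft (fun _ => α) e) z i) = ∏ j, f (e j) (z j) := by
    intro z
    rw [← Equiv.prod_comp e]
    refine prod_congr rfl fun j _ => ?_
    rw [MeasurableEquiv.coe_piCongrLeft, Equiv.piCongrLeft_apply_apply]
  simp only [e1]
  rw [lintegral_fin_prod _ (fun j => μ (e j)) (fun j => inferInstance) (fun j => f (e j))
    (fun j => hf _)]
  exact Equiv.prod_comp e (fun i => ∫⁻ x, f i x ∂μ i)

lemma pi_withDensity {ι α : Type*} [Fintype ι] [MeasurableSpace α] (μ : ι → Measure α)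
    [∀ i, SigmaFinite (μ i)] (f : ι → α → ℝ≥0∞) (hf : ∀ i, Measurable (f i))
    [∀ i, SigmaFinite ((μ i).withDensity (f i))] :
    Measure.pi (fun i => (μ i).withDensity (f i)) =
      (Measure.pi μ).withDensity fun x => ∏ i, f i (x i) := by
  refine Measure.pi_eq fun s hs => ?_
  rw [withDensity_apply _ (MeasurableSet.univ_pi hs)]
  rw [Measure.restrict_pi_pi, lintegral_pi_prod _ f hf]
  exact prod_congr rfl fun i _ => (withDensity_apply _ (hs i)).symm

/-! ### Radial measure -/

lemma normSqSum_vol_Iic {ι : Type*} [Fintype ι] [Nonempty ι] {s : ℝ} (hs : 0 ≤ s) :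
    volume {u : ι → ℂ | ∑ i, Complex.normSq (u i) ≤ s} =
      ENNReal.ofReal (s ^ Fintype.card ι) * volume {u : ι → ℂ | ∑ i, Complex.normSq (u i) ≤ 1} := by
  have hfr : Module.finrank ℝ (ι → ℂ) = 2 * Fintype.card ι := by
    rw [Module.finrank_pi_fintype]; simp [Complex.finrank_real_complex, mul_comm]
  rcases hs.eq_or_lt with rfl | hs
  · rw [zero_pow Fintype.card_ne_zero, ENNReal.ofReal_zero, zero_mul]
    have : {u : ι → ℂ | ∑ i, Complex.normSq (u i) ≤ 0} = {0} := by
      ext u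
      simp only [Set.mem_ofPred_eq, Set.mem_singleton_iff]
      constructor
      · intro h
        have h' := le_antisymm h (sum_nonneg fun i _ => Complex.normSq_nonneg _)
        rw [sum_eq_zero_iff_of_nonneg fun i _ => Complex.normSq_nonneg _] at h'
        funext i; simpa using h' i (mem_univ i)
      · rintro rfl; simp
    rw [this]
    exact measure_singleton _
  · have h := Measure.addHaar_smul_of_nonneg (volume : Measure (ι → ℂ)) (Real.sqrt_nonneg s)
      {u : ι → ℂ | ∑ i, Complex.normSq (u i) ≤ 1}
    rw [hfr, pow_mul, Real.sq_sqrt hs.le] at h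
    rw [← h]
    congr 1
    ext u
    rw [Set.mem_smul_set_iff_inv_smul_mem₀ (Real.sqrt_ne_zero'.2 hs)]
    simp only [Set.mem_ofPred_eq, Pi.smul_apply, Complex.real_smul, Complex.normSq_mul,
      Complex.normSq_ofReal]
    rw [← Finset.mul_sum, ← mul_inv, Real.mul_self_sqrt hs.le, inv_mul_le_iff₀ hs, mul_one]

lemma normSqSum_vol_lt_top {ι : Type*} [Fintype ι] :
    volume {u : ι → ℂ | ∑ i, Complex.normSq (u i) ≤ 1} < ∞ := by
  refine lt_of_le_of_lt (measure_mono (t := Metric.closedBall 0 1) ?_) measure_closedBall_lt_top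
  intro u hu
  rw [mem_closedBall_zero_iff, pi_norm_le_iff_of_nonneg zero_le_one]
  intro i
  have h1 : Complex.normSq (u i) ≤ 1 :=
    (single_le_sum (f := fun i => Complex.normSq (u i)) (fun i _ => Complex.normSq_nonneg _)
      (mem_univ i)).trans hu
  rw [Complex.normSq_eq_norm_sq] at h1
  nlinarith [norm_nonneg (u i)]

lemma measurable_normSq : Measurable Complex.normSq := Complex.continuous_normSq.measurable

lemma lintegral_pow_Ioc {a b : ℝ} (hab : a ≤ b) (ha : 0 ≤ a) (k : ℕ) :
    ∫⁻ s in Set.Ioc a b, ENNReal.ofReal ((k + 1 : ℝ) * s ^ k) =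
      ENNReal.ofReal (b ^ (k + 1)) - ENNReal.ofReal (a ^ (k + 1)) := by
  rw [← ofReal_integral_eq_lintegral_ofReal]
  · rw [← intervalIntegral.integral_of_le hab, intervalIntegral.integral_const_mul, integral_pow,
      ← ENNReal.ofReal_sub _ (by positivity)]
    congr 1
    field_simp
  · have : Continuous fun s : ℝ => (k + 1 : ℝ) * s ^ k := by fun_prop
    exact (this.intervalIntegrable a b).1
  · filter_upwards [ae_restrict_mem measurableSet_Ioc] with s hs
    have : 0 ≤ s := ha.trans hs.1.le
    positivity

/-- the radial density -/
def radDens (k : ℕ) (c : ℝ≥0∞) (s : ℝ) : ℝ≥0∞ := c * ENNReal.ofReal (s ^ k)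

lemma measurable_radDens (k : ℕ) (c : ℝ≥0∞) : Measurable (radDens k c) := by
  unfold radDens; fun_prop

lemma radial_map {ι : Type*} [Fintype ι] [Nonempty ι] :
    ∃ c : ℝ≥0∞, c ≠ ∞ ∧ Measure.map (fun u : ι → ℂ => ∑ i, Complex.normSq (u i)) volume =
      (volume.restrict (Set.Ioi (0:ℝ))).withDensity (radDens (Fintype.card ι - 1) c) := by
  set k := Fintype.card ι - 1 with hk
  have hk' : Fintype.card ι = k + 1 := by have := Fintype.card_pos (α := ι); omega
  set V := volume {u : ι → ℂ | ∑ i, Complex.normSq (u i) ≤ 1} with hV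
  have hVt : V ≠ ∞ := normSqSum_vol_lt_top.ne
  have hr : Measurable (fun u : ι → ℂ => ∑ i, Complex.normSq (u i)) := by
    refine Finset.measurable_sum _ fun i _ => measurable_normSq.comp (measurable_pi_apply i)
  have hr0 : ∀ u : ι → ℂ, 0 ≤ ∑ i, Complex.normSq (u i) :=
    fun u => sum_nonneg fun i _ => Complex.normSq_nonneg _
  refine ⟨V * ENNReal.ofReal (k + 1), ENNReal.mul_ne_top hVt ENNReal.ofReal_ne_top, ?_⟩
  have hIoc : ∀ a b : ℝ, a < b →
      Measure.map (fun u : ι → ℂ => ∑ i, Complex.normSq (u i)) volume (Set.Ioc a b) =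
        V * (ENNReal.ofReal ((max b 0) ^ (k+1)) - ENNReal.ofReal ((max a 0) ^ (k+1))) := by
    intro a b hab
    have hI : ∀ s : ℝ, 0 ≤ s → Measure.map (fun u : ι → ℂ => ∑ i, Complex.normSq (u i)) volume
        (Set.Iic s) = V * ENNReal.ofReal (s ^ (k+1)) := by
      intro s hs
      rw [Measure.map_apply hr measurableSet_Iic, ← hk', mul_comm]
      exact normSqSum_vol_Iic hs
    have hI' : ∀ s : ℝ, s < 0 → Measure.map (fun u : ι → ℂ => ∑ i, Complex.normSq (u i)) volume
        (Set.Iic s) = 0 := by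
      intro s hs
      rw [Measure.map_apply hr measurableSet_Iic]
      convert measure_empty
      · ext u
        simp only [Set.mem_preimage, Set.mem_Iic, Set.mem_empty_iff_false, iff_false, not_le]
        exact hs.trans_le (hr0 u)
      · infer_instance
    have hI2 : ∀ s : ℝ, Measure.map (fun u : ι → ℂ => ∑ i, Complex.normSq (u i)) volume
        (Set.Iic s) = V * ENNReal.ofReal ((max s 0) ^ (k+1)) := by
      intro s
      rcases lt_or_ge s 0 with h | h
      · rw [hI' s h, max_eq_right h.le]; simp
      · rw [hI s h, max_eq_left h]
    rw [← Set.Iic_sdiff_Iic, measure_sdiff (Set.Iic_subset_Iic.2 hab.le)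
      measurableSet_Iic.nullMeasurableSet (by rw [hI2]; exact ENNReal.mul_ne_top hVt ENNReal.ofReal_ne_top), hI2, hI2,
      ENNReal.mul_sub fun _ _ => hVt]
  refine Measure.ext_of_Ioc' _ _ (fun a b hab => ?_) (fun a b hab => ?_)
  · rw [hIoc a b hab]
    exact ENNReal.mul_ne_top hVt (ENNReal.sub_ne_top ENNReal.ofReal_ne_top)
  · rw [hIoc a b hab, withDensity_apply _ measurableSet_Ioc,
      Measure.restrict_restrict measurableSet_Ioc]
    have : Set.Ioc a b ∩ Set.Ioi 0 = Set.Ioc (max a 0) (max b 0) := by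
      ext x; simp only [Set.mem_inter_iff, Set.mem_Ioc, Set.mem_Ioi, max_lt_iff, le_max_iff]
      constructor
      · rintro ⟨⟨h1, h2⟩, h3⟩; exact ⟨⟨h1, h3⟩, Or.inl h2⟩
      · rintro ⟨⟨h1, h3⟩, h2⟩; exact ⟨⟨h1, h2.resolve_right (not_le.2 h3)⟩, h3⟩
    rw [this]
    have e : ∀ s : ℝ, radDens k (V * ENNReal.ofReal (k + 1)) s = V * ENNReal.ofReal ((k+1 : ℝ) * s ^ k) := by
      intro s; unfold radDens
      rw [mul_assoc, ← ENNReal.ofReal_mul (by positivity)]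
    simp only [e]
    rw [lintegral_const_mul _ (by fun_prop), lintegral_pow_Ioc (max_le_max hab.le le_rfl) (le_max_right _ _)]

/-! ### block weights -/

/-- block weights along `φ` -/
def wts {ι κ : Type*} [Fintype ι] (φ : ι → κ) (u : ι → ℂ) : κ → ℝ := fun a =>
  ∑ i : {i // φ i = a}, Complex.normSq (u i)

lemma measurable_wts {ι κ : Type*} [Fintype ι] (φ : ι → κ) : Measurable (wts φ) := by
  refine measurable_pi_lambda _ fun a => ?_
  exact Finset.measurable_sum _ fun i _ => measurable_normSq.comp (measurable_pi_apply _)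

lemma map_fiber {ι κ : Type} [Fintype ι] [Fintype κ] (φ : ι → κ) :
    Measure.map (fun (u : ι → ℂ) (a : κ) (i : {i // φ i = a}) => u i) volume =
      (Measure.pi fun a : κ => (volume : Measure ({i // φ i = a} → ℂ))) := by
  let e : (Σ a : κ, {i // φ i = a}) ≃ ι := Equiv.sigmaFiberEquiv φ
  have hm : Measurable (fun (u : ι → ℂ) (a : κ) (i : {i // φ i = a}) => u i) := by fun_prop
  have h0 := (volume_measurePreserving_piCongrLeft (fun _ : ι => ℂ) e)
  rw [← h0.map_eq, Measure.map_map hm (MeasurableEquiv.measurable _)]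
  have h1 : (fun (u : ι → ℂ) (a : κ) (i : {i // φ i = a}) => u i) ∘
      (MeasurableEquiv.piCongrLeft (fun _ : ι => ℂ) e) =
      fun (x : (Σ a : κ, {i // φ i = a}) → ℂ) a i => x ⟨a, i⟩ := by
    funext x a i
    simp only [Function.comp]
    have := Equiv.piCongrLeft_apply_apply (fun _ : ι => ℂ) e x ⟨a, i⟩
    exact this
  rw [h1]
  have hm2 : Measurable (fun (x : (Σ a : κ, {i // φ i = a}) → ℂ) (a : κ) (i : {i // φ i = a}) => x ⟨a, i⟩) := by
    fun_prop
  -- compare through the curried measure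
  have h2 : Measure.map (fun (y : ∀ a : κ, {i // φ i = a} → ℂ) (s : Σ a : κ, {i // φ i = a}) => y s.1 s.2)
      (Measure.pi fun a : κ => (volume : Measure ({i // φ i = a} → ℂ))) = volume := by
    refine (Measure.pi_eq fun s hs => ?_).symm
    rw [Measure.map_apply (by fun_prop) (MeasurableSet.univ_pi hs)]
    have : (fun (y : ∀ a : κ, {i // φ i = a} → ℂ) (s : Σ a : κ, {i // φ i = a}) => y s.1 s.2) ⁻¹'
        (Set.univ.pi s) = Set.univ.pi fun a => Set.univ.pi fun i => s ⟨a, i⟩ := by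
      ext y; simp [Set.mem_pi, Sigma.forall]
    rw [this, Measure.pi_pi, Fintype.prod_sigma]
    refine prod_congr rfl fun a _ => ?_
    rw [volume_pi_pi]
  rw [← h2, Measure.map_map hm2 (by fun_prop)]
  exact Measure.map_id

lemma lintegral_wts {ι κ : Type} [Fintype ι] [Fintype κ] (φ : ι → κ)
    (hφ : Function.Surjective φ) :
    ∃ c : ℝ≥0∞, ∀ f : (κ → ℝ) → ℝ≥0∞, Measurable f → 
      ∫⁻ u : ι → ℂ, f (wts φ u) = c * ∫⁻ p in {p : κ → ℝ | ∀ a, 0 < p a},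
        f p * ∏ a, ENNReal.ofReal (p a ^ (Nat.card {i // φ i = a} - 1)) := by
  simp only [Nat.card_eq_fintype_card]
  have hne : ∀ a, Nonempty {i // φ i = a} := fun a => let ⟨i, hi⟩ := hφ a; ⟨⟨i, hi⟩⟩
  choose c hc hmap using fun a => radial_map (ι := {i // φ i = a})
  refine ⟨∏ a, c a, fun f hf => ?_⟩
  have hsf : ∀ a, SigmaFinite ((volume.restrict (Set.Ioi (0:ℝ))).withDensity
      (radDens (Fintype.card {i // φ i = a} - 1) (c a))) := by
    intro a
    refine SigmaFinite.withDensity_of_ne_top (ae_of_all _ fun s => ?_)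
    exact ENNReal.mul_ne_top (hc a) ENNReal.ofReal_ne_top
  have hms : ∀ a, SigmaFinite (Measure.map (fun u : {i // φ i = a} → ℂ =>
      ∑ i, Complex.normSq (u i)) volume) := fun a => by rw [hmap a]; exact hsf a
  have hmr : ∀ a, Measurable (fun u : {i // φ i = a} → ℂ => ∑ i, Complex.normSq (u i)) := fun a =>
    Finset.measurable_sum _ fun i _ => measurable_normSq.comp (measurable_pi_apply _)
  have h1 : Measure.map (wts φ) volume = (volume.restrict {p : κ → ℝ | ∀ a, 0 < p a}).withDensity
      (fun p => ∏ a, radDens (Fintype.card {i // φ i = a} - 1) (c a) (p a)) := by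
    have hpi : Measure.map (wts φ) volume = Measure.map
        (fun (y : ∀ a : κ, {i // φ i = a} → ℂ) a => ∑ i, Complex.normSq (y a i))
        (Measure.map (fun (u : ι → ℂ) (a : κ) (i : {i // φ i = a}) => u i) volume) := by
      rw [Measure.map_map _ (by fun_prop)]
      · rfl
      · exact measurable_pi_lambda _ fun a => (hmr a).comp (measurable_pi_apply a)
    rw [hpi, map_fiber, Measure.pi_map_pi (fun a => (hmr a).aemeasurable)]
    simp only [hmap]
    rw [pi_withDensity _ _ (fun a => measurable_radDens _ _)]
    rw [← Measure.restrict_pi_pi]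
    congr 2
    ext p; simp
  rw [← lintegral_map hf (measurable_wts φ), h1, lintegral_withDensity_eq_lintegral_mul _ _ hf]
  · simp only [Pi.mul_apply, radDens, prod_mul_distrib, mul_assoc]
    rw [lintegral_const_mul]
    · simp only [mul_comm]
    · refine Measurable.mul ?_ hf
      exact Finset.measurable_prod _ fun a _ => by fun_prop
  · exact Finset.measurable_prod _ fun a _ => (measurable_radDens _ _).comp (measurable_pi_apply a)

/-! ### Linear change of variables -/

open scoped Matrix in
lemma map_mulVec {n : ℕ} (M : Matrix (Fin n) (Fin n) ℂ) (hM : M.det ≠ 0) :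
    Measure.map (fun x : Fin n → ℂ => M *ᵥ x) volume =
      ENNReal.ofReal ((Complex.normSq M.det)⁻¹) • volume := by
  have hd : LinearMap.det ((Matrix.toLin' M).restrictScalars ℝ) = Complex.normSq M.det := by
    rw [LinearMap.det_restrictScalars, LinearMap.det_toLin', Algebra.norm_complex_apply]
  have h := Measure.map_linearMap_addHaar_eq_smul_addHaar (volume : Measure (Fin n → ℂ))
    (f := (Matrix.toLin' M).restrictScalars ℝ) (by rw [hd]; simpa using hM)
  rw [hd, abs_of_nonneg (inv_nonneg.2 (Complex.normSq_nonneg _))] at h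
  exact h

open scoped Matrix in
lemma measurable_mulVec {n : ℕ} (M : Matrix (Fin n) (Fin n) ℂ) :
    Measurable (fun x : Fin n → ℂ => M *ᵥ x) := by
  have : Continuous (fun x : Fin n → ℂ => M *ᵥ x) := by fun_prop
  exact this.measurable

lemma measurePreserving_star (n : ℕ) :
    MeasurePreserving (fun x : Fin n → ℂ => star x) volume volume :=
  volume_preserving_pi (fun _ => Complex.conjLIE.measurePreserving)

open scoped Matrix in
lemma measurePreserving_unitary {n : ℕ} {U : Matrix (Fin n) (Fin n) ℂ} (hU : U * Uᴴ = 1) :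
    MeasurePreserving (fun v : Fin n → ℂ => Uᴴ *ᵥ star v) volume volume := by
  have h1 : Complex.normSq (Uᴴ).det = 1 := by
    have h := congrArg Matrix.det hU
    rw [Matrix.det_mul, Matrix.det_one] at h
    have h' := congrArg Complex.normSq h
    rw [Complex.normSq_mul, Complex.normSq_one, Matrix.det_conjTranspose] at h'
    rw [Matrix.det_conjTranspose]
    have e : Complex.normSq (star U.det) = Complex.normSq U.det := Complex.normSq_conj _
    rw [e] at h' ⊢
    nlinarith [Complex.normSq_nonneg U.det]
  have h2 : (Uᴴ).det ≠ 0 := by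
    intro h; rw [h] at h1; simp at h1
  have h3 : MeasurePreserving (fun x : Fin n → ℂ => Uᴴ *ᵥ x) volume volume := by
    refine ⟨measurable_mulVec _, ?_⟩
    rw [map_mulVec _ h2, h1]; simp
  exact h3.comp (measurePreserving_star n)

/-! ### One step -/

/-- block index map -/
def blk (n l : ℕ) (i : Fin n) : Fin (l + 1) :=
  if h : (i : ℕ) < l then Fin.succ (Fin.rev ⟨i, h⟩) else 0

lemma dvec_eq_blk {n l : ℕ} (τ : Fin l → ℝ) (i : Fin n) :
    dvec n τ i = (Fin.cons 0 τ : Fin (l + 1) → ℝ) (blk n l i) := by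
  unfold dvec blk
  split_ifs <;> simp

lemma blk_succ_iff {n l : ℕ} (hl : l < n) (i : Fin n) (j : Fin l) :
    blk n l i = j.succ ↔ i = ⟨Fin.rev j, (Fin.is_lt _).trans hl⟩ := by
  unfold blk
  split_ifs with h
  · rw [Fin.succ_inj, Fin.ext_iff, Fin.ext_iff]
    simp only [Fin.val_rev]
    omega
  · constructor
    · intro h'; exact absurd h'.symm (Fin.succ_ne_zero _)
    · intro h'
      exfalso; apply h
      rw [h']; simp only; exact Fin.is_lt _

lemma blk_zero_iff {n l : ℕ} (i : Fin n) : blk n l i = 0 ↔ l ≤ i := by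
  unfold blk
  split_ifs with h
  · constructor
    · intro h'; exact absurd h' (Fin.succ_ne_zero _)
    · intro h'; omega
  · simp; omega

lemma blk_surjective {n l : ℕ} (hl : l < n) : Function.Surjective (blk n l) := by
  intro a
  refine Fin.cases ?_ (fun j => ?_) a
  · exact ⟨⟨l, hl⟩, (blk_zero_iff _).2 le_rfl⟩
  · exact ⟨_, (blk_succ_iff hl _ j).2 rfl⟩

lemma card_blk_succ {n l : ℕ} (hl : l < n) (j : Fin l) :
    Fintype.card {i // blk n l i = j.succ} = 1 := by
  rw [Fintype.card_eq_one_iff]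
  refine ⟨⟨_, (blk_succ_iff hl _ j).2 rfl⟩, fun i => ?_⟩
  exact Subtype.ext ((blk_succ_iff hl _ j).1 i.2)

lemma card_blk_zero {n l : ℕ} (hl : l < n) :
    Fintype.card {i // blk n l i = 0} = n - l := by
  have h := Fintype.card_congr (Equiv.sigmaFiberEquiv (blk n l))
  rw [Fintype.card_sigma, Fin.sum_univ_succ] at h
  simp only [card_blk_succ hl, Fintype.card_fin, sum_const, card_univ, smul_eq_mul, mul_one] at h
  omega

lemma prod_blk {n l : ℕ} (hl : l < n) (p : Fin (l + 1) → ℝ) :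
    ∏ a, ENNReal.ofReal (p a ^ (Nat.card {i // blk n l i = a} - 1)) =
      ENNReal.ofReal (p 0 ^ (n - l - 1)) := by
  simp only [Nat.card_eq_fintype_card]
  rw [Fin.prod_univ_succ, card_blk_zero hl]
  simp [card_blk_succ hl]

open Polynomial in
open scoped Matrix in
lemma charpoly_step {n l : ℕ} (hl : l < n) (τ : Fin l → ℝ) (w : Fin n → ℂ) :
    (Matrix.diagonal (fun i => (dvec n τ i : ℂ)) + Matrix.vecMulVec w (star w)).charpoly =
      X ^ (n - l - 1) * (secPoly (Fin.cons 0 τ : Fin (l + 1) → ℝ) (wts (blk n l) w)).map Complex.ofRealHom := by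
  set t : Fin (l + 1) → ℝ := Fin.cons 0 τ with ht
  have hP : ∏ j, (X - C (dvec n τ j : ℂ)) = X ^ (n - l - 1) * ∏ a, (X - C (t a : ℂ)) := by
    rw [dvec_prod hl.le τ (fun r => X - C (r : ℂ)), Fin.prod_univ_succ]
    simp only [ht, Fin.cons_zero, Fin.cons_succ, Complex.ofReal_zero, C_0, sub_zero]
    rw [← mul_assoc, ← pow_succ, Nat.sub_add_cancel (by omega)]
  have hQ : ∀ i, ∏ j ∈ univ.erase i, (X - C (dvec n τ j : ℂ)) =
      X ^ (n - l - 1) * ∏ a ∈ univ.erase (blk n l i), (X - C (t a : ℂ)) := by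
    intro i
    have h := hP
    rw [← mul_prod_erase univ (fun j => X - C (dvec n τ j : ℂ)) (mem_univ i),
      ← mul_prod_erase univ (fun a => X - C (t a : ℂ)) (mem_univ (blk n l i)),
      dvec_eq_blk, ← ht, ← mul_assoc, mul_comm (X ^ (n - l - 1)), mul_assoc] at h
    exact mul_left_cancel₀ (X_sub_C_ne_zero _) h
  rw [charpoly_diag_add_rankone, hP]
  simp only [hQ, secPoly, Polynomial.map_sub, Polynomial.map_prod, Polynomial.map_sum,
    Polynomial.map_mul, Polynomial.map_X, Polynomial.map_C, mul_sub, Complex.ofRealHom_eq_coe]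
  congr 1
  rw [mul_sum]
  have hF := fun (G : Fin n → ℂ[X]) => Equiv.sum_comp (Equiv.sigmaFiberEquiv (blk n l)) G
  rw [← hF, Fintype.sum_sigma]
  refine sum_congr rfl fun a _ => ?_
  have : ∀ i : {i // blk n l i = a}, C (w ((Equiv.sigmaFiberEquiv (blk n l)) ⟨a, i⟩) *
      star w ((Equiv.sigmaFiberEquiv (blk n l)) ⟨a, i⟩)) * (X ^ (n - l - 1) *
        ∏ a ∈ univ.erase (blk n l ((Equiv.sigmaFiberEquiv (blk n l)) ⟨a, i⟩)), (X - C (t a : ℂ))) =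
      C ((Complex.normSq (w i) : ℂ)) * (X ^ (n - l - 1) * ∏ a ∈ univ.erase a, (X - C (t a : ℂ))) := by
    intro i
    have e1 : (Equiv.sigmaFiberEquiv (blk n l)) ⟨a, i⟩ = i.1 := rfl
    rw [e1, i.2, ← Complex.mul_conj]; rfl
  simp only [this]
  rw [← sum_mul, wts]
  push_cast
  rw [← map_sum, mul_comm, mul_assoc, mul_comm (C _)]
  congr!

open scoped Matrix in
open Polynomial in
lemma tl_step {n l : ℕ} (hl : l < n) (Z : ℕ → Fin n → ℂ) (hτ : StrictMono (tl l Z))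
    (hτ0 : ∀ i, 0 < tl l Z i) :
    ∃ T : (Fin n → ℂ) → (Fin n → ℂ), MeasurePreserving T volume volume ∧
      ∀ v y, y ∈ intSet (Fin.cons 0 (tl l Z) : Fin (l + 1) → ℝ) →
        wts (blk n l) (T v) = pmap (Fin.cons 0 (tl l Z) : Fin (l + 1) → ℝ) y →
        tl (l + 1) (Function.update Z l v) = y := by
  obtain ⟨h1, h2, h3⟩ := tl_spec hl.le Z
  obtain ⟨U, hU1, hU2, hU⟩ := exists_diag (gramC_posSemidef l Z).1 (dvec_antitone h1 h2) h3
  refine ⟨fun v => Uᴴ *ᵥ star v, measurePreserving_unitary hU1, fun v y hy hw => ?_⟩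
  set t : Fin (l + 1) → ℝ := Fin.cons 0 (tl l Z) with ht
  have hti : StrictMono t := by
    rw [ht]
    intro a b
    refine Fin.cases ?_ (fun i => ?_) a <;> refine Fin.cases ?_ (fun j => ?_) b
    · intro h; exact absurd h (lt_irrefl _)
    · intro _; simpa using hτ0 j
    · intro h; exact absurd h (by simp)
    · intro h; simpa using hτ (Fin.succ_lt_succ_iff.1 h)
  have ht0 : ∀ a, 0 ≤ t a := fun a => by
    have : t 0 ≤ t a := hti.monotone (Fin.zero_le a)
    simpa [ht] using this
  have hy0 : ∀ a, 0 ≤ y a := fun a => (ht0 a).trans (hy.1 a).le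
  refine tl_eq_of hl _ (intSet_strictMono hy).monotone hy0 ?_
  rw [dvec_prod (Nat.succ_le_of_lt hl) y (fun r => X - C (r : ℂ)), gramC_succ,
    gramC_congr l (W := Z) (fun i hi => by rw [Function.update_of_ne hi.ne]), Function.update_self]
  set w := Uᴴ *ᵥ star v with hwd
  have hv : star v = U *ᵥ w := by
    rw [hwd, Matrix.mulVec_mulVec, hU1, Matrix.one_mulVec]
  have hv2 : v = star w ᵥ* Uᴴ := by
    rw [← Matrix.star_mulVec, ← hv, star_star]
  have hmat : gramC l Z + Matrix.vecMulVec (star v) v =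
      U * ((Matrix.diagonal (fun i => (dvec n (tl l Z) i : ℂ)) + Matrix.vecMulVec w (star w)) * Uᴴ) := by
    have : Matrix.vecMulVec (star v) v = U * Matrix.vecMulVec w (star w) * Uᴴ := by
      rw [Matrix.mul_vecMulVec, Matrix.vecMulVec_mul, ← hv, ← hv2]
    rw [this, Matrix.add_mul, Matrix.mul_add, ← Matrix.mul_assoc, ← Matrix.mul_assoc, ← hU]
  rw [hmat, Matrix.charpoly_mul_comm, Matrix.mul_assoc, hU2, Matrix.mul_one, charpoly_step hl, hw,
    secPoly_pmap hti.injective]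
  simp only [Polynomial.map_prod, Polynomial.map_sub, Polynomial.map_X, Polynomial.map_C,
    Complex.ofRealHom_eq_coe, Complex.ofReal_zero, C_0, sub_zero]
  rw [Nat.sub_sub]

lemma cons_strictMono {l : ℕ} {τ : Fin l → ℝ} (hτ : StrictMono τ) (hτ0 : ∀ i, 0 < τ i) :
    StrictMono (Fin.cons 0 τ : Fin (l + 1) → ℝ) := by
  intro a b
  refine Fin.cases ?_ (fun i => ?_) a <;> refine Fin.cases ?_ (fun j => ?_) b
  · intro h; exact absurd h (lt_irrefl _)
  · intro _; simpa using hτ0 j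
  · intro h; exact absurd h (by simp)
  · intro h; simpa using hτ (Fin.succ_lt_succ_iff.1 h)

/-- transition density -/
def stepDens (n l : ℕ) (τ : Fin l → ℝ) (y : Fin (l + 1) → ℝ) : ℝ≥0∞ :=
  ENNReal.ofReal (VM y / VM (Fin.cons 0 τ : Fin (l + 1) → ℝ)) *
    ENNReal.ofReal (pmap (Fin.cons 0 τ : Fin (l + 1) → ℝ) y 0 ^ (n - l - 1))

lemma measurable_VM {N : ℕ} : Measurable (VM : (Fin N → ℝ) → ℝ) := by
  have : Continuous (VM : (Fin N → ℝ) → ℝ) := by unfold VM; fun_prop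
  exact this.measurable

lemma continuous_pmap {N : ℕ} (t : Fin N → ℝ) : Continuous (pmap t) := by
  refine continuous_pi fun i => ?_
  unfold pmap; fun_prop

lemma measurable_stepDens (n l : ℕ) (τ : Fin l → ℝ) : Measurable (stepDens n l τ) := by
  have h1 : Measurable fun y : Fin (l + 1) → ℝ =>
      ENNReal.ofReal (VM y / VM (Fin.cons 0 τ : Fin (l + 1) → ℝ)) :=
    (measurable_VM.div measurable_const).ennreal_ofReal
  have h2 : Measurable fun y : Fin (l + 1) → ℝ =>
      ENNReal.ofReal (pmap (Fin.cons 0 τ : Fin (l + 1) → ℝ) y 0 ^ (n - l - 1)) := by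
    have := ((continuous_apply 0).comp (continuous_pmap (Fin.cons 0 τ : Fin (l + 1) → ℝ))).pow (n - l - 1)
    exact this.measurable.ennreal_ofReal
  exact h1.mul h2

lemma step_lintegral {n l : ℕ} (hl : l < n) :
    ∃ c : ℝ≥0∞, ∀ Z : ℕ → Fin n → ℂ, StrictMono (tl l Z) → (∀ i, 0 < tl l Z i) →
      ∀ g : (Fin (l + 1) → ℝ) → ℝ≥0∞, Measurable g →
      ∫⁻ v : Fin n → ℂ, g (tl (l + 1) (Function.update Z l v)) =
        c * ∫⁻ y in intSet (Fin.cons 0 (tl l Z) : Fin (l + 1) → ℝ), g y * stepDens n l (tl l Z) y := by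
  obtain ⟨c, hc⟩ := lintegral_wts (blk n l) (blk_surjective hl)
  refine ⟨c, fun Z hτ hτ0 g hg => ?_⟩
  obtain ⟨T, hT, hTl⟩ := tl_step hl Z hτ hτ0
  have ht := cons_strictMono hτ hτ0
  set t : Fin (l + 1) → ℝ := Fin.cons 0 (tl l Z) with htd
  have hpos : MeasurableSet {p : Fin (l+1) → ℝ | ∀ a, 0 < p a} := by
    rw [← pmap_image ht]
    exact measurableSet_pmap_image ht (isOpen_intSet t).measurableSet subset_rfl
  have hae : ∀ᵐ v : Fin n → ℂ, ∀ a, 0 < wts (blk n l) (T v) a := by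
    have h := hc (Set.indicator {p : Fin (l+1) → ℝ | ∀ a, 0 < p a}ᶜ 1) (measurable_one.indicator hpos.compl)
    have h0 : ∫⁻ p in {p : Fin (l+1) → ℝ | ∀ a, 0 < p a}, Set.indicator {p : Fin (l+1) → ℝ | ∀ a, 0 < p a}ᶜ 1 p *
        ∏ a, ENNReal.ofReal (p a ^ (Nat.card {i // blk n l i = a} - 1)) = 0 := by
      rw [setLIntegral_congr_fun (g := fun _ => 0) hpos]
      · simp
      · intro p hp; simp [Set.indicator_of_notMem (show p ∉ {p : Fin (l+1) → ℝ | ∀ a, 0 < p a}ᶜ from fun h => h hp)]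
    rw [h0, mul_zero] at h
    have h := (lintegral_eq_zero_iff (f := fun u : Fin n → ℂ =>
      Set.indicator {p : Fin (l+1) → ℝ | ∀ a, 0 < p a}ᶜ (1 : (Fin (l+1) → ℝ) → ℝ≥0∞) (wts (blk n l) u))
      ((measurable_one.indicator hpos.compl).comp (measurable_wts _))).1 h
    have h2 : ∀ᵐ w : Fin n → ℂ, ∀ a, 0 < wts (blk n l) w a := by
      filter_upwards [h] with w hw
      by_contra hcon
      have : wts (blk n l) w ∈ {p : Fin (l+1) → ℝ | ∀ a, 0 < p a}ᶜ := hcon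
      rw [Set.indicator_of_mem this] at hw
      simp at hw
    exact hT.quasiMeasurePreserving.ae h2
  have hupd : Measurable fun v : Fin n → ℂ => tl (l + 1) (Function.update Z l v) := by
    refine measurable_tl hl _ fun i a => ?_
    by_cases h : i = l
    · subst h; simp only [Function.update_self]; exact measurable_pi_apply a
    · simp only [Function.update_of_ne h]; exact measurable_const
  have hmeas : Measure.map (fun v : Fin n → ℂ => tl (l + 1) (Function.update Z l v)) volume =
      c • (volume.restrict (intSet t)).withDensity (stepDens n l (tl l Z)) := by
    refine Measure.ext fun B hB => ?_
    have hBi : MeasurableSet (B ∩ intSet t) := hB.inter (isOpen_intSet t).measurableSet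
    have him := measurableSet_pmap_image ht hBi Set.inter_subset_right
    rw [Measure.map_apply hupd hB]
    have e1 : volume ((fun v : Fin n → ℂ => tl (l + 1) (Function.update Z l v)) ⁻¹' B) =
        volume ((fun v => wts (blk n l) (T v)) ⁻¹' (pmap t '' (B ∩ intSet t))) := by
      refine measure_congr ?_
      filter_upwards [hae] with v hv
      obtain ⟨y, hy, hyp⟩ := pmap_surj ht _ hv
      have hyt := hTl v y hy hyp.symm
      refine propext ?_
      show tl (l + 1) (Function.update Z l v) ∈ B ↔ wts (blk n l) (T v) ∈ pmap t '' (B ∩ intSet t)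
      rw [hyt, ← hyp]
      constructor
      · intro h; exact ⟨y, ⟨h, hy⟩, rfl⟩
      · rintro ⟨z, ⟨hz, hz2⟩, hzy⟩
        rwa [← pmap_injOn ht.injective hz2 hy hzy]
    have e2 : volume ((fun v => wts (blk n l) (T v)) ⁻¹' (pmap t '' (B ∩ intSet t))) =
        ∫⁻ w : Fin n → ℂ, Set.indicator (pmap t '' (B ∩ intSet t)) 1 (wts (blk n l) w) := by
      have hm : MeasurableSet ((wts (blk n l)) ⁻¹' (pmap t '' (B ∩ intSet t))) := measurable_wts _ him
      have : (fun v => wts (blk n l) (T v)) ⁻¹' (pmap t '' (B ∩ intSet t)) =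
        T ⁻¹' ((wts (blk n l)) ⁻¹' (pmap t '' (B ∩ intSet t))) := rfl
      rw [this, hT.measure_preimage hm.nullMeasurableSet, ← lintegral_indicator_one hm]
      rfl
    rw [e1, e2, hc _ (measurable_one.indicator him)]
    rw [Measure.smul_apply, smul_eq_mul, withDensity_apply _ hB,
      Measure.restrict_restrict hB]
    congr 1
    have e3 : ∀ p : Fin (l+1) → ℝ, Set.indicator (pmap t '' (B ∩ intSet t)) 1 p *
        ∏ a, ENNReal.ofReal (p a ^ (Nat.card {i // blk n l i = a} - 1)) =
        Set.indicator (pmap t '' (B ∩ intSet t)) (fun p => ENNReal.ofReal (p 0 ^ (n - l - 1))) p := by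
      intro p
      rw [prod_blk hl]
      by_cases hp : p ∈ pmap t '' (B ∩ intSet t)
      · simp [Set.indicator_of_mem hp]
      · simp [Set.indicator_of_notMem hp]
    simp only [e3]
    rw [setLIntegral_indicator him, Set.inter_eq_self_of_subset_left, lintegral_pmap_image ht hBi Set.inter_subset_right]
    · rfl
    · rw [← pmap_image ht]; exact Set.image_mono Set.inter_subset_right
  rw [← lintegral_map hg hupd, hmeas, lintegral_smul_measure, smul_eq_mul,
    lintegral_withDensity_eq_lintegral_mul _ (measurable_stepDens _ _ _) hg]
  congr 1
  exact lintegral_congr fun y => mul_comm _ _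

/-! ### Induction over levels -/

lemma mem_coords {m n : ℕ} (hmn : m ≤ n) (p : ℕ × ℕ) : p ∈ coords m n ↔ p.1 < m ∧ p.2 ≤ p.1 := by
  simp only [coords, mem_filter, mem_product, mem_range, lt_min_iff]
  omega

/-- index equivalence -/
def coordsEquiv {m n : ℕ} (hmn : m + 1 ≤ n) :
    ({p // p ∈ coords m n} ⊕ Fin (m + 1)) ≃ {p // p ∈ coords (m + 1) n} where
  toFun := Sum.elim (fun c => ⟨c.1, (mem_coords hmn _).2
      ⟨((mem_coords (by omega) _).1 c.2).1.trans (Nat.lt_succ_self m),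
        ((mem_coords (by omega) _).1 c.2).2⟩⟩)
    (fun i => ⟨(m, i), (mem_coords hmn _).2 ⟨Nat.lt_succ_self m, Nat.lt_succ_iff.1 i.2⟩⟩)
  invFun c := if h : c.1.1 < m then
      Sum.inl ⟨c.1, (mem_coords (by omega) _).2 ⟨h, ((mem_coords hmn _).1 c.2).2⟩⟩
    else Sum.inr ⟨c.1.2, by have := (mem_coords hmn _).1 c.2; omega⟩
  left_inv := by
    rintro (c | i)
    · have := ((mem_coords (by omega) _).1 c.2).1
      simp [this]
    · simp
  right_inv := by
    rintro ⟨⟨a, b⟩, hc⟩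
    have := (mem_coords hmn _).1 hc
    by_cases h : a < m
    · simp [h]
    · have : a = m := by simp at this; omega
      subst this
      simp

/-- join an array with a new level -/
def joinE {m n : ℕ} (hmn : m + 1 ≤ n) : (Arr m n × (Fin (m + 1) → ℝ)) ≃ᵐ Arr (m + 1) n :=
  (MeasurableEquiv.sumPiEquivProdPi (fun _ : {p // p ∈ coords m n} ⊕ Fin (m + 1) => ℝ)).symm.trans
    (MeasurableEquiv.piCongrLeft (fun _ => ℝ) (coordsEquiv hmn))

lemma joinE_mp {m n : ℕ} (hmn : m + 1 ≤ n) : MeasurePreserving (joinE hmn) volume volume := by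
  have h1 := volume_measurePreserving_sumPiEquivProdPi_symm
    (fun _ : {p // p ∈ coords m n} ⊕ Fin (m + 1) => ℝ)
  have h2 := volume_measurePreserving_piCongrLeft (fun _ => ℝ) (coordsEquiv hmn)
  exact h2.comp h1

lemma joinE_inl {m n : ℕ} (hmn : m + 1 ≤ n) (x : Arr m n × (Fin (m + 1) → ℝ))
    (c : {p // p ∈ coords m n}) : joinE hmn x (coordsEquiv hmn (Sum.inl c)) = x.1 c := by
  exact Equiv.piCongrLeft_apply_apply (fun _ => ℝ) (coordsEquiv hmn)
    ((MeasurableEquiv.sumPiEquivProdPi (fun _ : {p // p ∈ coords m n} ⊕ Fin (m + 1) => ℝ)).symm x)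
    (Sum.inl c)

lemma joinE_inr {m n : ℕ} (hmn : m + 1 ≤ n) (x : Arr m n × (Fin (m + 1) → ℝ))
    (i : Fin (m + 1)) : joinE hmn x (coordsEquiv hmn (Sum.inr i)) = x.2 i := by
  exact Equiv.piCongrLeft_apply_apply (fun _ => ℝ) (coordsEquiv hmn)
    ((MeasurableEquiv.sumPiEquivProdPi (fun _ : {p // p ∈ coords m n} ⊕ Fin (m + 1) => ℝ)).symm x)
    (Sum.inr i)

/-- level as a vector -/
def levF {m n : ℕ} (μ : Arr m n) (l : ℕ) : Fin l → ℝ := fun i => lev μ l i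

lemma lev_succ {m n : ℕ} (hmn : m ≤ n) (μ : Arr m n) {l i : ℕ} (hl : l < m) (hi : i ≤ l) :
    lev μ (l + 1) i = μ ⟨(l, i), (mem_coords hmn _).2 ⟨hl, hi⟩⟩ := by
  have h : (l, i) ∈ coords m n := (mem_coords hmn _).2 ⟨hl, hi⟩
  simp [lev, ent, h]

lemma levF_join_lt {m n : ℕ} (hmn : m + 1 ≤ n) (x : Arr m n × (Fin (m + 1) → ℝ)) {l : ℕ}
    (hl : l ≤ m) : levF (joinE hmn x) l = levF x.1 l := by
  funext i
  cases l with
  | zero => exact i.elim0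
  | succ l =>
    have hi : (i : ℕ) ≤ l := Nat.lt_succ_iff.1 i.2
    simp only [levF]
    rw [lev_succ hmn _ (by omega) hi, lev_succ (by omega) _ hl hi]
    exact joinE_inl hmn x ⟨(l, i), _⟩

lemma levF_join_top {m n : ℕ} (hmn : m + 1 ≤ n) (x : Arr m n × (Fin (m + 1) → ℝ)) :
    levF (joinE hmn x) (m + 1) = x.2 := by
  funext i
  simp only [levF]
  rw [lev_succ hmn _ (by omega) (Nat.lt_succ_iff.1 i.2)]
  exact joinE_inr hmn x i

lemma measurable_levF {m n : ℕ} (l : ℕ) : Measurable fun μ : Arr m n => levF μ l := by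
  refine measurable_pi_lambda _ fun i => ?_
  unfold levF lev ent
  split_ifs
  · exact measurable_const
  · exact measurable_pi_apply _
  · exact measurable_const

/-- the array of Wishart eigenvalues (increasing) -/
def Tarr {n : ℕ} (m : ℕ) (Z : ℕ → Fin n → ℂ) : Arr m n :=
  fun c => eigsDesc (gramC (c.1.1 + 1) Z) (c.1.1 - c.1.2)

lemma Tarr_levF {m n : ℕ} (hmn : m ≤ n) (Z : ℕ → Fin n → ℂ) {l : ℕ} (hl : l ≤ m) :
    levF (Tarr m Z) l = tl l Z := by
  funext i
  cases l with
  | zero => exact i.elim0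
  | succ l =>
    simp only [levF]
    rw [lev_succ hmn _ (by omega) (Nat.lt_succ_iff.1 i.2)]
    rfl

lemma measurable_Tarr {α : Type*} [MeasurableSpace α] {m n : ℕ} (hmn : m ≤ n)
    (Z : α → ℕ → Fin n → ℂ) (hZ : ∀ i a, Measurable fun ω => Z ω i a) :
    Measurable fun ω => Tarr m (Z ω) := by
  refine measurable_pi_lambda _ fun c => ?_
  have hc := (mem_coords hmn _).1 c.2
  have := measurable_tl (l := c.1.1 + 1) (by omega) Z hZ
  exact (measurable_pi_apply (⟨c.1.2, by omega⟩ : Fin (c.1.1 + 1))).comp this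

/-- extension by zero -/
def extZ {m n : ℕ} (Z : Fin m → Fin n → ℂ) : ℕ → Fin n → ℂ :=
  fun i => if h : i < m then Z ⟨i, h⟩ else 0

lemma measurable_extZ {m n : ℕ} (i : ℕ) (a : Fin n) :
    Measurable fun Z : Fin m → Fin n → ℂ => extZ Z i a := by
  unfold extZ
  split_ifs
  · fun_prop
  · exact measurable_const

lemma extZ_insertNth {m n : ℕ} (v : Fin n → ℂ) (Z : Fin m → Fin n → ℂ) :
    extZ (Fin.insertNth (α := fun _ => Fin n → ℂ) (Fin.last m) v Z) = Function.update (extZ Z) m v := by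
  funext i
  by_cases h : i = m
  · subst h
    simp only [extZ, Function.update_self, lt_add_iff_pos_right, Nat.lt_one_iff, pos_of_gt, dite_true]
    exact Fin.insertNth_apply_same (α := fun _ => Fin n → ℂ) (Fin.last i) v Z
  · rw [Function.update_of_ne h]
    unfold extZ
    by_cases h' : i < m
    · rw [dif_pos h', dif_pos (by omega)]
      have := Fin.insertNth_apply_succAbove (α := fun _ => Fin n → ℂ) (Fin.last m) v Z ⟨i, h'⟩
      rw [Fin.succAbove_last] at this
      exact this
    · rw [dif_neg h', dif_neg (by omega)]

lemma Tarr_update {m n : ℕ} (hmn : m + 1 ≤ n) (Z : ℕ → Fin n → ℂ) (v : Fin n → ℂ) :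
    Tarr (m + 1) (Function.update Z m v) =
      joinE hmn (Tarr m Z, tl (m + 1) (Function.update Z m v)) := by
  funext c
  obtain ⟨s, rfl⟩ := (coordsEquiv hmn).surjective c
  rcases s with c | i
  · rw [joinE_inl]
    have hc := (mem_coords (by omega) _).1 c.2
    show eigsDesc (gramC (c.1.1 + 1) (Function.update Z m v)) (c.1.1 - c.1.2) =
      eigsDesc (gramC (c.1.1 + 1) Z) (c.1.1 - c.1.2)
    rw [gramC_congr (c.1.1 + 1) (W := Z) fun i hi => by
      rw [Function.update_of_ne (by omega)]]
  · rw [joinE_inr]; rfl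

/-- one-step kernel with indicator -/
def stepK (n l : ℕ) (τ : Fin l → ℝ) (y : Fin (l + 1) → ℝ) : ℝ≥0∞ :=
  Set.indicator (intSet (Fin.cons 0 τ : Fin (l + 1) → ℝ)) (stepDens n l τ) y

/-- density of the T array -/
def Wd {m : ℕ} (n : ℕ) (μ : Arr m n) : ℝ≥0∞ :=
  ∏ l ∈ range m, stepK n l (levF μ l) (levF μ (l + 1))

lemma measurable_cons {l : ℕ} : Measurable fun τ : Fin l → ℝ => (Fin.cons 0 τ : Fin (l + 1) → ℝ) := by
  refine measurable_pi_lambda _ fun i => ?_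
  refine Fin.cases ?_ (fun j => ?_) i
  · simp
  · simpa using measurable_pi_apply j

lemma measurable_stepK (n l : ℕ) :
    Measurable fun x : (Fin l → ℝ) × (Fin (l + 1) → ℝ) => stepK n l x.1 x.2 := by
  have hc : Measurable fun x : (Fin l → ℝ) × (Fin (l + 1) → ℝ) => (Fin.cons 0 x.1 : Fin (l + 1) → ℝ) :=
    measurable_cons.comp measurable_fst
  have hc' : ∀ i, Measurable fun x : (Fin l → ℝ) × (Fin (l + 1) → ℝ) => (Fin.cons 0 x.1 : Fin (l + 1) → ℝ) i :=
    fun i => (measurable_pi_apply i).comp hc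
  have hs' : ∀ i, Measurable fun x : (Fin l → ℝ) × (Fin (l + 1) → ℝ) => x.2 i :=
    fun i => (measurable_pi_apply i).comp measurable_snd
  have h1 : MeasurableSet {x : (Fin l → ℝ) × (Fin (l + 1) → ℝ) |
      x.2 ∈ intSet (Fin.cons 0 x.1 : Fin (l + 1) → ℝ)} := by
    have : {x : (Fin l → ℝ) × (Fin (l + 1) → ℝ) | x.2 ∈ intSet (Fin.cons 0 x.1 : Fin (l + 1) → ℝ)} =
      (⋂ i, {x | (Fin.cons 0 x.1 : Fin (l + 1) → ℝ) i < x.2 i}) ∩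
        ⋂ i, ⋂ j, ⋂ (_ : i < j), {x | x.2 i < (Fin.cons 0 x.1 : Fin (l + 1) → ℝ) j} := by
      ext x; simp [intSet]
    rw [this]
    refine (MeasurableSet.iInter fun i => measurableSet_lt (hc' i) (hs' i)).inter ?_
    exact MeasurableSet.iInter fun i => MeasurableSet.iInter fun j => MeasurableSet.iInter fun _ =>
      measurableSet_lt (hs' i) (hc' j)
  have h2 : Measurable fun x : (Fin l → ℝ) × (Fin (l + 1) → ℝ) => stepDens n l x.1 x.2 := by
    have e1 : Measurable fun x : (Fin l → ℝ) × (Fin (l + 1) → ℝ) =>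
        ENNReal.ofReal (VM x.2 / VM (Fin.cons 0 x.1 : Fin (l + 1) → ℝ)) :=
      ((measurable_VM.comp measurable_snd).div (measurable_VM.comp hc)).ennreal_ofReal
    have e2 : Measurable fun x : (Fin l → ℝ) × (Fin (l + 1) → ℝ) =>
        ENNReal.ofReal (pmap (Fin.cons 0 x.1 : Fin (l + 1) → ℝ) x.2 0 ^ (n - l - 1)) := by
      refine Measurable.ennreal_ofReal (Measurable.pow_const ?_ _)
      unfold pmap
      refine Measurable.div (Measurable.neg ?_) ?_
      · exact Finset.measurable_prod _ fun j _ => (hc' 0).sub (hs' j)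
      · exact Finset.measurable_prod _ fun j _ => (hc' 0).sub (hc' j)
    exact e1.mul e2
  have : (fun x : (Fin l → ℝ) × (Fin (l + 1) → ℝ) => stepK n l x.1 x.2) =
      Set.indicator {x : (Fin l → ℝ) × (Fin (l + 1) → ℝ) |
        x.2 ∈ intSet (Fin.cons 0 x.1 : Fin (l + 1) → ℝ)} (fun x => stepDens n l x.1 x.2) := by
    funext x
    by_cases h : x.2 ∈ intSet (Fin.cons 0 x.1 : Fin (l + 1) → ℝ)
    · rw [stepK, Set.indicator_of_mem h, Set.indicator_of_mem (by exact h)]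
    · rw [stepK, Set.indicator_of_notMem h, Set.indicator_of_notMem (by exact h)]
  rw [this]
  exact h2.indicator h1

lemma measurable_Wd {m n : ℕ} : Measurable (Wd n : Arr m n → ℝ≥0∞) := by
  unfold Wd
  refine Finset.measurable_prod _ fun l _ => ?_
  exact (measurable_stepK n l).comp ((measurable_levF l).prodMk (measurable_levF (l + 1)))

lemma Wd_join {m n : ℕ} (hmn : m + 1 ≤ n) (x : Arr m n × (Fin (m + 1) → ℝ)) :
    Wd n (joinE hmn x) = Wd n x.1 * stepK n m (levF x.1 m) x.2 := by
  unfold Wd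
  rw [prod_range_succ, levF_join_top, levF_join_lt hmn x le_rfl]
  congr 1
  refine prod_congr rfl fun l hl => ?_
  have := mem_range.1 hl
  rw [levF_join_lt hmn x (by omega), levF_join_lt hmn x (by omega)]

lemma Wd_ne_zero {m n : ℕ} {μ : Arr m n} (h : Wd n μ ≠ 0) {l : ℕ} (hl : l < m) :
    levF μ (l + 1) ∈ intSet (Fin.cons 0 (levF μ l) : Fin (l + 1) → ℝ) := by
  by_contra hcon
  refine h (prod_eq_zero (mem_range.2 hl) ?_)
  rw [stepK, Set.indicator_of_notMem hcon]

lemma Wd_good {m n : ℕ} {μ : Arr m n} (h : Wd n μ ≠ 0) {l : ℕ} (hl : l ≤ m) :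
    StrictMono (levF μ l) ∧ ∀ i, 0 < levF μ l i := by
  cases l with
  | zero => exact ⟨fun i => i.elim0, fun i => i.elim0⟩
  | succ l =>
    have h1 := Wd_ne_zero h (l := l) (by omega)
    have h2 := intSet_strictMono h1
    refine ⟨h2, fun i => lt_of_lt_of_le ?_ (h2.monotone (Fin.zero_le i))⟩
    simpa using h1.1 0

lemma measurableSet_good (l : ℕ) : MeasurableSet {τ : Fin l → ℝ | StrictMono τ ∧ ∀ i, 0 < τ i} := by
  have : {τ : Fin l → ℝ | StrictMono τ ∧ ∀ i, 0 < τ i} =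
      (⋂ i, ⋂ j, ⋂ (_ : i < j), {τ | τ i < τ j}) ∩ ⋂ i, {τ | 0 < τ i} := by
    ext x; simp [StrictMono]
  rw [this]
  refine MeasurableSet.inter ?_ ?_
  · exact MeasurableSet.iInter fun i => MeasurableSet.iInter fun j => MeasurableSet.iInter fun _ =>
      measurableSet_lt (measurable_pi_apply i) (measurable_pi_apply j)
  · exact MeasurableSet.iInter fun i => measurableSet_lt measurable_const (measurable_pi_apply i)

lemma ae_good_of {m n : ℕ} (hmn : m ≤ n) {c : ℝ≥0∞}
    (hc : ∀ G : Arr m n → ℝ≥0∞, Measurable G →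
      ∫⁻ Z : Fin m → Fin n → ℂ, G (Tarr m (extZ Z)) = c * ∫⁻ μ, G μ * Wd n μ) :
    ∀ᵐ Z : Fin m → Fin n → ℂ, StrictMono (tl m (extZ Z)) ∧ ∀ i, 0 < tl m (extZ Z) i := by
  set S : Set (Arr m n) := {μ | StrictMono (levF μ m) ∧ ∀ i, 0 < levF μ m i} with hS
  have hSm : MeasurableSet S := (measurable_levF m) (measurableSet_good m)
  have h := hc (Set.indicator Sᶜ 1) (measurable_one.indicator hSm.compl)
  have h0 : ∀ μ : Arr m n, Set.indicator Sᶜ (1 : Arr m n → ℝ≥0∞) μ * Wd n μ = 0 := by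
    intro μ
    by_cases hW : Wd n μ = 0
    · rw [hW, mul_zero]
    · have hmem : μ ∈ S := Wd_good hW le_rfl
      rw [Set.indicator_of_notMem (Set.notMem_compl_iff.2 hmem), zero_mul]
  simp only [h0, lintegral_zero, mul_zero] at h
  have hTm : Measurable fun Z : Fin m → Fin n → ℂ => Tarr m (extZ Z) :=
    measurable_Tarr hmn _ measurable_extZ
  have h := (lintegral_eq_zero_iff (f := fun Z : Fin m → Fin n → ℂ =>
    Set.indicator Sᶜ (1 : Arr m n → ℝ≥0∞) (Tarr m (extZ Z)))
    ((measurable_one.indicator hSm.compl).comp hTm)).1 h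
  filter_upwards [h] with Z hZ
  by_contra hcon
  have : Tarr m (extZ Z) ∈ Sᶜ := by
    intro h'
    have h'' : StrictMono (levF (Tarr m (extZ Z)) m) ∧ ∀ i, 0 < levF (Tarr m (extZ Z)) m i := h'
    rw [Tarr_levF hmn _ le_rfl] at h''
    exact hcon h''
  rw [Set.indicator_of_mem this] at hZ
  simp at hZ

theorem lintegral_Tarr {n : ℕ} (m : ℕ) (hmn : m ≤ n) :
    ∃ c : ℝ≥0∞, ∀ G : Arr m n → ℝ≥0∞, Measurable G →
      ∫⁻ Z : Fin m → Fin n → ℂ, G (Tarr m (extZ Z)) = c * ∫⁻ μ, G μ * Wd n μ := by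
  induction m with
  | zero =>
    refine ⟨1, fun G hG => ?_⟩
    have : IsEmpty {p // p ∈ coords 0 n} := ⟨fun c => by simpa [coords] using c.2⟩
    have hv : (volume : Measure (Arr 0 n)) = Measure.dirac isEmptyElim := by
      rw [volume_pi]; exact Measure.pi_of_empty _
    rw [hv, volume_pi, Measure.pi_of_empty]
    rw [lintegral_dirac, lintegral_dirac]
    simp only [Wd, range_zero, prod_empty, mul_one, one_mul]
    congr 1
    exact Subsingleton.elim _ _
  | succ m ih =>
    obtain ⟨c, hc⟩ := ih (by omega)
    obtain ⟨c', hc'⟩ := step_lintegral (n := n) (l := m) (by omega)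
    refine ⟨c' * c, fun G hG => ?_⟩
    have hgood := ae_good_of (by omega) hc
    have hTm : Measurable fun Z : Fin (m + 1) → Fin n → ℂ => Tarr (m + 1) (extZ Z) :=
      measurable_Tarr hmn _ measurable_extZ
    have e1 := ((volume_preserving_piFinSuccAbove (fun _ : Fin (m + 1) => Fin n → ℂ)
      (Fin.last m)).symm).lintegral_comp (hG.comp hTm)
    rw [show (∫⁻ Z : Fin (m + 1) → Fin n → ℂ, G (Tarr (m + 1) (extZ Z))) =
      ∫⁻ Z : Fin (m + 1) → Fin n → ℂ, (G ∘ fun Z => Tarr (m + 1) (extZ Z)) Z from rfl, ← e1]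
    have e2 : ∀ x : (Fin n → ℂ) × (Fin m → Fin n → ℂ),
        (G ∘ fun Z => Tarr (m + 1) (extZ Z)) ((MeasurableEquiv.piFinSuccAbove
          (fun _ : Fin (m + 1) => Fin n → ℂ) (Fin.last m)).symm x) =
        G (joinE hmn (Tarr m (extZ x.2), tl (m + 1) (Function.update (extZ x.2) m x.1))) := by
      intro x
      rw [← Tarr_update hmn, ← extZ_insertNth]
      rfl
    simp only [e2]
    have hZm : ∀ i a, Measurable fun x : (Fin n → ℂ) × (Fin m → Fin n → ℂ) =>
        Function.update (extZ x.2) m x.1 i a := by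
      intro i a
      by_cases h : i = m
      · subst h
        simp only [Function.update_self]
        exact (measurable_pi_apply a).comp measurable_fst
      · simp only [Function.update_of_ne h]
        exact (measurable_extZ i a).comp measurable_snd
    have hm1 : Measurable fun x : (Fin n → ℂ) × (Fin m → Fin n → ℂ) =>
        G (joinE hmn (Tarr m (extZ x.2), tl (m + 1) (Function.update (extZ x.2) m x.1))) := by
      refine hG.comp ((joinE hmn).measurable.comp (Measurable.prodMk ?_ ?_))
      · exact (measurable_Tarr (by omega) _ measurable_extZ).comp measurable_snd
      · exact measurable_tl hmn _ hZm
    rw [Measure.volume_eq_prod, lintegral_prod_symm _ hm1.aemeasurable]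
    have e3 : ∀ᵐ Z : Fin m → Fin n → ℂ, ∫⁻ v : Fin n → ℂ,
        G (joinE hmn (Tarr m (extZ Z), tl (m + 1) (Function.update (extZ Z) m v))) =
        (fun μ : Arr m n => c' * ∫⁻ y, G (joinE hmn (μ, y)) * stepK n m (levF μ m) y)
          (Tarr m (extZ Z)) := by
      filter_upwards [hgood] with Z hZ
      rw [hc' (extZ Z) hZ.1 hZ.2 (fun y => G (joinE hmn (Tarr m (extZ Z), y)))
        (hG.comp ((joinE hmn).measurable.comp measurable_prodMk_left))]
      rw [← lintegral_indicator (isOpen_intSet _).measurableSet, Tarr_levF (by omega) _ le_rfl]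
      congr 2
      funext y
      unfold stepK
      by_cases h : y ∈ intSet (Fin.cons 0 (tl m (extZ Z)) : Fin (m + 1) → ℝ)
      · rw [Set.indicator_of_mem h, Set.indicator_of_mem h]
      · rw [Set.indicator_of_notMem h, Set.indicator_of_notMem h, mul_zero]
    have hm2 : Measurable fun x : Arr m n × (Fin (m + 1) → ℝ) =>
        G (joinE hmn x) * stepK n m (levF x.1 m) x.2 :=
      (hG.comp (joinE hmn).measurable).mul ((measurable_stepK n m).comp
        (((measurable_levF m).comp measurable_fst).prodMk measurable_snd))
    have hm3 : Measurable fun μ : Arr m n => ∫⁻ y, G (joinE hmn (μ, y)) * stepK n m (levF μ m) y :=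
      hm2.lintegral_prod_right'
    rw [lintegral_congr_ae e3, hc _ (hm3.const_mul c')]
    have e4 : ∀ μ : Arr m n, (c' * ∫⁻ y, G (joinE hmn (μ, y)) * stepK n m (levF μ m) y) * Wd n μ =
        c' * ∫⁻ y, G (joinE hmn (μ, y)) * Wd n (joinE hmn (μ, y)) := by
      intro μ
      have hm5 : Measurable fun y => G (joinE hmn (μ, y)) * stepK n m (levF μ m) y :=
        hm2.comp measurable_prodMk_left
      rw [mul_assoc, ← lintegral_mul_const _ hm5]
      congr 2
      funext y
      rw [Wd_join]; ring
    simp only [e4]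
    have hm4 : Measurable fun x : Arr m n × (Fin (m + 1) → ℝ) => G (joinE hmn x) * Wd n (joinE hmn x) :=
      (hG.comp (joinE hmn).measurable).mul (measurable_Wd.comp (joinE hmn).measurable)
    rw [lintegral_const_mul _ hm4.lintegral_prod_right', ← mul_assoc, mul_comm c c']
    congr 1
    rw [← lintegral_prod (fun x : Arr m n × (Fin (m + 1) → ℝ) =>
      G (joinE hmn x) * Wd n (joinE hmn x)) hm4.aemeasurable, ← Measure.volume_eq_prod]
    exact (joinE_mp hmn).lintegral_comp (hG.mul measurable_Wd)

lemma ae_good {m n : ℕ} (hmn : m ≤ n) :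
    ∀ᵐ Z : Fin m → Fin n → ℂ, StrictMono (tl m (extZ Z)) ∧ ∀ i, 0 < tl m (extZ Z) i := by
  obtain ⟨c, hc⟩ := lintegral_Tarr m hmn
  exact ae_good_of hmn hc

/-! ### Telescoping the density -/

/-- one-level weight -/
def Fw (n l : ℕ) (y : Fin l → ℝ) : ℝ := VM y * (∏ i, y i) ^ (n - l)

lemma Fw_pos {n l : ℕ} {y : Fin l → ℝ} (hy : StrictMono y) (h0 : ∀ i, 0 < y i) : 0 < Fw n l y :=
  mul_pos (VM_pos hy) (pow_pos (prod_pos fun i _ => h0 i) _)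

lemma pmap_cons_zero {l : ℕ} (τ : Fin l → ℝ) (y : Fin (l + 1) → ℝ) :
    pmap (Fin.cons 0 τ : Fin (l + 1) → ℝ) y 0 = (∏ i, y i) / ∏ i, τ i := by
  have h1 : ∏ j ∈ univ.erase (0 : Fin (l + 1)), ((Fin.cons 0 τ : Fin (l + 1) → ℝ) 0 -
      (Fin.cons 0 τ : Fin (l + 1) → ℝ) j) = (-1) ^ l * ∏ i, τ i := by
    have e : univ.erase (0 : Fin (l + 1)) = univ.map (Fin.succEmb l) := by
      ext j
      simp only [mem_erase, mem_univ, and_true, Finset.mem_map, true_and, Fin.coe_succEmb]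
      exact (Fin.exists_succ_eq (x := j)).symm
    rw [e, prod_map]
    simp [prod_neg]
  rw [pmap, h1]
  simp only [Fin.cons_zero, zero_sub]
  rw [prod_neg]
  simp only [card_univ, Fintype.card_fin, pow_succ]
  have : ((-1 : ℝ) ^ l) ≠ 0 := by simp
  rw [show -((-1 : ℝ) ^ l * -1 * ∏ i, y i) = (-1) ^ l * ∏ i, y i by ring, mul_div_mul_left _ _ this]

lemma VM_cons_zero {l : ℕ} (τ : Fin l → ℝ) :
    VM (Fin.cons 0 τ : Fin (l + 1) → ℝ) = VM τ * ∏ i, τ i := by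
  have := Matrix.det_vandermonde (Fin.cons 0 τ : Fin (l + 1) → ℝ)
  unfold VM
  rw [Fin.prod_univ_succ, mul_comm]
  congr 1
  · refine prod_congr rfl fun i _ => ?_
    rw [← Fin.map_succEmb_Ioi, prod_map]
    simp
  · have e : Ioi (0 : Fin (l + 1)) = univ.map (Fin.succEmb l) := by
      ext j
      simp only [mem_Ioi, Finset.mem_map, mem_univ, true_and, Fin.coe_succEmb]
      rw [Fin.pos_iff_ne_zero]
      exact (Fin.exists_succ_eq (x := j)).symm
    rw [e, prod_map]
    simp

lemma stepDens_eq {n l : ℕ} (hl : l < n) {τ : Fin l → ℝ} {y : Fin (l + 1) → ℝ} (hτ : StrictMono τ)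
    (hτ0 : ∀ i, 0 < τ i) (hy : StrictMono y) (hy0 : ∀ i, 0 < y i) :
    ENNReal.ofReal (Fw n l τ) * stepDens n l τ y = ENNReal.ofReal (Fw n (l + 1) y) := by
  have h1 := VM_pos hτ
  have h2 := VM_pos hy
  have h3 : 0 < ∏ i, τ i := prod_pos fun i _ => hτ0 i
  have h4 : 0 < ∏ i, y i := prod_pos fun i _ => hy0 i
  rw [stepDens, pmap_cons_zero, VM_cons_zero, ← ENNReal.ofReal_mul (by positivity),
    ← ENNReal.ofReal_mul (Fw_pos hτ hτ0).le]
  congr 1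
  unfold Fw
  rw [show n - l = (n - l - 1) + 1 by omega, show n - (l + 1) = n - l - 1 by omega]
  simp only [Nat.add_sub_cancel]
  rw [div_pow, pow_succ]
  field_simp

/-- the chain condition -/
def chainT {m n : ℕ} (μ : Arr m n) : Prop :=
  ∀ l, l < m → levF μ (l + 1) ∈ intSet (Fin.cons 0 (levF μ l) : Fin (l + 1) → ℝ)

lemma chainT_good {m n : ℕ} {μ : Arr m n} (h : chainT μ) {l : ℕ} (hl : l ≤ m) :
    StrictMono (levF μ l) ∧ ∀ i, 0 < levF μ l i := by
  cases l with
  | zero => exact ⟨fun i => i.elim0, fun i => i.elim0⟩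
  | succ l =>
    have h1 := h l (by omega)
    have h2 := intSet_strictMono h1
    refine ⟨h2, fun i => lt_of_lt_of_le ?_ (h2.monotone (Fin.zero_le i))⟩
    simpa using h1.1 0

lemma Wd_eq {m n : ℕ} (hmn : m ≤ n) {μ : Arr m n} (h : chainT μ) :
    Wd n μ = ENNReal.ofReal (Fw n m (levF μ m)) := by
  have key : ∀ k ≤ m, ∏ l ∈ range k, stepK n l (levF μ l) (levF μ (l + 1)) =
      ENNReal.ofReal (Fw n k (levF μ k)) := by
    intro k
    induction k with
    | zero => intro _; simp [Fw, VM]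
    | succ k ih =>
      intro hk
      rw [prod_range_succ, ih (by omega), stepK, Set.indicator_of_mem (h k (by omega))]
      obtain ⟨a, b⟩ := chainT_good h (l := k) (by omega)
      obtain ⟨a', b'⟩ := chainT_good h hk
      exact stepDens_eq (by omega) a b a' b'
  exact key m le_rfl

lemma Wd_eq_zero {m n : ℕ} {μ : Arr m n} (h : ¬ chainT μ) : Wd n μ = 0 := by
  by_contra hcon
  exact h fun l hl => Wd_ne_zero hcon hl

/-! ### Row-wise multiplication -/

open scoped ComplexOrder MatrixOrder Matrix Matrix.Norms.L2Operator in
lemma exists_sqrt {n : ℕ} {S : Matrix (Fin n) (Fin n) ℂ} (hS : S.PosSemidef) :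
    ∃ R : Matrix (Fin n) (Fin n) ℂ, Rᴴ = R ∧ R * R = S :=
  ⟨CFC.sqrt S, (Matrix.nonneg_iff_posSemidef.1 (CFC.sqrt_nonneg S)).1, CFC.sqrt_mul_sqrt_self S hS.nonneg⟩

open scoped Matrix in
lemma gramC_rowmul {n : ℕ} (l : ℕ) (R : Matrix (Fin n) (Fin n) ℂ) (Z : ℕ → Fin n → ℂ) :
    gramC l (fun i => Rᵀ *ᵥ Z i) = Rᴴ * gramC l Z * R := by
  have h : (Matrix.of fun (i : Fin l) (a : Fin n) => (Rᵀ *ᵥ Z i) a) =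
      (Matrix.of fun (i : Fin l) (a : Fin n) => Z i a) * R := by
    ext i a
    simp [Matrix.mul_apply, Matrix.mulVec, dotProduct, mul_comm]
  rw [gramC_eq, gramC_eq, h, Matrix.conjTranspose_mul]
  simp only [Matrix.mul_assoc]

open scoped Matrix in
lemma extZ_rowmul {m n : ℕ} (M : Matrix (Fin n) (Fin n) ℂ) (Z : Fin m → Fin n → ℂ) :
    extZ (fun i => M *ᵥ Z i) = fun i => M *ᵥ extZ Z i := by
  funext i
  unfold extZ
  split_ifs <;> simp

/-- Gram matrix of a finite family -/
def gr {k n : ℕ} (X : Fin k → Fin n → ℂ) : Matrix (Fin n) (Fin n) ℂ := gramC k (extZ X)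

open scoped ComplexOrder in
lemma gr_psd {k n : ℕ} (X : Fin k → Fin n → ℂ) : (gr X).PosSemidef := gramC_posSemidef _ _

open scoped Matrix in
lemma gr_rowmul {k n : ℕ} (R : Matrix (Fin n) (Fin n) ℂ) (X : Fin k → Fin n → ℂ) :
    gr (fun i => Rᵀ *ᵥ X i) = Rᴴ * gr X * R := by
  rw [gr, extZ_rowmul, gramC_rowmul]; rfl

/-- squared norm -/
def nsq {k n : ℕ} (X : Fin k → Fin n → ℂ) : ℝ := ∑ i, ∑ a, Complex.normSq (X i a)

lemma nsq_eq {k n : ℕ} (X : Fin k → Fin n → ℂ) : nsq X = (gr X).trace.re := by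
  simp only [nsq, gr, gramC, Matrix.trace, Matrix.diag, Matrix.of_apply]
  rw [sum_comm, Complex.re_sum]
  refine sum_congr rfl fun a _ => ?_
  rw [sum_range, Complex.re_sum]
  refine sum_congr rfl fun i _ => ?_
  rw [Complex.normSq_eq_conj_mul_self.symm, Complex.ofReal_re]
  simp [extZ]

open scoped Matrix in
lemma nsq_rowmul {k n : ℕ} {R : Matrix (Fin n) (Fin n) ℂ} (hR : Rᴴ = R) (X : Fin k → Fin n → ℂ) :
    nsq (fun i => Rᵀ *ᵥ X i) = (gr X * (R * R)).trace.re := by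
  rw [nsq_eq, gr_rowmul, hR, Matrix.mul_assoc, Matrix.trace_mul_comm, Matrix.mul_assoc]

open scoped Matrix in
lemma measurable_rowmul {k n : ℕ} (M : Matrix (Fin n) (Fin n) ℂ) :
    Measurable fun (X : Fin k → Fin n → ℂ) (i : Fin k) => M *ᵥ X i :=
  measurable_pi_lambda _ fun i => (measurable_mulVec M).comp (measurable_pi_apply i)

open scoped Matrix in
lemma lintegral_rowmul {k n : ℕ} {M : Matrix (Fin n) (Fin n) ℂ} (hM : M.det ≠ 0)
    {H : (Fin k → Fin n → ℂ) → ℝ≥0∞} (hH : Measurable H) :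
    ∫⁻ X : Fin k → Fin n → ℂ, H (fun i => M *ᵥ X i) =
      ENNReal.ofReal ((Complex.normSq M.det)⁻¹) ^ k * ∫⁻ X, H X := by
  have hmap := map_mulVec M hM
  have hc0 : ENNReal.ofReal ((Complex.normSq M.det)⁻¹) ≠ 0 := by
    have : 0 < Complex.normSq M.det := Complex.normSq_pos.2 hM
    rw [Ne, ENNReal.ofReal_eq_zero, not_le]; positivity
  have hct : ENNReal.ofReal ((Complex.normSq M.det)⁻¹) ≠ ⊤ := ENNReal.ofReal_ne_top
  generalize ENNReal.ofReal ((Complex.normSq M.det)⁻¹) = c at *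
  have h1 : Measure.map (fun (X : Fin k → Fin n → ℂ) (i : Fin k) => M *ᵥ X i) volume =
      c ^ k • volume := by
    have h2 : (volume : Measure (Fin k → Fin n → ℂ)) = (c ^ k)⁻¹ •
        Measure.map (fun (X : Fin k → Fin n → ℂ) (i : Fin k) => M *ᵥ X i) volume := by
      rw [volume_pi]
      refine Measure.pi_eq fun s hs => ?_
      have hs' : ∀ i, volume ((fun x : Fin n → ℂ => M *ᵥ x) ⁻¹' s i) = c * volume (s i) := by
        intro i
        rw [← Measure.map_apply (measurable_mulVec M) (hs i), hmap, Measure.smul_apply, smul_eq_mul]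
      have hpre : (fun (X : Fin k → Fin n → ℂ) (i : Fin k) => M *ᵥ X i) ⁻¹' (Set.univ.pi s) =
          Set.univ.pi fun i => (fun x : Fin n → ℂ => M *ᵥ x) ⁻¹' s i := by
        ext X; simp
      rw [Measure.smul_apply, Measure.map_apply (measurable_rowmul M) (MeasurableSet.univ_pi hs),
        hpre, Measure.pi_pi]
      simp only [hs', prod_mul_distrib, prod_const, card_univ, Fintype.card_fin, smul_eq_mul]
      rw [← mul_assoc, ENNReal.inv_mul_cancel (pow_ne_zero _ hc0) (ENNReal.pow_ne_top hct), one_mul]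
    conv_rhs => rw [h2]
    rw [smul_smul, ENNReal.mul_inv_cancel (pow_ne_zero _ hc0) (ENNReal.pow_ne_top hct), one_smul]
  rw [← lintegral_map hH (measurable_rowmul M), h1, lintegral_smul_measure, smul_eq_mul]

lemma measurable_gr_entry {α : Type*} [MeasurableSpace α] {k n : ℕ} {X : α → Fin k → Fin n → ℂ}
    (hX : Measurable X) (a b : Fin n) : Measurable fun x => gr (X x) a b :=
  measurable_gramC_entry k (fun x => extZ (X x)) (fun i a => (measurable_extZ i a).comp hX) a b

lemma measurable_det {α : Type*} [MeasurableSpace α] {n : ℕ} {M : α → Matrix (Fin n) (Fin n) ℂ}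
    (hM : ∀ a b, Measurable fun x => M x a b) : Measurable fun x => (M x).det := by
  simp only [Matrix.det_apply]
  refine Finset.measurable_sum _ fun σ _ => ?_
  exact (Finset.measurable_prod _ fun i _ => hM _ _).const_smul _

lemma measurable_trace_mul {α : Type*} [MeasurableSpace α] {n : ℕ} {M N : α → Matrix (Fin n) (Fin n) ℂ}
    (hM : ∀ a b, Measurable fun x => M x a b) (hN : ∀ a b, Measurable fun x => N x a b) :
    Measurable fun x => (M x * N x).trace := by
  simp only [Matrix.trace, Matrix.diag, Matrix.mul_apply]
  exact Finset.measurable_sum _ fun i _ => Finset.measurable_sum _ fun j _ => (hM _ _).mul (hN _ _)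

lemma measurable_inv_entry {α : Type*} [MeasurableSpace α] {n : ℕ} {M : α → Matrix (Fin n) (Fin n) ℂ}
    (hM : ∀ a b, Measurable fun x => M x a b) (a b : Fin n) : Measurable fun x => (M x)⁻¹ a b := by
  simp only [Matrix.inv_def, Matrix.smul_apply, smul_eq_mul, Ring.inverse_eq_inv', Matrix.adjugate_apply]
  refine (measurable_det hM).inv.mul (measurable_det fun c d => ?_)
  simp only [Matrix.updateRow_apply]
  split_ifs
  · exact measurable_const
  · exact hM _ _

/-- Jacobi matrix of finite families -/
def Jm {A m n : ℕ} (l : ℕ) (X : Fin A → Fin n → ℂ) (Y : Fin m → Fin n → ℂ) :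
    Matrix (Fin n) (Fin n) ℂ := gr X * (gr X + gramC l (extZ Y))⁻¹

/-- Jacobi array -/
def jArr {A m n : ℕ} (X : Fin A → Fin n → ℂ) (Y : Fin m → Fin n → ℂ) : Arr m n :=
  fun c => eigsDesc (Jm (c.1.1 + 1) X Y) (n - (c.1.1 + 1) + c.1.2)

/-- limiting array in terms of `Z` -/
def Lam {m n : ℕ} (Z : Fin m → Fin n → ℂ) : Arr m n :=
  fun c => eigsDesc ((1 + gramC (c.1.1 + 1) (extZ Z))⁻¹) (n - (c.1.1 + 1) + c.1.2)

lemma Lam_eq {m n : ℕ} (hmn : m ≤ n) (Z : Fin m → Fin n → ℂ) :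
    Lam Z = fun c => (1 + Tarr m (extZ Z) c)⁻¹ := by
  funext c
  have hc := (mem_coords hmn _).1 c.2
  exact eigsDesc_inv_one_add (l := c.1.1 + 1) (by omega) (extZ Z) ⟨c.1.2, by omega⟩

open scoped Matrix in
lemma Jm_charpoly {A m n : ℕ} (l : ℕ) (X : Fin A → Fin n → ℂ) (Z : Fin m → Fin n → ℂ)
    {R : Matrix (Fin n) (Fin n) ℂ} (hR : Rᴴ = R) (hRR : R * R = gr X) (hd : R.det ≠ 0) :
    (Jm l X (fun i => Rᵀ *ᵥ Z i)).charpoly = ((1 + gramC l (extZ Z))⁻¹).charpoly := by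
  have hu : IsUnit R.det := isUnit_iff_ne_zero.2 hd
  have e1 : Jm l X (fun i => Rᵀ *ᵥ Z i) = R * ((1 + gramC l (extZ Z))⁻¹ * R⁻¹) := by
    rw [Jm, extZ_rowmul, gramC_rowmul, ← hRR, hR]
    have : R * R + R * gramC l (extZ Z) * R = R * ((1 + gramC l (extZ Z)) * R) := by
      rw [Matrix.add_mul, Matrix.mul_add, Matrix.one_mul, Matrix.mul_assoc]
    rw [this, Matrix.mul_inv_rev, Matrix.mul_inv_rev, Matrix.mul_assoc, Matrix.mul_assoc,
      Matrix.mul_nonsing_inv_cancel_left _ _ hu]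
  rw [e1, Matrix.charpoly_mul_comm, Matrix.mul_assoc, Matrix.nonsing_inv_mul _ hu, Matrix.mul_one]

lemma eigsDesc_congr {n : ℕ} {M N : Matrix (Fin n) (Fin n) ℂ} (h : M.charpoly = N.charpoly) :
    eigsDesc M = eigsDesc N := by
  unfold eigsDesc; rw [h]

open scoped Matrix in
lemma jArr_rowmul {A m n : ℕ} (X : Fin A → Fin n → ℂ) (Z : Fin m → Fin n → ℂ)
    {R : Matrix (Fin n) (Fin n) ℂ} (hR : Rᴴ = R) (hRR : R * R = gr X) (hd : R.det ≠ 0) :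
    jArr X (fun i => Rᵀ *ᵥ Z i) = Lam Z := by
  funext c
  unfold jArr Lam
  rw [eigsDesc_congr (Jm_charpoly _ X Z hR hRR hd)]

open scoped Matrix ComplexOrder in
lemma Jm_real {A m n : ℕ} (l : ℕ) (X : Fin A → Fin n → ℂ) (Y : Fin m → Fin n → ℂ)
    (hX : (gr X).det ≠ 0) :
    ∃ e : Fin n → ℝ, (Jm l X Y).charpoly = ∏ i, (Polynomial.X - Polynomial.C (e i : ℂ)) := by
  obtain ⟨R, hR, hRR⟩ := exists_sqrt (gr_psd X)
  have hd : R.det ≠ 0 := by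
    intro h; apply hX; rw [← hRR, Matrix.det_mul, h, zero_mul]
  have hu : IsUnit (Rᵀ).det := by rw [Matrix.det_transpose]; exact isUnit_iff_ne_zero.2 hd
  have hY : Y = fun i => Rᵀ *ᵥ (fun i => (Rᵀ)⁻¹ *ᵥ Y i) i := by
    funext i
    rw [Matrix.mulVec_mulVec, Matrix.mul_nonsing_inv _ hu, Matrix.one_mulVec]
  rw [hY, Jm_charpoly l X _ hR hRR hd]
  have hh : ((1 + gramC l (extZ fun i => (Rᵀ)⁻¹ *ᵥ Y i))⁻¹).IsHermitian :=
    (Matrix.isHermitian_one.add (gramC_posSemidef _ _).1).inv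
  exact ⟨hh.eigenvalues, hh.charpoly_eq⟩

/-- measurable version of the Jacobi array -/
def jArr0 {A m n : ℕ} (x : (Fin A → Fin n → ℂ) × (Fin m → Fin n → ℂ)) : Arr m n :=
  fun c => eigsDesc (if (gr x.1).det = 0 then 0 else Jm (c.1.1 + 1) x.1 x.2) (n - (c.1.1 + 1) + c.1.2)

lemma jArr0_eq {A m n : ℕ} (x : (Fin A → Fin n → ℂ) × (Fin m → Fin n → ℂ)) (h : (gr x.1).det ≠ 0) :
    jArr0 x = jArr x.1 x.2 := by
  funext c; simp [jArr0, jArr, h]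

lemma measurable_jArr0 {A m n : ℕ} (hmn : m ≤ n) :
    Measurable (jArr0 : (Fin A → Fin n → ℂ) × (Fin m → Fin n → ℂ) → Arr m n) := by
  refine measurable_pi_lambda _ fun c => ?_
  have hc := (mem_coords hmn _).1 c.2
  have hg : ∀ a b, Measurable fun x : (Fin A → Fin n → ℂ) × (Fin m → Fin n → ℂ) => gr x.1 a b :=
    fun a b => measurable_gr_entry measurable_fst a b
  have hg2 : ∀ a b, Measurable fun x : (Fin A → Fin n → ℂ) × (Fin m → Fin n → ℂ) =>
      gramC (c.1.1 + 1) (extZ x.2) a b :=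
    fun a b => measurable_gramC_entry _ (fun x : (Fin A → Fin n → ℂ) × (Fin m → Fin n → ℂ) => extZ x.2)
      (fun i a => (measurable_extZ i a).comp measurable_snd) a b
  refine measurable_eigsDesc (fun x : (Fin A → Fin n → ℂ) × (Fin m → Fin n → ℂ) =>
    if (gr x.1).det = 0 then 0 else Jm (c.1.1 + 1) x.1 x.2) (fun a b => ?_) (fun x => ?_)
    ⟨n - (c.1.1 + 1) + c.1.2, by omega⟩
  · have : (fun x : (Fin A → Fin n → ℂ) × (Fin m → Fin n → ℂ) =>
        (if (gr x.1).det = 0 then 0 else Jm (c.1.1 + 1) x.1 x.2) a b) =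
        fun x => if (gr x.1).det = 0 then 0 else Jm (c.1.1 + 1) x.1 x.2 a b := by
      funext x; split_ifs <;> rfl
    rw [this]
    refine Measurable.ite (measurable_det hg (measurableSet_singleton 0)) measurable_const ?_
    simp only [Jm, Matrix.mul_apply]
    refine Finset.measurable_sum _ fun i _ => (hg a i).mul ?_
    refine measurable_inv_entry (fun a b => ?_) i b
    simp only [Matrix.add_apply]
    exact (hg a b).add (hg2 a b)
  · by_cases h : (gr x.1).det = 0
    · refine ⟨0, ?_⟩
      simp [h, Matrix.charpoly_zero]
    · simp only [h, if_false]
      exact Jm_real _ _ _ h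

/-! ### Gaussian reduction -/

open scoped ComplexOrder in
lemma ae_posDef {A n : ℕ} (hnA : n ≤ A) : ∀ᵐ X : Fin A → Fin n → ℂ, (gr X).PosDef := by
  induction A, hnA using Nat.le_induction with
  | base =>
    filter_upwards [ae_good (le_refl n)] with X hX
    refine (gr_psd X).posDef_iff_isUnit.2 ?_
    rw [Matrix.isUnit_iff_isUnit_det, isUnit_iff_ne_zero]
    have h := (tl_spec le_rfl (extZ X)).2.2
    have h1 := Matrix.eval_charpoly (gr X) 0
    have h2 : (gr X).charpoly = ∏ i, (Polynomial.X - Polynomial.C ((dvec n (tl n (extZ X)) i : ℝ) : ℂ)) := h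
    rw [h2, map_zero, zero_sub, Matrix.det_neg, Polynomial.eval_prod] at h1
    intro h0
    rw [h0, mul_zero, prod_eq_zero_iff] at h1
    obtain ⟨i, -, hi⟩ := h1
    simp only [Polynomial.eval_sub, Polynomial.eval_X, Polynomial.eval_C, zero_sub, neg_eq_zero,
      Complex.ofReal_eq_zero, dvec, i.2, dif_pos] at hi
    exact (hX.2 _).ne' hi
  | succ A hA ih =>
    have e1 := volume_preserving_piFinSuccAbove (fun _ : Fin (A + 1) => Fin n → ℂ) (Fin.last A)
    have e2 : Measure.QuasiMeasurePreserving (fun X : Fin (A + 1) → Fin n → ℂ =>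
        ((MeasurableEquiv.piFinSuccAbove (fun _ : Fin (A + 1) => Fin n → ℂ) (Fin.last A)) X).2)
        volume volume :=
      Measure.quasiMeasurePreserving_snd.comp e1.quasiMeasurePreserving
    filter_upwards [e2.ae ih] with X hX
    set x := (MeasurableEquiv.piFinSuccAbove (fun _ : Fin (A + 1) => Fin n → ℂ) (Fin.last A)) X with hx
    have hX' : X = Fin.insertNth (α := fun _ => Fin n → ℂ) (Fin.last A) x.1 x.2 := by
      have := (MeasurableEquiv.piFinSuccAbove (fun _ : Fin (A + 1) => Fin n → ℂ) (Fin.last A)).symm_apply_apply X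
      rw [← hx] at this
      exact this.symm
    have : gr X = gr x.2 + Matrix.vecMulVec (star x.1) x.1 := by
      conv_lhs => rw [hX']
      rw [gr, extZ_insertNth, gramC_succ, Function.update_self]
      congr 1
      refine gramC_congr A fun i hi => ?_
      rw [Function.update_of_ne hi.ne]
    rw [this]
    exact hX.add_posSemidef (Matrix.posSemidef_vecMulVec_star_self _)

open scoped Matrix ComplexOrder in
lemma sqrt_det {n : ℕ} {S R : Matrix (Fin n) (Fin n) ℂ} (hR : Rᴴ = R) (hRR : R * R = S) :
    Complex.normSq R.det = S.det.re := by
  have h1 : (starRingEnd ℂ) R.det = R.det := by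
    have := Matrix.det_conjTranspose R
    rw [hR] at this
    exact this.symm
  have h2 : (Complex.normSq R.det : ℂ) = S.det := by
    rw [Complex.normSq_eq_conj_mul_self, h1, ← Matrix.det_mul, hRR]
  rw [← h2, Complex.ofReal_re]

lemma measurable_Lam {m n : ℕ} (hmn : m ≤ n) : Measurable (Lam : (Fin m → Fin n → ℂ) → Arr m n) := by
  have : (Lam : (Fin m → Fin n → ℂ) → Arr m n) = fun Z c => (1 + Tarr m (extZ Z) c)⁻¹ := by
    funext Z; rw [Lam_eq hmn]
  rw [this]
  have hT : Measurable fun Z : Fin m → Fin n → ℂ => (Tarr m (extZ Z) : Arr m n) :=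
    measurable_Tarr hmn (fun Z : Fin m → Fin n → ℂ => extZ Z) (fun i a => measurable_extZ i a)
  exact measurable_pi_lambda _ fun c => (measurable_const.add ((measurable_pi_apply c).comp hT)).inv

lemma measurable_nsq {k n : ℕ} : Measurable (nsq : (Fin k → Fin n → ℂ) → ℝ) := by
  unfold nsq
  refine Finset.measurable_sum _ fun i _ => Finset.measurable_sum _ fun a _ => ?_
  exact measurable_normSq.comp (by fun_prop)

open scoped Matrix ComplexOrder in
lemma gauss1 {A m n : ℕ} (hmn : m ≤ n) (X : Fin A → Fin n → ℂ) (hX : (gr X).PosDef)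
    {G : Arr m n → ℝ≥0∞} (hG : Measurable G) :
    ∫⁻ Y : Fin m → Fin n → ℂ, ENNReal.ofReal (Real.exp (-nsq Y)) * G (jArr0 (X, Y)) =
      ENNReal.ofReal ((gr X).det.re) ^ m *
        ∫⁻ Z : Fin m → Fin n → ℂ, ENNReal.ofReal (Real.exp (-(gr Z * gr X).trace.re)) * G (Lam Z) := by
  obtain ⟨R, hR, hRR⟩ := exists_sqrt hX.posSemidef
  have hdX : (gr X).det ≠ 0 := hX.det_pos.ne'
  have hd : R.det ≠ 0 := by
    intro h; apply hdX; rw [← hRR, Matrix.det_mul, h, zero_mul]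
  have hd' : (Rᵀ).det ≠ 0 := by rwa [Matrix.det_transpose]
  have hpos : 0 < (gr X).det.re := (Complex.lt_def.1 hX.det_pos).1
  have hm : Measurable fun Y : Fin m → Fin n → ℂ =>
      ENNReal.ofReal (Real.exp (-nsq Y)) * G (jArr0 (X, Y)) :=
    (measurable_nsq.neg.exp.ennreal_ofReal).mul
      (hG.comp ((measurable_jArr0 hmn).comp measurable_prodMk_left))
  have h := lintegral_rowmul (k := m) hd' hm
  rw [Matrix.det_transpose, sqrt_det hR hRR] at h
  have e : ∀ Z : Fin m → Fin n → ℂ,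
      ENNReal.ofReal (Real.exp (-nsq (fun i => Rᵀ *ᵥ Z i))) * G (jArr0 (X, fun i => Rᵀ *ᵥ Z i)) =
      ENNReal.ofReal (Real.exp (-(gr Z * gr X).trace.re)) * G (Lam Z) := by
    intro Z
    have h0 : jArr0 (X, fun i => Rᵀ *ᵥ Z i) = jArr X (fun i => Rᵀ *ᵥ Z i) :=
      jArr0_eq (X, fun i => Rᵀ *ᵥ Z i) hdX
    rw [nsq_rowmul hR, hRR, h0, jArr_rowmul X Z hR hRR hd]
  simp only [e] at h
  rw [h, ← mul_assoc, ← mul_pow, ← ENNReal.ofReal_mul hpos.le, mul_inv_cancel₀ hpos.ne',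
    ENNReal.ofReal_one, one_pow, one_mul]

/-- normalizing integral -/
def KK (A m n : ℕ) : ℝ≥0∞ :=
  ∫⁻ X : Fin A → Fin n → ℂ, ENNReal.ofReal ((gr X).det.re) ^ m * ENNReal.ofReal (Real.exp (-nsq X))

lemma measurable_detre {α : Type*} [MeasurableSpace α] {k n : ℕ} {X : α → Fin k → Fin n → ℂ}
    (hX : Measurable X) : Measurable fun x => (gr (X x)).det.re :=
  Complex.measurable_re.comp (measurable_det fun a b => measurable_gr_entry hX a b)

open scoped Matrix ComplexOrder in
lemma gauss2 {A m n : ℕ} (B : Matrix (Fin n) (Fin n) ℂ) (hB : B.PosDef) :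
    ∫⁻ X : Fin A → Fin n → ℂ, ENNReal.ofReal ((gr X).det.re) ^ m *
        ENNReal.ofReal (Real.exp (-(gr X * B).trace.re)) =
      ENNReal.ofReal ((B.det.re)⁻¹) ^ (A + m) * KK A m n := by
  obtain ⟨R, hR, hRR⟩ := exists_sqrt hB.posSemidef
  have hdX : B.det ≠ 0 := hB.det_pos.ne'
  have hd : R.det ≠ 0 := by
    intro h; apply hdX; rw [← hRR, Matrix.det_mul, h, zero_mul]
  have hd' : (Rᵀ).det ≠ 0 := by rwa [Matrix.det_transpose]
  have hpos : 0 < B.det.re := (Complex.lt_def.1 hB.det_pos).1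
  have him : B.det.im = 0 := (Complex.lt_def.1 hB.det_pos).2.symm
  have hm : Measurable fun X : Fin A → Fin n → ℂ =>
      ENNReal.ofReal ((gr X).det.re) ^ m * ENNReal.ofReal (Real.exp (-nsq X)) :=
    ((measurable_detre measurable_id).ennreal_ofReal.pow_const m).mul
      measurable_nsq.neg.exp.ennreal_ofReal
  have h := lintegral_rowmul (k := A) hd' hm
  rw [Matrix.det_transpose, sqrt_det hR hRR] at h
  have e : ∀ X : Fin A → Fin n → ℂ,
      ENNReal.ofReal ((gr (fun i => Rᵀ *ᵥ X i)).det.re) ^ m *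
        ENNReal.ofReal (Real.exp (-nsq (fun i => Rᵀ *ᵥ X i))) =
      ENNReal.ofReal B.det.re ^ m * (ENNReal.ofReal ((gr X).det.re) ^ m *
        ENNReal.ofReal (Real.exp (-(gr X * B).trace.re))) := by
    intro X
    have : (gr (fun i => Rᵀ *ᵥ X i)).det.re = B.det.re * (gr X).det.re := by
      rw [gr_rowmul, hR, Matrix.det_mul, Matrix.det_mul, mul_right_comm, ← Matrix.det_mul, hRR,
        Complex.mul_re, him]; ring
    rw [nsq_rowmul hR, hRR, this, ENNReal.ofReal_mul hpos.le, mul_pow, mul_assoc]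
  rw [lintegral_congr e] at h
  rw [lintegral_const_mul' _ _ (ENNReal.pow_ne_top ENNReal.ofReal_ne_top)] at h
  have h2 := congrArg (fun t => ENNReal.ofReal ((B.det.re)⁻¹) ^ m * t) h
  beta_reduce at h2
  rw [← mul_assoc, ← mul_pow, ← ENNReal.ofReal_mul (inv_nonneg.2 hpos.le), inv_mul_cancel₀ hpos.ne',
    ENNReal.ofReal_one, one_pow, one_mul, ← mul_assoc, ← pow_add, add_comm m A] at h2
  rw [h2, KK]

open scoped Matrix ComplexOrder in
theorem gauss_main {A m n : ℕ} (hmn : m ≤ n) (hnA : n ≤ A)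
    {G : Arr m n → ℝ≥0∞} (hG : Measurable G) :
    ∫⁻ x : (Fin A → Fin n → ℂ) × (Fin m → Fin n → ℂ),
      ENNReal.ofReal (Real.exp (-nsq x.1)) * (ENNReal.ofReal (Real.exp (-nsq x.2)) * G (jArr0 x)) =
    KK A m n * ∫⁻ Z : Fin m → Fin n → ℂ, G (Lam Z) *
      ENNReal.ofReal ((∏ i, (1 + tl m (extZ Z) i))⁻¹) ^ (A + m) := by
  have hm1 : Measurable fun x : (Fin A → Fin n → ℂ) × (Fin m → Fin n → ℂ) =>
      ENNReal.ofReal (Real.exp (-nsq x.1)) * (ENNReal.ofReal (Real.exp (-nsq x.2)) * G (jArr0 x)) :=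
    (measurable_nsq.comp measurable_fst).neg.exp.ennreal_ofReal.mul
      ((measurable_nsq.comp measurable_snd).neg.exp.ennreal_ofReal.mul (hG.comp (measurable_jArr0 hmn)))
  have hgX : ∀ a b, Measurable fun x : (Fin A → Fin n → ℂ) × (Fin m → Fin n → ℂ) => gr x.1 a b :=
    fun a b => measurable_gr_entry measurable_fst a b
  have hgZ : ∀ a b, Measurable fun x : (Fin A → Fin n → ℂ) × (Fin m → Fin n → ℂ) => gr x.2 a b :=
    fun a b => measurable_gr_entry measurable_snd a b
  have hB : ∀ a b, Measurable fun x : (Fin A → Fin n → ℂ) × (Fin m → Fin n → ℂ) =>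
      (1 + gr x.2) a b := by
    intro a b
    simp only [Matrix.add_apply]
    exact measurable_const.add (hgZ a b)
  have hm2 : Measurable fun x : (Fin A → Fin n → ℂ) × (Fin m → Fin n → ℂ) =>
      G (Lam x.2) * (ENNReal.ofReal ((gr x.1).det.re) ^ m *
        ENNReal.ofReal (Real.exp (-(gr x.1 * (1 + gr x.2)).trace.re))) :=
    (hG.comp ((measurable_Lam hmn).comp measurable_snd)).mul
      (((measurable_detre measurable_fst).ennreal_ofReal.pow_const m).mul
        (Complex.measurable_re.comp (measurable_trace_mul hgX hB)).neg.exp.ennreal_ofReal)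
  rw [Measure.volume_eq_prod, lintegral_prod _ hm1.aemeasurable]
  have step : ∀ᵐ X : Fin A → Fin n → ℂ, ∫⁻ Y : Fin m → Fin n → ℂ,
      ENNReal.ofReal (Real.exp (-nsq X)) * (ENNReal.ofReal (Real.exp (-nsq Y)) * G (jArr0 (X, Y))) =
      ∫⁻ Z : Fin m → Fin n → ℂ, G (Lam Z) * (ENNReal.ofReal ((gr X).det.re) ^ m *
        ENNReal.ofReal (Real.exp (-(gr X * (1 + gr Z)).trace.re))) := by
    filter_upwards [ae_posDef hnA] with X hX
    rw [lintegral_const_mul' _ _ ENNReal.ofReal_ne_top, gauss1 hmn X hX hG, ← mul_assoc,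
      ← lintegral_const_mul' _ _
        (ENNReal.mul_ne_top ENNReal.ofReal_ne_top (ENNReal.pow_ne_top ENNReal.ofReal_ne_top))]
    refine lintegral_congr fun Z => ?_
    have : Real.exp (-(gr X * (1 + gr Z)).trace.re) =
        Real.exp (-nsq X) * Real.exp (-(gr Z * gr X).trace.re) := by
      rw [← Real.exp_add, nsq_eq, Matrix.mul_add, Matrix.mul_one, Matrix.trace_add,
        Matrix.trace_mul_comm (gr X) (gr Z), Complex.add_re]
      congr 1; ring
    rw [this, ENNReal.ofReal_mul (Real.exp_pos _).le]
    ring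
  rw [lintegral_congr_ae step, lintegral_lintegral_swap hm2.aemeasurable,
    ← lintegral_const_mul]
  · refine lintegral_congr fun Z => ?_
    have hm3 : Measurable fun X : Fin A → Fin n → ℂ => ENNReal.ofReal ((gr X).det.re) ^ m *
        ENNReal.ofReal (Real.exp (-(gr X * (1 + gr Z)).trace.re)) := by
      refine ((measurable_detre measurable_id).ennreal_ofReal.pow_const m).mul ?_
      have h4 : Measurable fun X : Fin A → Fin n → ℂ => (gr X * (1 + gr Z)).trace :=
        measurable_trace_mul (N := fun _ => 1 + gr Z)
          (fun a b => measurable_gr_entry measurable_id a b) (fun a b => measurable_const)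
      exact (Complex.measurable_re.comp h4).neg.exp.ennreal_ofReal
    rw [lintegral_const_mul _ hm3]
    rw [gauss2 (1 + gr Z) (Matrix.PosDef.one.add_posSemidef (gr_psd Z))]
    have : (1 + gr Z).det.re = ∏ i, (1 + tl m (extZ Z) i) := by
      rw [gr, det_one_add_gramC hmn]
      rw [← Complex.ofReal_re (∏ i, (1 + tl m (extZ Z) i))]
      push_cast; rfl
    rw [this]; ring
  · have hT : Measurable fun Z : Fin m → Fin n → ℂ => tl m (extZ Z) :=
      measurable_tl hmn (fun Z : Fin m → Fin n → ℂ => extZ Z) (fun i a => measurable_extZ i a)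
    refine (hG.comp (measurable_Lam hmn)).mul (Measurable.pow_const ?_ _)
    exact (Finset.measurable_prod _ fun i _ =>
      measurable_const.add ((measurable_pi_apply i).comp hT)).inv.ennreal_ofReal

/-! ### The law of the Gaussian entries -/

lemma map_withDensity_comp {α β : Type*} [MeasurableSpace α] [MeasurableSpace β] {μ : Measure α}
    {ν : Measure β} {g : α → β} (hg : MeasurePreserving g μ ν) {f : β → ℝ≥0∞} (hf : Measurable f) :
    Measure.map g (μ.withDensity fun x => f (g x)) = ν.withDensity f := by
  ext s hs
  rw [Measure.map_apply hg.measurable hs, withDensity_apply _ (hg.measurable hs),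
    withDensity_apply _ hs, hg.setLIntegral_comp_preimage hs hf]

/-- density of the standard complex Gaussian -/
def cgd (z : ℂ) : ℝ≥0∞ := ENNReal.ofReal (Real.pi⁻¹ * Real.exp (-Complex.normSq z))

lemma measurable_cgd : Measurable cgd :=
  (measurable_normSq.neg.exp.const_mul _).ennreal_ofReal

lemma complexGaussian_one : complexGaussian 1 = volume.withDensity cgd := by
  have hv : ((1 : ℝ) / 2).toNNReal ≠ 0 := by
    rw [Ne, Real.toNNReal_eq_zero]; norm_num
  have hvr : (((1 : ℝ) / 2).toNNReal : ℝ) = 1 / 2 := Real.coe_toNNReal _ (by norm_num)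
  unfold complexGaussian
  rw [gaussianReal_of_var_ne_zero _ hv, prod_withDensity (measurable_gaussianPDF _ _)
    (measurable_gaussianPDF _ _), ← Measure.volume_eq_prod]
  have h := map_withDensity_comp Complex.volume_preserving_equiv_real_prod.symm measurable_cgd
  rw [← h]
  have e : (fun p : ℝ × ℝ => (⟨p.1, p.2⟩ : ℂ)) = Complex.measurableEquivRealProd.symm := by
    funext p; rfl
  rw [e]
  congr 2
  funext p
  have e2 : Complex.normSq (Complex.measurableEquivRealProd.symm p) = p.1 * p.1 + p.2 * p.2 := by
    rw [← e]; exact Complex.normSq_mk _ _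
  rw [cgd, e2, gaussianPDF, gaussianPDF, ← ENNReal.ofReal_mul (gaussianPDFReal_nonneg _ _ _)]
  congr 1
  simp only [gaussianPDFReal_def, hvr, sub_zero]
  have h1 : 2 * Real.pi * (1 / 2) = Real.pi := by ring
  rw [h1]
  have h2 : (√Real.pi)⁻¹ * (√Real.pi)⁻¹ = Real.pi⁻¹ := by
    rw [← mul_inv, Real.mul_self_sqrt Real.pi_pos.le]
  rw [mul_mul_mul_comm, h2, ← Real.exp_add]
  congr 2; ring

instance cg_prob : IsProbabilityMeasure (complexGaussian 1) := by
  unfold complexGaussian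
  refine Measure.isProbabilityMeasure_map (Measurable.aemeasurable ?_)
  exact Complex.measurableEquivRealProd.symm.measurable

lemma mp_curry (k n : ℕ) :
    MeasurePreserving (fun (x : Fin k × Fin n → ℂ) (i : Fin k) (a : Fin n) => x (i, a)) volume volume := by
  have h : MeasurePreserving (MeasurableEquiv.curry (Fin k) (Fin n) ℂ).symm volume volume := by
    refine ⟨(MeasurableEquiv.curry (Fin k) (Fin n) ℂ).symm.measurable, ?_⟩
    symm
    rw [volume_pi]
    refine Measure.pi_eq fun s hs => ?_
    rw [Measure.map_apply (MeasurableEquiv.curry (Fin k) (Fin n) ℂ).symm.measurable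
      (MeasurableSet.univ_pi hs)]
    have : (MeasurableEquiv.curry (Fin k) (Fin n) ℂ).symm ⁻¹' (Set.univ.pi s) =
        Set.univ.pi fun i => Set.univ.pi fun a => s (i, a) := by
      ext X
      simp only [Set.mem_preimage, Set.mem_univ_pi, Prod.forall]
      rfl
    rw [this, volume_pi_pi, Fintype.prod_prod_type]
    exact prod_congr rfl fun i _ => volume_pi_pi _
  exact h.symm

/-- rearranging the Gaussian entries -/
def Psi (A m n : ℕ) (x : (Fin A × Fin n) ⊕ (Fin m × Fin n) → ℂ) :
    (Fin A → Fin n → ℂ) × (Fin m → Fin n → ℂ) :=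
  (fun i a => x (Sum.inl (i, a)), fun i a => x (Sum.inr (i, a)))

lemma mp_Psi (A m n : ℕ) : MeasurePreserving (Psi A m n) volume volume := by
  have h1 := volume_measurePreserving_sumPiEquivProdPi (fun _ : (Fin A × Fin n) ⊕ (Fin m × Fin n) => ℂ)
  have h2 := (mp_curry A n).prod (mp_curry m n)
  exact h2.comp h1

lemma prod_cgd (k n : ℕ) (x : Fin k → Fin n → ℂ) : ∏ p : Fin k × Fin n, cgd (x p.1 p.2) =
    ENNReal.ofReal Real.pi⁻¹ ^ (k * n) * ENNReal.ofReal (Real.exp (-nsq x)) := by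
  have : Real.exp (-nsq x) = ∏ p : Fin k × Fin n, Real.exp (-Complex.normSq (x p.1 p.2)) := by
    rw [← Real.exp_sum, Fintype.sum_prod_type, nsq]
    simp only [sum_neg_distrib]
  rw [this, ENNReal.ofReal_prod_of_nonneg fun _ _ => (Real.exp_pos _).le]
  simp only [cgd]
  have : ∀ p : Fin k × Fin n, ENNReal.ofReal (Real.pi⁻¹ * Real.exp (-Complex.normSq (x p.1 p.2))) =
      ENNReal.ofReal Real.pi⁻¹ * ENNReal.ofReal (Real.exp (-Complex.normSq (x p.1 p.2))) :=
    fun p => ENNReal.ofReal_mul (inv_nonneg.2 Real.pi_pos.le)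
  simp only [this, prod_mul_distrib, prod_const, card_univ, Fintype.card_prod, Fintype.card_fin]

theorem entries_law {A m n : ℕ}
    {Ω : Type} [MeasurableSpace Ω] (P : Measure Ω) [IsProbabilityMeasure P]
    (X Y : ℕ → ℕ → Ω → ℂ) (hX : ∀ i j, Measurable (X i j)) (hY : ∀ i j, Measurable (Y i j))
    (hindep : iIndepFun
      (Sum.elim (fun p : ℕ × ℕ => X p.1 p.2) (fun p : ℕ × ℕ => Y p.1 p.2)) P)
    (hXg : ∀ i j, Measure.map (X i j) P = complexGaussian 1)
    (hYg : ∀ i j, Measure.map (Y i j) P = complexGaussian 1) :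
    ∃ c : ℝ≥0∞, Measure.map (fun ω => ((fun (i : Fin A) (a : Fin n) => X i a ω),
        (fun (i : Fin m) (a : Fin n) => Y i a ω))) P =
      volume.withDensity fun x : (Fin A → Fin n → ℂ) × (Fin m → Fin n → ℂ) =>
        c * (ENNReal.ofReal (Real.exp (-nsq x.1)) * ENNReal.ofReal (Real.exp (-nsq x.2))) := by
  set g : (Fin A × Fin n) ⊕ (Fin m × Fin n) → (ℕ × ℕ) ⊕ (ℕ × ℕ) :=
    Sum.map (fun p => ((p.1 : ℕ), (p.2 : ℕ))) (fun p => ((p.1 : ℕ), (p.2 : ℕ))) with hg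
  have hinj : Function.Injective g := by
    refine Function.Injective.sumMap ?_ ?_
    · rintro ⟨a, b⟩ ⟨c, d⟩ h
      simp only [Prod.mk.injEq, Fin.val_inj] at h
      rw [h.1, h.2]
    · rintro ⟨a, b⟩ ⟨c, d⟩ h
      simp only [Prod.mk.injEq, Fin.val_inj] at h
      rw [h.1, h.2]
  set W : (ℕ × ℕ) ⊕ (ℕ × ℕ) → Ω → ℂ :=
    Sum.elim (fun p : ℕ × ℕ => X p.1 p.2) (fun p : ℕ × ℕ => Y p.1 p.2) with hW
  have hWm : ∀ i, Measurable (W i) := by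
    rintro (p | p)
    · exact hX _ _
    · exact hY _ _
  have hWg : ∀ i, Measure.map (W i) P = complexGaussian 1 := by
    rintro (p | p)
    · exact hXg _ _
    · exact hYg _ _
  have h1 := hindep.precomp hinj
  rw [iIndepFun_iff_map_fun_eq_pi_map fun i => (hWm (g i)).aemeasurable] at h1
  have : SigmaFinite ((volume : Measure ℂ).withDensity cgd) := by
    rw [← complexGaussian_one]; infer_instance
  simp only [hWg, complexGaussian_one] at h1
  rw [pi_withDensity (fun _ => (volume : Measure ℂ)) (fun _ => cgd) (fun _ => measurable_cgd)] at h1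
  set c := ENNReal.ofReal Real.pi⁻¹ ^ (A * n) * ENNReal.ofReal Real.pi⁻¹ ^ (m * n) with hc
  refine ⟨c, ?_⟩
  have hm : Measurable fun x : (Fin A → Fin n → ℂ) × (Fin m → Fin n → ℂ) =>
        c * (ENNReal.ofReal (Real.exp (-nsq x.1)) * ENNReal.ofReal (Real.exp (-nsq x.2))) :=
    ((measurable_nsq.comp measurable_fst).neg.exp.ennreal_ofReal.mul
      (measurable_nsq.comp measurable_snd).neg.exp.ennreal_ofReal).const_mul c
  rw [← map_withDensity_comp (mp_Psi A m n) hm]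
  have hd : (fun x => c * (ENNReal.ofReal (Real.exp (-nsq (Psi A m n x).1)) *
      ENNReal.ofReal (Real.exp (-nsq (Psi A m n x).2)))) =
      fun x : (Fin A × Fin n) ⊕ (Fin m × Fin n) → ℂ => ∏ i, cgd (x i) := by
    funext x
    rw [Fintype.prod_sum_type]
    have e1 := prod_cgd A n (Psi A m n x).1
    have e2 := prod_cgd m n (Psi A m n x).2
    have e3 : ∏ p : Fin A × Fin n, cgd (x (Sum.inl p)) =
      ∏ p : Fin A × Fin n, cgd ((Psi A m n x).1 p.1 p.2) := rfl
    have e4 : ∏ p : Fin m × Fin n, cgd (x (Sum.inr p)) =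
      ∏ p : Fin m × Fin n, cgd ((Psi A m n x).2 p.1 p.2) := rfl
    rw [e3, e4, e1, e2, hc]; ring
  rw [hd, volume_pi, ← h1, Measure.map_map (mp_Psi A m n).measurable
    (measurable_pi_lambda _ fun i => hWm (g i))]
  rfl

open scoped ComplexOrder in
theorem jac_law {A m n : ℕ} (hmn : m ≤ n) (hnA : n ≤ A)
    {Ω : Type} [MeasurableSpace Ω] (P : Measure Ω) [IsProbabilityMeasure P]
    (X Y : ℕ → ℕ → Ω → ℂ) (hX : ∀ i j, Measurable (X i j)) (hY : ∀ i j, Measurable (Y i j))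
    (hindep : iIndepFun
      (Sum.elim (fun p : ℕ × ℕ => X p.1 p.2) (fun p : ℕ × ℕ => Y p.1 p.2)) P)
    (hXg : ∀ i j, Measure.map (X i j) P = complexGaussian 1)
    (hYg : ∀ i j, Measure.map (Y i j) P = complexGaussian 1) :
    AEMeasurable (fun ω => jacArrC A n m (fun i k => X i k ω) fun i k => Y i k ω) P ∧
    ∃ c : ℝ≥0∞, ∀ G : Arr m n → ℝ≥0∞, Measurable G →
      ∫⁻ ω, G (jacArrC A n m (fun i k => X i k ω) fun i k => Y i k ω) ∂P =
      c * ∫⁻ μ : Arr m n, G (fun c => (1 + μ c)⁻¹) *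
        ENNReal.ofReal ((∏ i, (1 + levF μ m i))⁻¹) ^ (A + m) * Wd n μ := by
  obtain ⟨c1, hc1⟩ := entries_law (A := A) (m := m) (n := n) P X Y hX hY hindep hXg hYg
  set T : Ω → (Fin A → Fin n → ℂ) × (Fin m → Fin n → ℂ) := fun ω =>
    ((fun (i : Fin A) (a : Fin n) => X i a ω), (fun (i : Fin m) (a : Fin n) => Y i a ω)) with hT
  have hTm : Measurable T := by
    refine Measurable.prodMk ?_ ?_
    · exact measurable_pi_lambda _ fun i => measurable_pi_lambda _ fun a => hX _ _
    · exact measurable_pi_lambda _ fun i => measurable_pi_lambda _ fun a => hY _ _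
  have hdm : MeasurableSet {x : (Fin A → Fin n → ℂ) × (Fin m → Fin n → ℂ) | (gr x.1).det ≠ 0} := by
    have : Measurable fun x : (Fin A → Fin n → ℂ) × (Fin m → Fin n → ℂ) => (gr x.1).det :=
      measurable_det fun a b => measurable_gr_entry measurable_fst a b
    exact (this (measurableSet_singleton 0)).compl
  have hae0 : ∀ᵐ x : (Fin A → Fin n → ℂ) × (Fin m → Fin n → ℂ), (gr x.1).det ≠ 0 := by
    have := Measure.quasiMeasurePreserving_fst (μ := (volume : Measure (Fin A → Fin n → ℂ)))
      (ν := (volume : Measure (Fin m → Fin n → ℂ)))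
    filter_upwards [this.ae (ae_posDef hnA)] with x hx
    exact hx.det_pos.ne'
  have hae : ∀ᵐ ω ∂P, (gr (T ω).1).det ≠ 0 := by
    have h : ∀ᵐ x ∂(Measure.map T P), (gr x.1).det ≠ 0 := by
      rw [hc1]; exact (withDensity_absolutelyContinuous _ _) hae0
    exact ae_of_ae_map hTm.aemeasurable h
  have hJ : ∀ᵐ ω ∂P, jacArrC A n m (fun i k => X i k ω) (fun i k => Y i k ω) = jArr0 (T ω) := by
    filter_upwards [hae] with ω hω
    rw [jArr0_eq _ hω]
    funext c
    have hc := (mem_coords hmn _).1 c.2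
    have e1 : (Matrix.of fun a b : Fin n => ∑ i ∈ range A, (starRingEnd ℂ) (X i a ω) * X i b ω) =
        gr (T ω).1 := by
      refine gramC_congr (Z := fun i (a : Fin n) => X i a ω) A fun i hi => ?_
      simp [extZ, hi, hT]
    have e2 : (Matrix.of fun a b : Fin n => ∑ i ∈ range (c.1.1 + 1),
        (starRingEnd ℂ) (Y i a ω) * Y i b ω) = gramC (c.1.1 + 1) (extZ (T ω).2) := by
      refine gramC_congr (Z := fun i (a : Fin n) => Y i a ω) _ fun i hi => ?_
      have : i < m := by omega
      simp [extZ, this, hT]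
    unfold jacArrC jacEigC jacMatC jArr Jm
    rw [e1, e2]
  refine ⟨⟨fun ω => jArr0 (T ω), (measurable_jArr0 hmn).comp hTm, hJ⟩, ?_⟩
  obtain ⟨c2, hc2⟩ := lintegral_Tarr (n := n) m hmn
  refine ⟨c1 * (KK A m n * c2), fun G hG => ?_⟩
  have hGJ : Measurable fun x : (Fin A → Fin n → ℂ) × (Fin m → Fin n → ℂ) => G (jArr0 x) :=
    hG.comp (measurable_jArr0 hmn)
  rw [lintegral_congr_ae (hJ.mono fun ω h => by rw [h]), ← lintegral_map hGJ hTm, hc1]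
  have hm : Measurable fun x : (Fin A → Fin n → ℂ) × (Fin m → Fin n → ℂ) =>
        (ENNReal.ofReal (Real.exp (-nsq x.1)) * ENNReal.ofReal (Real.exp (-nsq x.2))) :=
    ((measurable_nsq.comp measurable_fst).neg.exp.ennreal_ofReal.mul
      (measurable_nsq.comp measurable_snd).neg.exp.ennreal_ofReal)
  rw [lintegral_withDensity_eq_lintegral_mul _ (hm.const_mul c1) hGJ]
  simp only [Pi.mul_apply, mul_assoc]
  rw [lintegral_const_mul]
  swap
  · exact (measurable_nsq.comp measurable_fst).neg.exp.ennreal_ofReal.mul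
      ((measurable_nsq.comp measurable_snd).neg.exp.ennreal_ofReal.mul hGJ)
  rw [gauss_main hmn hnA hG]
  have hmT : Measurable fun μ : Arr m n => G (fun c => (1 + μ c)⁻¹) *
        ENNReal.ofReal ((∏ i, (1 + levF μ m i))⁻¹) ^ (A + m) := by
    refine (hG.comp (measurable_pi_lambda _ fun c =>
      (measurable_const.add (measurable_pi_apply c)).inv)).mul (Measurable.pow_const ?_ _)
    exact (Finset.measurable_prod _ fun i _ =>
      measurable_const.add ((measurable_pi_apply i).comp (measurable_levF m))).inv.ennreal_ofReal
  have h3 := hc2 _ hmT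
  congr 2
  simp only [← mul_assoc]
  rw [← h3]
  refine lintegral_congr fun Z => ?_
  rw [Lam_eq hmn, Tarr_levF hmn _ le_rfl]

/-! ### Change of variables to the Jacobi eigenvalues -/

/-- inverse substitution -/
def psi {m n : ℕ} (x : Arr m n) : Arr m n := fun c => (x c)⁻¹ - 1

lemma lev_psi {m n : ℕ} (hmn : m ≤ n) (x : Arr m n) {l i : ℕ} (hl : l ≤ m) (hi : i < l) :
    lev (psi x) l i = (lev x l i)⁻¹ - 1 := by
  obtain ⟨k, rfl⟩ : ∃ k, l = k + 1 := ⟨l - 1, by omega⟩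
  rw [lev_succ hmn _ (by omega) (by omega), lev_succ hmn _ (by omega) (by omega), psi]

lemma VM_inv {N : ℕ} (x : Fin N → ℝ) (hx : ∀ i, 0 < x i) :
    VM (fun i => (x i)⁻¹ - 1) = (∏ i, ∏ j ∈ Ioi i, (x i - x j)) * ((∏ i, x i) ^ (N - 1))⁻¹ := by
  have h1 : ∏ i, ∏ j ∈ Ioi i, (x i * x j) = (∏ i, x i) ^ (N - 1) := by
    have := Finset.prod_prod_Ioi_mul_eq_prod_prod_off_diag (fun i j : Fin N => x j)
    simp only [prod_const, card_compl, Fintype.card_fin, card_singleton, prod_pow] at this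
    exact this
  rw [← h1, ← prod_inv_distrib, ← prod_mul_distrib, VM]
  refine prod_congr rfl fun i _ => ?_
  rw [← prod_inv_distrib, ← prod_mul_distrib]
  refine prod_congr rfl fun j _ => ?_
  have := (hx i).ne'
  have := (hx j).ne'
  field_simp
  ring

lemma vand_eq {k : ℕ} (x : ℕ → ℝ) : vand k x = ∏ i : Fin k, ∏ j ∈ Ioi i, (x i - x j) := by
  rw [vand, prod_range]
  refine prod_congr rfl fun i _ => ?_
  rw [prod_range, ← prod_filter_mul_prod_filter_not univ (fun j : Fin k => i < j)]
  rw [prod_congr rfl (g := fun j : Fin k => x i - x j) ?_,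
    prod_congr rfl (s₁ := univ.filter fun j : Fin k => ¬ i < j) (g := fun j : Fin k => (1 : ℝ)) ?_]
  · rw [prod_const_one, mul_one]
    refine prod_congr ?_ fun _ _ => rfl
    ext j; simp
  · intro j hj
    have : ¬ (i : ℕ) < j := by simpa using hj
    rw [if_neg this]
  · intro j hj
    have : (i : ℕ) < j := by simpa using hj
    rw [if_pos this]

lemma prod_coords {m n : ℕ} (hmn : m ≤ n) (x : Arr m n) (f : ℝ → ℝ) :
    ∏ c, f (x c) = ∏ l ∈ range m, ∏ i ∈ range (l + 1), f (lev x (l + 1) i) := by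
  rw [← prod_finset_product (coords m n) (range m) (fun l => range (l + 1))
    (f := fun p => f (lev x (p.1 + 1) p.2)),
    ← prod_coe_sort (coords m n) (fun p => f (lev x (p.1 + 1) p.2))]
  · refine prod_congr rfl fun c _ => ?_
    have hc := (mem_coords hmn _).1 c.2
    rw [lev_succ hmn x hc.1 hc.2]
  · intro p
    rw [mem_coords hmn, mem_range, mem_range]; omega

/-- generic arrays -/
def genA {m n : ℕ} (x : Arr m n) : Prop :=
  (∀ c, x c ≠ 0 ∧ x c ≠ 1) ∧ ∀ c d, c ≠ d → x c ≠ x d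

lemma ae_genA (m n : ℕ) : ∀ᵐ x : Arr m n, genA x := by
  unfold genA
  refine Filter.Eventually.and ?_ ?_
  · rw [ae_all_iff]
    intro c
    have h0 := Measure.ae_eval_ne (μ := fun _ : {p // p ∈ coords m n} => (volume : Measure ℝ)) c 0
    have h1 := Measure.ae_eval_ne (μ := fun _ : {p // p ∈ coords m n} => (volume : Measure ℝ)) c 1
    exact h0.and h1
  · rw [ae_all_iff]; intro c
    rw [ae_all_iff]; intro d
    by_cases hcd : c = d
    · exact Filter.Eventually.of_forall fun x h => absurd hcd h
    let L : Arr m n →ₗ[ℝ] ℝ := (LinearMap.proj c : Arr m n →ₗ[ℝ] ℝ) - (LinearMap.proj d : Arr m n →ₗ[ℝ] ℝ)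
    have hL : LinearMap.ker L ≠ ⊤ := by
      intro h
      have : (Pi.single c 1 : Arr m n) ∈ LinearMap.ker L := by rw [h]; trivial
      rw [LinearMap.mem_ker] at this
      simp [L, Pi.single_apply, Ne.symm hcd] at this
    have h0 := Measure.addHaar_submodule (volume : Measure (Arr m n)) (LinearMap.ker L) hL
    refine (measure_eq_zero_iff_ae_notMem.1 h0).mono fun x hx _ h => hx ?_
    rw [SetLike.mem_coe, LinearMap.mem_ker]
    simp [L, h]

lemma supp_iff {m n : ℕ} (hmn : m ≤ n) {x : Arr m n} (hg : genA x) :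
    jacSupp x ↔ (∀ c, x c ∈ Set.Ioo (0 : ℝ) 1) ∧ chainT (psi x) := by
  have hne : ∀ l i i', 1 ≤ l → l < m → i < l → i' < l + 1 → lev x l i ≠ lev x (l + 1) i' := by
    intro l i i' h1 h2 h3 h4
    obtain ⟨k, rfl⟩ : ∃ k, l = k + 1 := ⟨l - 1, by omega⟩
    rw [lev_succ hmn _ (by omega) (by omega), lev_succ hmn _ (by omega) (by omega)]
    refine hg.2 _ _ ?_
    intro h
    have := congrArg (fun c => c.1.1) h
    simp at this
  constructor
  · rintro ⟨h1, h2⟩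
    have hb : ∀ c, x c ∈ Set.Ioo (0 : ℝ) 1 := by
      intro c
      have hc := (mem_coords hmn _).1 c.2
      have := h2 (c.1.1 + 1) c.1.2 (by omega) (by omega) (by rw [lt_min_iff]; omega)
      rw [lev_succ hmn x hc.1 hc.2] at this
      exact ⟨lt_of_le_of_ne this.1 (hg.1 c).1.symm, lt_of_le_of_ne this.2 (hg.1 c).2⟩
    have hbl : ∀ l i, l ≤ m → i < l → lev x l i ∈ Set.Ioo (0 : ℝ) 1 := by
      intro l i hl hi
      obtain ⟨k, rfl⟩ : ∃ k, l = k + 1 := ⟨l - 1, by omega⟩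
      rw [lev_succ hmn _ (by omega) (by omega)]; exact hb _
    refine ⟨hb, fun l hl => ?_⟩
    have key1 : ∀ k : Fin l, levF (psi x) (l + 1) k.castSucc < levF (psi x) l k := by
      intro k
      have hk := k.2
      have h3 := (h1 l (by omega) hl).1 k (by rw [lt_min_iff]; omega)
      have h4 := hne l k k (by omega) hl hk (by omega)
      have h5 : lev x l k < lev x (l + 1) k := lt_of_le_of_ne h3 h4
      show lev (psi x) (l + 1) k < lev (psi x) l k
      rw [lev_psi hmn x (by omega) (by omega), lev_psi hmn x (by omega) (by omega)]
      have := inv_strictAnti₀ (hbl l k (by omega) hk).1 h5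
      linarith
    have key2 : ∀ k : Fin l, levF (psi x) l k < levF (psi x) (l + 1) k.succ := by
      intro k
      have hk := k.2
      have h3 := (h1 l (by omega) hl).2 k (by rw [lt_min_iff]; omega) (by rw [lt_min_iff]; omega)
      have h4 := hne l k (k + 1) (by omega) hl hk (by omega)
      have h5 : lev x (l + 1) (k + 1) < lev x l k := lt_of_le_of_ne h3 h4.symm
      show lev (psi x) l k < lev (psi x) (l + 1) (k + 1)
      rw [lev_psi hmn x (by omega) (by omega), lev_psi hmn x (by omega) (by omega)]
      have := inv_strictAnti₀ (hbl (l + 1) (k + 1) (by omega) (by omega)).1 h5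
      linarith
    have hmono : StrictMono (levF (psi x) (l + 1)) :=
      Fin.strictMono_iff_lt_succ.2 fun k => (key1 k).trans (key2 k)
    refine ⟨fun i => ?_, fun i j hij => ?_⟩
    · refine Fin.cases ?_ (fun k => ?_) i
      · rw [Fin.cons_zero]
        show 0 < lev (psi x) (l + 1) 0
        rw [lev_psi hmn x (by omega) (by omega)]
        have h := hbl (l + 1) 0 (by omega) (by omega)
        have := (one_lt_inv₀ h.1).2 h.2
        linarith
      · rw [Fin.cons_succ]; exact key2 k
    · obtain ⟨k, rfl⟩ := Fin.exists_succ_eq.2 (Fin.pos_iff_ne_zero.1 (lt_of_le_of_lt (Fin.zero_le i) hij))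
      rw [Fin.cons_succ]
      refine lt_of_le_of_lt (hmono.monotone ?_) (key1 k)
      rw [Fin.le_def, Fin.val_castSucc]
      rw [Fin.lt_def, Fin.val_succ] at hij
      omega
  · rintro ⟨hb, hc⟩
    have hbl : ∀ l i, l ≤ m → i < l → lev x l i ∈ Set.Ioo (0 : ℝ) 1 := by
      intro l i hl hi
      obtain ⟨k, rfl⟩ : ∃ k, l = k + 1 := ⟨l - 1, by omega⟩
      rw [lev_succ hmn _ (by omega) (by omega)]; exact hb _
    refine ⟨fun l hl1 hl => ?_, fun l i hl1 hl hi => ?_⟩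
    · obtain ⟨a, b⟩ := hc l hl
      refine ⟨fun i hi => ?_, fun i hi _ => ?_⟩
      · have hi' : i < l := (lt_min_iff.1 hi).1
        have := b (Fin.castSucc ⟨i, hi'⟩) (Fin.succ ⟨i, hi'⟩) (Fin.castSucc_lt_succ)
        rw [Fin.cons_succ] at this
        change lev (psi x) (l + 1) i < lev (psi x) l i at this
        rw [lev_psi hmn x (by omega) (by omega), lev_psi hmn x (by omega) (by omega)] at this
        have h2 : (lev x (l + 1) i)⁻¹ < (lev x l i)⁻¹ := by linarith
        exact ((inv_lt_inv₀ (hbl _ _ (by omega) (by omega)).1 (hbl _ _ (by omega) (by omega)).1).1 h2).le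
      · have hi' : i < l := (lt_min_iff.1 hi).1
        have := a (Fin.succ ⟨i, hi'⟩)
        rw [Fin.cons_succ] at this
        change lev (psi x) l i < lev (psi x) (l + 1) (i + 1) at this
        rw [lev_psi hmn x (by omega) (by omega), lev_psi hmn x (by omega) (by omega)] at this
        have h2 : (lev x l i)⁻¹ < (lev x (l + 1) (i + 1))⁻¹ := by linarith
        exact ((inv_lt_inv₀ (hbl _ _ (by omega) (by omega)).1 (hbl _ _ (by omega) (by omega)).1).1 h2).le
    · exact Set.Ioo_subset_Icc_self (hbl l i hl (lt_min_iff.1 hi).1)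

lemma dens_value {A m n : ℕ} (hm : 1 ≤ m) (hmn : m ≤ n) (hnA : n ≤ A) {x : Arr m n}
    (hs : jacSupp x) (hb : ∀ c, x c ∈ Set.Ioo (0 : ℝ) 1) :
    ((∏ i, (1 + levF (psi x) m i))⁻¹) ^ (A + m) * Fw n m (levF (psi x) m) * ∏ c, ((x c) ^ 2)⁻¹ =
      jacDens2 A n m x := by
  have hbl : ∀ l i, l ≤ m → i < l → lev x l i ∈ Set.Ioo (0 : ℝ) 1 := by
    intro l i hl hi
    obtain ⟨k, rfl⟩ : ∃ k, l = k + 1 := ⟨l - 1, by omega⟩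
    rw [lev_succ hmn _ (by omega) (by omega)]; exact hb _
  have e0 : levF (psi x) m = fun i : Fin m => (lev x m i)⁻¹ - 1 := by
    funext i; exact lev_psi hmn x le_rfl i.2
  have hpos : ∀ i : Fin m, 0 < lev x m i := fun i => (hbl m i le_rfl i.2).1
  have e1 : VM (levF (psi x) m) = vand m (lev x m) * ((∏ i : Fin m, lev x m i) ^ (m - 1))⁻¹ := by
    rw [e0, VM_inv (fun i : Fin m => lev x m i) hpos, vand_eq]
  have hP : 0 < ∏ i : Fin m, lev x m i := prod_pos fun i _ => hpos i
  have e2 : ∏ i, (1 + levF (psi x) m i) = (∏ i : Fin m, lev x m i)⁻¹ := by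
    rw [e0, ← prod_inv_distrib]; exact prod_congr rfl fun i _ => by ring
  have e3 : ∏ i, levF (psi x) m i = (∏ i : Fin m, (1 - lev x m i)) * (∏ i : Fin m, lev x m i)⁻¹ := by
    rw [e0, ← prod_inv_distrib, ← prod_mul_distrib]
    refine prod_congr rfl fun i _ => ?_
    have := (hpos i).ne'
    field_simp
  have e4 : ∏ c, ((x c) ^ 2)⁻¹ = (∏ l ∈ Ico 1 m, ∏ i ∈ range l, ((lev x l i) ^ 2)⁻¹) *
      ((∏ i : Fin m, lev x m i) ^ 2)⁻¹ := by
    rw [prod_coords hmn x (fun t => (t ^ 2)⁻¹)]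
    obtain ⟨k, rfl⟩ : ∃ k, m = k + 1 := ⟨m - 1, by omega⟩
    rw [prod_range_succ, prod_Ico_eq_prod_range]
    congr 1
    · rw [Nat.add_sub_cancel]
      refine prod_congr rfl fun l _ => ?_
      rw [add_comm 1 l]
    · rw [← prod_pow, ← prod_inv_distrib, prod_range]
  have hs' : x ∈ {μ : Arr m n | jacSupp μ} := hs
  rw [jacDens2, Set.indicator_of_mem hs', min_eq_left hmn, Fw, e1, e2, e3, e4]
  have e5 : ∏ i ∈ range m, lev x m i ^ ((A : ℝ) + m - n - 1) * (1 - lev x m i) ^ ((n : ℝ) - m) =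
      (∏ i : Fin m, lev x m i) ^ (A + m - n - 1) * (∏ i : Fin m, (1 - lev x m i)) ^ (n - m) := by
    rw [prod_range, ← prod_pow, ← prod_pow, ← prod_mul_distrib]
    refine prod_congr rfl fun i _ => ?_
    have h1 : (A : ℝ) + m - n - 1 = ((A + m - n - 1 : ℕ) : ℝ) := by
      rw [Nat.sub_sub, Nat.cast_sub (by omega)]; push_cast; ring
    have h2 : (n : ℝ) - m = ((n - m : ℕ) : ℝ) := by rw [Nat.cast_sub hmn]
    rw [h1, h2, Real.rpow_natCast, Real.rpow_natCast]
  have e6 : ∏ l ∈ Ico 1 m, ∏ i ∈ range (min l n), lev x l i ^ (-2 : ℝ) =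
      ∏ l ∈ Ico 1 m, ∏ i ∈ range l, ((lev x l i) ^ 2)⁻¹ := by
    refine prod_congr rfl fun l hl => ?_
    rw [mem_Ico] at hl
    rw [min_eq_left (by omega)]
    refine prod_congr rfl fun i hi => ?_
    rw [Real.rpow_neg (hbl l i (by omega) (by simpa using hi)).1.le, Real.rpow_two]
  rw [e5, e6]
  generalize (∏ l ∈ Ico 1 m, ∏ i ∈ range l, ((lev x l i) ^ 2)⁻¹) = R
  generalize (∏ i : Fin m, lev x m i) = p at *
  generalize (∏ i : Fin m, (1 - lev x m i)) = q
  generalize vand m (lev x m) = v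
  rw [inv_inv, show A + m = (A + m - n - 1) + (m - 1) + (n - m) + 2 by omega]
  have hN : A + m - n - 1 = (A + m - n - 1) + (m - 1) + (n - m) + 2 - n - 1 := by omega
  rw [← hN]
  generalize A + m - n - 1 = a
  generalize m - 1 = b
  generalize n - m = d
  rw [mul_pow, pow_add, pow_add, pow_add, inv_pow]
  have := hP.ne'
  field_simp

lemma cov1 : MeasurePreserving (fun x : ℝ => x⁻¹ - 1)
    ((volume.restrict (Set.Ioo 0 1)).withDensity fun x => ENNReal.ofReal ((x ^ 2)⁻¹))
    (volume.restrict (Set.Ioi 0)) := by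
  have hmeas : Measurable fun x : ℝ => x⁻¹ - 1 := measurable_inv.sub_const 1
  refine ⟨hmeas, ?_⟩
  ext s hs
  rw [Measure.map_apply hmeas hs, withDensity_apply _ (hmeas hs)]
  have himg : (fun x : ℝ => x⁻¹ - 1) '' Set.Ioo 0 1 = Set.Ioi 0 := by
    ext y
    constructor
    · rintro ⟨x, hx, rfl⟩
      have := (one_lt_inv₀ hx.1).2 hx.2
      simp only [Set.mem_Ioi]; linarith
    · intro hy
      have hy' : 0 < y := hy
      refine ⟨(1 + y)⁻¹, ⟨by positivity, inv_lt_one_of_one_lt₀ (by linarith)⟩, ?_⟩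
      simp
  have hinj : Set.InjOn (fun x : ℝ => x⁻¹ - 1) (Set.Ioo 0 1) := by
    intro a _ b _ h
    simpa using h
  have hder : ∀ x ∈ Set.Ioo (0 : ℝ) 1,
      HasDerivWithinAt (fun x : ℝ => x⁻¹ - 1) (-(x ^ 2)⁻¹) (Set.Ioo 0 1) x :=
    fun x hx => ((hasDerivAt_inv hx.1.ne').sub_const 1).hasDerivWithinAt
  have h := lintegral_image_eq_lintegral_abs_deriv_mul measurableSet_Ioo hder hinj
    (Set.indicator s 1)
  rw [himg, lintegral_indicator_one hs] at h
  rw [h, ← lintegral_indicator (hmeas hs)]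
  refine lintegral_congr fun x => ?_
  rw [abs_neg, abs_of_nonneg (by positivity)]
  by_cases hx : x⁻¹ - 1 ∈ s
  · have hx' : x ∈ (fun x : ℝ => x⁻¹ - 1) ⁻¹' s := hx
    rw [Set.indicator_of_mem hx', Set.indicator_of_mem hx]; simp
  · have hx' : x ∉ (fun x : ℝ => x⁻¹ - 1) ⁻¹' s := hx
    rw [Set.indicator_of_notMem hx', Set.indicator_of_notMem hx]; simp

lemma measurable_psi {m n : ℕ} : Measurable (psi : Arr m n → Arr m n) :=
  measurable_pi_lambda _ fun c => (measurable_pi_apply c).inv.sub_const 1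

lemma cov {m n : ℕ} {F : Arr m n → ℝ≥0∞} (hF : Measurable F) :
    ∫⁻ μ in (Set.univ.pi fun _ => Set.Ioi 0), F μ =
      ∫⁻ x in (Set.univ.pi fun _ => Set.Ioo 0 1),
        (∏ c, ENNReal.ofReal ((x c ^ 2)⁻¹)) * F (psi x) := by
  have hd : Measurable fun x : ℝ => ENNReal.ofReal ((x ^ 2)⁻¹) :=
    (measurable_id.pow_const 2).inv.ennreal_ofReal
  have hsf : SigmaFinite ((volume.restrict (Set.Ioo (0 : ℝ) 1)).withDensity
      fun x => ENNReal.ofReal ((x ^ 2)⁻¹)) :=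
    SigmaFinite.withDensity_of_ne_top (Filter.Eventually.of_forall fun _ => ENNReal.ofReal_ne_top)
  have h := measurePreserving_pi (ι := {p // p ∈ coords m n})
    (fun _ => (volume.restrict (Set.Ioo (0 : ℝ) 1)).withDensity fun x => ENNReal.ofReal ((x ^ 2)⁻¹))
    (fun _ => volume.restrict (Set.Ioi (0 : ℝ))) (f := fun _ x => x⁻¹ - 1) (fun _ => cov1)
  rw [pi_withDensity (fun _ => volume.restrict (Set.Ioo (0 : ℝ) 1)) (fun _ x => ENNReal.ofReal ((x ^ 2)⁻¹))
    (fun _ => hd), ← Measure.restrict_pi_pi, ← Measure.restrict_pi_pi, ← volume_pi] at h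
  have h2 := h.lintegral_comp hF
  rw [← h2, lintegral_withDensity_eq_lintegral_mul]
  · rfl
  · exact Finset.measurable_prod _ fun c _ => hd.comp (measurable_pi_apply c)
  · exact hF.comp measurable_psi

theorem law_main {A m n : ℕ} (hm : 1 ≤ m) (hmn : m ≤ n) (hnA : n ≤ A)
    {G : Arr m n → ℝ≥0∞} (hG : Measurable G) :
    ∫⁻ μ : Arr m n, G (fun c => (1 + μ c)⁻¹) *
        ENNReal.ofReal ((∏ i, (1 + levF μ m i))⁻¹) ^ (A + m) * Wd n μ =
      ∫⁻ x : Arr m n, G x * ENNReal.ofReal (jacDens2 A n m x) := by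
  set F : Arr m n → ℝ≥0∞ := fun μ => G (fun c => (1 + μ c)⁻¹) *
        ENNReal.ofReal ((∏ i, (1 + levF μ m i))⁻¹) ^ (A + m) * Wd n μ with hFdef
  have hF : Measurable F := by
    refine Measurable.mul ?_ measurable_Wd
    refine (hG.comp (measurable_pi_lambda _ fun c =>
      (measurable_const.add (measurable_pi_apply c)).inv)).mul (Measurable.pow_const ?_ _)
    exact (Finset.measurable_prod _ fun i _ =>
      measurable_const.add ((measurable_pi_apply i).comp (measurable_levF m))).inv.ennreal_ofReal
  have hpos : MeasurableSet (Set.univ.pi fun _ : {p // p ∈ coords m n} => Set.Ioi (0 : ℝ)) :=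
    MeasurableSet.univ_pi fun _ => measurableSet_Ioi
  have hbox : MeasurableSet (Set.univ.pi fun _ : {p // p ∈ coords m n} => Set.Ioo (0 : ℝ) 1) :=
    MeasurableSet.univ_pi fun _ => measurableSet_Ioo
  have e1 : ∫⁻ μ, F μ = ∫⁻ μ in (Set.univ.pi fun _ => Set.Ioi 0), F μ := by
    rw [← lintegral_indicator hpos]
    refine lintegral_congr fun μ => ?_
    by_cases hμ : μ ∈ Set.univ.pi fun _ : {p // p ∈ coords m n} => Set.Ioi (0 : ℝ)
    · rw [Set.indicator_of_mem hμ]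
    · rw [Set.indicator_of_notMem hμ]
      have : ¬ chainT μ := by
        intro hc
        apply hμ
        intro c _
        have hcc := (mem_coords hmn _).1 c.2
        have := (chainT_good hc (l := c.1.1 + 1) (by omega)).2 ⟨c.1.2, by omega⟩
        have h2 := lev_succ hmn μ hcc.1 hcc.2
        change 0 < lev μ (c.1.1 + 1) c.1.2 at this
        rw [h2] at this
        exact this
      simp only [hFdef, Wd_eq_zero this, mul_zero]
  rw [e1, cov hF, ← lintegral_indicator hbox]
  refine lintegral_congr_ae ?_
  filter_upwards [ae_genA m n] with x hx
  have hiff := supp_iff hmn hx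
  by_cases hs : jacSupp x
  · obtain ⟨hb, hc⟩ := hiff.1 hs
    have hxb : x ∈ Set.univ.pi fun _ : {p // p ∈ coords m n} => Set.Ioo (0 : ℝ) 1 := fun c _ => hb c
    rw [Set.indicator_of_mem hxb, ← dens_value hm hmn hnA hs hb]
    have hφ : (fun c => (1 + psi x c)⁻¹) = x := by
      funext c; simp [psi]
    obtain ⟨g1, g2⟩ := chainT_good hc (le_refl m)
    have p1 : 0 ≤ (∏ i, (1 + levF (psi x) m i))⁻¹ :=
      inv_nonneg.2 (prod_nonneg fun i _ => by have := g2 i; linarith)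
    have p2 : 0 < Fw n m (levF (psi x) m) := Fw_pos g1 g2
    simp only [hFdef, hφ, Wd_eq hmn hc]
    rw [ENNReal.ofReal_mul (mul_nonneg (pow_nonneg p1 _) p2.le), ENNReal.ofReal_mul (pow_nonneg p1 _),
      ENNReal.ofReal_pow p1, ENNReal.ofReal_prod_of_nonneg fun c _ => by positivity]
    ring
  · have hz : jacDens2 A n m x = 0 := by
      have hs' : x ∉ {μ : Arr m n | jacSupp μ} := hs
      rw [jacDens2, Set.indicator_of_notMem hs']
    rw [hz, ENNReal.ofReal_zero, mul_zero]
    by_cases hb : x ∈ Set.univ.pi fun _ : {p // p ∈ coords m n} => Set.Ioo (0 : ℝ) 1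
    · rw [Set.indicator_of_mem hb]
      have : ¬ chainT (psi x) := fun hc => hs (hiff.2 ⟨fun c => hb c trivial, hc⟩)
      simp only [hFdef, Wd_eq_zero this, mul_zero]
    · rw [Set.indicator_of_notMem hb]


/-- joint density of the first `m` levels of the β = 2 Jacobi ensemble. -/
theorem jacobi_density_beta2
    (A n m : ℕ) (hm : 1 ≤ m) (hmn : m ≤ n) (hnA : n ≤ A)
    {Ω : Type} [MeasurableSpace Ω] (P : Measure Ω) [IsProbabilityMeasure P]
    (X Y : ℕ → ℕ → Ω → ℂ) (hX : ∀ i j, Measurable (X i j)) (hY : ∀ i j, Measurable (Y i j))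
    (hindep : iIndepFun
      (Sum.elim (fun p : ℕ × ℕ => X p.1 p.2) (fun p : ℕ × ℕ => Y p.1 p.2)) P)
    (hXg : ∀ i j, Measure.map (X i j) P = complexGaussian 1)
    (hYg : ∀ i j, Measure.map (Y i j) P = complexGaussian 1) :
    ∃ C : ℝ, 0 < C ∧
      Measure.map (fun ω => jacArrC A n m (fun i k => X i k ω) fun i k => Y i k ω) P
        = volume.withDensity fun μ : Arr m n =>
            ENNReal.ofReal (C * jacDens2 A n m μ) := by
  obtain ⟨hAE, c, hc⟩ := jac_law hmn hnA P X Y hX hY hindep hXg hYg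
  have hc' : ∀ G : Arr m n → ℝ≥0∞, Measurable G →
      ∫⁻ ω, G (jacArrC A n m (fun i k => X i k ω) fun i k => Y i k ω) ∂P =
      c * ∫⁻ x : Arr m n, G x * ENNReal.ofReal (jacDens2 A n m x) := by
    intro G hG
    rw [hc G hG, law_main hm hmn hnA hG]
  have h1 := hc' (fun _ => 1) measurable_const
  simp only [lintegral_const, measure_univ, mul_one] at h1
  have hc0 : c ≠ 0 := by
    rintro rfl
    rw [zero_mul] at h1
    exact one_ne_zero h1
  have hct : c ≠ ⊤ := by
    rintro rfl
    rw [ENNReal.top_mul'] at h1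
    split_ifs at h1
    · exact one_ne_zero h1
    · exact ENNReal.one_ne_top h1
  have hC : 0 < c.toReal := ENNReal.toReal_pos hc0 hct
  refine ⟨c.toReal, hC, ?_⟩
  ext s hs
  rw [Measure.map_apply_of_aemeasurable hAE hs, withDensity_apply _ hs]
  have h2 := hc' (Set.indicator s 1) (measurable_one.indicator hs)
  have e1 : ∫⁻ ω, Set.indicator s (1 : Arr m n → ℝ≥0∞)
      (jacArrC A n m (fun i k => X i k ω) fun i k => Y i k ω) ∂P =
      P ((fun ω => jacArrC A n m (fun i k => X i k ω) fun i k => Y i k ω) ⁻¹' s) := by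
    have hn := hAE.nullMeasurableSet_preimage hs
    rw [← lintegral_indicator_one₀ hn]
    rfl
  have e2 : ∀ x : Arr m n, Set.indicator s (1 : Arr m n → ℝ≥0∞) x * ENNReal.ofReal (jacDens2 A n m x) =
      Set.indicator s (fun x => ENNReal.ofReal (jacDens2 A n m x)) x := by
    intro x
    by_cases hx : x ∈ s
    · rw [Set.indicator_of_mem hx, Set.indicator_of_mem hx, Pi.one_apply, one_mul]
    · rw [Set.indicator_of_notMem hx, Set.indicator_of_notMem hx, zero_mul]
  rw [← e1, h2, lintegral_congr e2, lintegral_indicator hs, ← lintegral_const_mul' _ _ hct]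
  refine lintegral_congr fun x => ?_
  rw [ENNReal.ofReal_mul hC.le, ENNReal.ofReal_toReal hct]


end RMT
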